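/- Let u ∈ W^{1,p}_{loc}(Ω; Λ^k ℝ^n ⊗ ℝ^N) be a local weak solution of δ(a(x)|du|^{p−2} du) = f in Ω, i.e. for any ball B_R ⊂⊂ Ω, ∫_{B_R} ⟨a(x)|du|^{p−2}du ; dψ⟩ = ∫_{B_R} ⟨f ; ψ⟩ holds for all ψ ∈ W^{1,p}_0(B_R; Λ^k ℝ^n ⊗ ℝ^N). Then u also satisfies ∫_{B_R} ⟨a(x)|du|^{p−2}du ; dφ⟩ = ∫_{B_R} ⟨f ; φ⟩ for all φ ∈ W^{1,p}_{δ,T}(B_R; Λ^k ℝ^n ⊗ ℝ^N). -/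

import Mathlib

open MeasureTheory Metric Filter
open scoped ENNReal NNReal

noncomputable section

/-- Euclidean space `ℝ^n`. -/
abbrev En (n : ℕ) : Type := EuclideanSpace ℝ (Fin n)

/-- Index set for the coefficients of a `k`-form on `ℝ^n`: increasing multi-indices,
identified with `k`-element subsets of `Fin n`. -/
abbrev FormIdx (n k : ℕ) : Type := {s : Finset (Fin n) // s.card = k}

/-- An `ℝ^N`-valued `k`-covector on `ℝ^n`, described by its coefficients. -/
abbrev Form (n N k : ℕ) : Type := FormIdx n k × Fin N → ℝ

variable {n N k : ℕ}

/-- Euclidean inner product of two (vector-valued) forms. -/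
def finner (v w : Form n N k) : ℝ := ∑ q, v q * w q

/-- Euclidean norm of a (vector-valued) form. -/
def fnorm (v : Form n N k) : ℝ := Real.sqrt (∑ q, v q ^ 2)

/-- Euclidean norm of a full array of partial derivatives (a gradient). -/
def gnorm (H : Fin n → Form n N k) : ℝ := Real.sqrt (∑ i, ∑ q, H i q ^ 2)

/-- The pointwise exterior derivative of a `k`-form, assembled from the array
`G i = ∂_i u` of its partial derivatives. -/
def extD (G : Fin n → Form n N k) : Form n N (k + 1) := fun q =>
  ∑ i : Fin n,
    if h : i ∈ q.1.1 then
      (-1 : ℝ) ^ (q.1.1.filter (fun j => j < i)).card *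
        G i (⟨q.1.1.erase i, by simp [Finset.card_erase_of_mem h, q.1.2]⟩, q.2)
    else 0

/-- The pointwise codifferential of a `(k+1)`-form, assembled from the array
`G i = ∂_i u` of its partial derivatives. -/
def codiff (G : Fin n → Form n N (k + 1)) : Form n N k := fun q =>
  -∑ i : Fin n,
      if h : i ∈ q.1.1 then 0
      else
        (-1 : ℝ) ^ (q.1.1.filter (fun j => j < i)).card *
          G i (⟨insert i q.1.1, by simp [Finset.card_insert_of_notMem h, q.1.2]⟩, q.2)

/-- The nonlinearity `z ↦ t |z|^{p-2} z`. -/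
def nl (p t : ℝ) (z : Form n N k) : Form n N k := fun q => t * fnorm z ^ (p - 2) * z q

/-- The auxiliary map `V(z) = |z|^{(p-2)/2} z`. -/
def Vform (p : ℝ) (z : Form n N k) : Form n N k := fun q => fnorm z ^ ((p - 2) / 2) * z q

/-- The `i`-th standard basis vector of `ℝ^n`. -/
def basisVec (i : Fin n) : En n := EuclideanSpace.single i 1

/-- Scalar test functions: smooth and compactly supported inside `Ω`. -/
def IsTestFun (Ω : Set (En n)) (φ : En n → ℝ) : Prop :=
  ContDiff ℝ (⊤ : ℕ∞) φ ∧ HasCompactSupport φ ∧ tsupport φ ⊆ Ω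

/-- Test `k`-forms: componentwise smooth and compactly supported inside `Ω`. -/
def IsTestForm (Ω : Set (En n)) (φ : En n → Form n N k) : Prop :=
  (∀ q, ContDiff ℝ (⊤ : ℕ∞) fun x => φ x q) ∧ HasCompactSupport φ ∧ tsupport φ ⊆ Ω

/-- The (classical) array of partial derivatives of a form-valued map. -/
def smoothGrad (φ : En n → Form n N k) (x : En n) : Fin n → Form n N k := fun i q =>
  fderiv ℝ (fun y => φ y q) x (basisVec i)

/-- `g` is the weak (distributional) `i`-th partial derivative of `u` on `Ω`. -/
def HasWeakPartial (Ω : Set (En n)) (u g : En n → ℝ) (i : Fin n) : Prop :=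
  ∀ φ : En n → ℝ, IsTestFun Ω φ →
    ∫ x in Ω, u x * fderiv ℝ φ x (basisVec i) = -∫ x in Ω, g x * φ x

/-- `G` is the weak gradient (array of weak partial derivatives) of the form `u` on `Ω`. -/
def HasWeakGrad (Ω : Set (En n)) (u : En n → Form n N k)
    (G : En n → Fin n → Form n N k) : Prop :=
  ∀ i q, HasWeakPartial Ω (fun x => u x q) (fun x => G x i q) i

/-- Membership in `W^{1,p}(Ω)` for a form `u` with weak gradient `G`. -/
def MemW1p (Ω : Set (En n)) (p : ℝ) (u : En n → Form n N k)
    (G : En n → Fin n → Form n N k) : Prop :=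
  HasWeakGrad Ω u G ∧
    (∀ q, AEStronglyMeasurable (fun x => u x q) (volume.restrict Ω)) ∧
    (∀ i q, AEStronglyMeasurable (fun x => G x i q) (volume.restrict Ω)) ∧
    IntegrableOn (fun x => fnorm (u x) ^ p) Ω volume ∧
    IntegrableOn (fun x => gnorm (G x) ^ p) Ω volume

/-- Membership in `W^{1,p}_loc(Ω)` for a form `u` with weak gradient `G`. -/
def MemW1pLoc (Ω : Set (En n)) (p : ℝ) (u : En n → Form n N k)
    (G : En n → Fin n → Form n N k) : Prop :=
  HasWeakGrad Ω u G ∧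
    (∀ q, AEStronglyMeasurable (fun x => u x q) (volume.restrict Ω)) ∧
    (∀ i q, AEStronglyMeasurable (fun x => G x i q) (volume.restrict Ω)) ∧
    ∀ K, K ⊆ Ω → IsCompact K →
      IntegrableOn (fun x => fnorm (u x) ^ p) K volume ∧
      IntegrableOn (fun x => gnorm (G x) ^ p) K volume

/-- `δ f = 0` on `Ω` in the sense of distributions: `∫ ⟨f, dψ⟩ = 0` for every smooth
compactly supported form `ψ` of degree one less. (Vacuous for `0`-forms.) -/
def WeaklyCoclosed (Ω : Set (En n)) (f : En n → Form n N k) : Prop :=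
  ∀ (j : ℕ) (h : j + 1 = k) (ψ : En n → Form n N j), IsTestForm Ω ψ →
    ∫ x in Ω, finner (f x) (cast (congrArg (Form n N) h) (extD (smoothGrad ψ x))) = 0

/-- Weak formulation of the vanishing of the tangential part `ν ∧ u = 0` on `∂B`:
the integration-by-parts formula `∫_B ⟨du, ψ⟩ = ∫_B ⟨u, δψ⟩` holds without boundary
contribution for every smooth `(k+1)`-form `ψ`. -/
def TangentialZero (B : Set (En n)) (u : En n → Form n N k)
    (G : En n → Fin n → Form n N k) : Prop :=
  ∀ ψ : En n → Form n N (k + 1), (∀ q, ContDiff ℝ (⊤ : ℕ∞) fun x => ψ x q) →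
    ∫ x in B, finner (extD (G x)) (ψ x) = ∫ x in B, finner (u x) (codiff (smoothGrad ψ x))

/-- The space `W^{1,p}_{δ,T}(B)`: `W^{1,p}` forms which are weakly coclosed in `B` and
have vanishing tangential part on `∂B`. -/
def MemWdeltaT (B : Set (En n)) (p : ℝ) (u : En n → Form n N k)
    (G : En n → Fin n → Form n N k) : Prop :=
  MemW1p B p u G ∧ WeaklyCoclosed B u ∧ TangentialZero B u G

/-- `u` (with weak gradient `G`) is a local weak solution of
`δ(a(x) |du|^{p-2} du) = f` on `Ω`. -/
def IsLocalWeakSolution (Ω : Set (En n)) (p : ℝ) (a : En n → ℝ)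
    (u : En n → Form n N k) (G : En n → Fin n → Form n N k)
    (f : En n → Form n N k) : Prop :=
  ∀ φ : En n → Form n N k, IsTestForm Ω φ →
    ∫ x in Ω, finner (nl p (a x) (extD (G x))) (extD (smoothGrad φ x)) =
      ∫ x in Ω, finner (f x) (φ x)

/-- The Lorentz (quasi-)norm `‖g‖_{L^{(p,θ)}(μ)}`. -/
def lorentzNorm {α : Type*} [MeasurableSpace α] (μ : Measure α) (p : ℝ) (θ : ℝ≥0∞)
    (g : α → ℝ) : ℝ≥0∞ :=
  if θ = ⊤ then
    (⨆ t : ℝ, if 0 < t then ENNReal.ofReal (t ^ p) * μ {x | t < |g x|} else 0) ^ (1 / p)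
  else
    (∫⁻ t in Set.Ioi (0 : ℝ),
        (ENNReal.ofReal (t ^ p) * μ {x | t < |g x|}) ^ (θ.toReal / p) / ENNReal.ofReal t) ^
      (1 / θ.toReal)

/-- Membership in the Lorentz space `L^{(p,θ)}(s)`. -/
def MemLorentzOn {α : Type*} [MeasurableSpace α] (μ : Measure α) (p : ℝ) (θ : ℝ≥0∞)
    (g : α → ℝ) (s : Set α) : Prop :=
  AEStronglyMeasurable g (μ.restrict s) ∧ lorentzNorm (μ.restrict s) p θ g ≠ ⊤

/-- Local membership in the Lorentz space `L^{(p,θ)}` on the open set `Ω`. -/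
def MemLorentzLoc (p : ℝ) (θ : ℝ≥0∞) (g : En n → ℝ) (Ω : Set (En n)) : Prop :=
  ∀ K, K ⊆ Ω → IsCompact K → MemLorentzOn volume p θ g K

/-- The `L^s` norm of a scalar function on a set, valued in `ℝ≥0∞`. -/
def lpNormOn (s : ℝ) (g : En n → ℝ) (A : Set (En n)) : ℝ≥0∞ :=
  (∫⁻ x in A, ENNReal.ofReal (|g x| ^ s)) ^ (1 / s)

/-- A Dini modulus of continuity. -/
def IsDiniModulus (ω : ℝ → ℝ) : Prop :=
  (∀ t, 0 ≤ ω t) ∧ MonotoneOn ω (Set.Ici 0) ∧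
    IntegrableOn (fun t => ω t / t) (Set.Ioc 0 1) volume ∧
    Tendsto ω (nhdsWithin 0 (Set.Ioi 0)) (nhds 0)

/-- `ω` is a modulus of continuity for `a` on `Ω`. -/
def IsModulusFor (ω : ℝ → ℝ) (a : En n → ℝ) (Ω : Set (En n)) : Prop :=
  ∀ x ∈ Ω, ∀ y ∈ Ω, |a x - a y| ≤ ω ‖x - y‖

/-- Dini continuity on `Ω`. -/
def DiniContinuousOn (a : En n → ℝ) (Ω : Set (En n)) : Prop :=
  ∃ ω, IsDiniModulus ω ∧ IsModulusFor ω a Ω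

/-- `a` is `α`-Hölder with constant `C` on `s`. -/
def HolderOn (α C : ℝ) (a : En n → ℝ) (s : Set (En n)) : Prop :=
  ∀ x ∈ s, ∀ y ∈ s, |a x - a y| ≤ C * ‖x - y‖ ^ α

/-- `g` agrees a.e. on `Ω` with a function continuous on `Ω`. -/
def HasContinuousRepOn {V : Type*} [TopologicalSpace V] (Ω : Set (En n)) (g : En n → V) :
    Prop :=
  ∃ v : En n → V, ContinuousOn v Ω ∧ ∀ᵐ x ∂volume.restrict Ω, g x = v x

/-- `g` has locally vanishing mean oscillation in `Ω`. -/
def LocallyVMOOn {V : Type*} [NormedAddCommGroup V] [NormedSpace ℝ V] (Ω : Set (En n))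
    (g : En n → V) : Prop :=
  ∀ K, K ⊆ Ω → IsCompact K → ∀ ε > 0, ∃ r₀ > 0, ∀ x ∈ K, ∀ r, 0 < r → r ≤ r₀ →
    (⨍ y in ball x r, ‖g y - ⨍ z in ball x r, g z‖) ≤ ε

/-- `g` has locally bounded mean oscillation in `Ω`. -/
def LocallyBMOOn {V : Type*} [NormedAddCommGroup V] [NormedSpace ℝ V] (Ω : Set (En n))
    (g : En n → V) : Prop :=
  ∀ K, K ⊆ Ω → IsCompact K → ∃ C : ℝ, ∃ r₀ > 0, ∀ x ∈ K, ∀ r, 0 < r → r ≤ r₀ →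
    (⨍ y in ball x r, ‖g y - ⨍ z in ball x r, g z‖) ≤ C

/-- The `p`-th power of the Campanato seminorm `[u]^p_{𝓛^{p,λ}(s)}`, valued in `ℝ≥0∞`. -/
def campanatoSemi {V : Type*} [NormedAddCommGroup V] [NormedSpace ℝ V] (p lam : ℝ)
    (s : Set (En n)) (u : En n → V) : ℝ≥0∞ :=
  ⨆ (x₀ : En n) (_ : x₀ ∈ closure s) (ρ : ℝ) (_ : 0 < ρ),
    ENNReal.ofReal
      (ρ ^ (-lam) * ∫ y in ball x₀ ρ ∩ s, ‖u y - ⨍ z in ball x₀ ρ ∩ s, u z‖ ^ p)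

/-- The Campanato norm `‖u‖_{𝓛^{p,λ}(s)} = ‖u‖_{L^p(s)} + [u]_{𝓛^{p,λ}(s)}`. -/
def campanatoNorm {V : Type*} [NormedAddCommGroup V] [NormedSpace ℝ V] (p lam : ℝ)
    (s : Set (En n)) (u : En n → V) : ℝ≥0∞ :=
  (∫⁻ y in s, ENNReal.ofReal (‖u y‖ ^ p)) ^ (1 / p) + campanatoSemi p lam s u ^ (1 / p)

/-- Membership in the Campanato space `𝓛^{p,λ}(s)`. -/
def MemCampanatoOn {V : Type*} [NormedAddCommGroup V] [NormedSpace ℝ V] (p lam : ℝ)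
    (s : Set (En n)) (u : En n → V) : Prop :=
  AEStronglyMeasurable u (volume.restrict s) ∧
    IntegrableOn (fun y => ‖u y‖ ^ p) s volume ∧ campanatoSemi p lam s u ≠ ⊤

/-- Local membership in the Campanato space `𝓛^{p,λ}` on `Ω`. -/
def MemCampanatoLoc {V : Type*} [NormedAddCommGroup V] [NormedSpace ℝ V] (p lam : ℝ)
    (Ω : Set (En n)) (u : En n → V) : Prop :=
  ∀ K, K ⊆ Ω → IsCompact K → MemCampanatoOn p lam K u

/-- `v` is of class `C^{1,θ}` locally on `Ω`. -/
def C1HolderLocOn {V : Type*} [NormedAddCommGroup V] [NormedSpace ℝ V] (θ : ℝ)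
    (Ω : Set (En n)) (v : En n → V) : Prop :=
  ∃ Dv : En n → En n →L[ℝ] V, (∀ x ∈ Ω, HasFDerivAt v (Dv x) x) ∧
    ∀ K, K ⊆ Ω → IsCompact K →
      ∃ C : ℝ, 0 ≤ C ∧ ∀ x ∈ K, ∀ y ∈ K, ‖Dv x - Dv y‖ ≤ C * ‖x - y‖ ^ θ

/-- Local membership in `L^q` for a form-valued map. -/
def MemLqLoc (q : ℝ) (f : En n → Form n N k) (Ω : Set (En n)) : Prop :=
  (∀ r, AEStronglyMeasurable (fun x => f x r) (volume.restrict Ω)) ∧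
    ∀ K, K ⊆ Ω → IsCompact K → IntegrableOn (fun x => fnorm (f x) ^ q) K volume

/-- `x` is a Lebesgue point of the form-valued map `g`. -/
def IsLebesguePoint (g : En n → Form n N k) (x : En n) : Prop :=
  Tendsto (fun r => ⨍ y in ball x r, fnorm (g y - g x)) (nhdsWithin 0 (Set.Ioi 0)) (nhds 0)

/-- The space `W^{1,p}_0(B)`: `W^{1,p}` forms with zero trace, characterized by the fact
that the extension by zero has a weak gradient on all of `ℝ^n`. -/
def MemW1p0 (n N k : ℕ) (B : Set (En n)) (p : ℝ) (ψ : En n → Form n N k)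
    (Gψ : En n → Fin n → Form n N k) : Prop :=
  MemW1p B p ψ Gψ ∧ HasWeakGrad Set.univ (B.indicator ψ) (B.indicator Gψ)


/-- Sign of inserting `i` into `S`. -/
def sgn (i : Fin n) (S : Finset (Fin n)) : ℝ := (-1 : ℝ) ^ (S.filter (fun j => j < i)).card

/-- Coefficients extended by zero to all finsets. -/
def tot (w : Form n N k) (S : Finset (Fin n)) (c : Fin N) : ℝ :=
  if h : S.card = k then w (⟨S, h⟩, c) else 0

lemma tot_eq (w : Form n N k) (q : FormIdx n k × Fin N) : tot w q.1.1 q.2 = w q := by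
  obtain ⟨⟨S, hS⟩, c⟩ := q
  simp [tot, hS]

lemma extD_eq (G : Fin n → Form n N k) (q : FormIdx n (k+1) × Fin N) :
    extD G q = ∑ i, if i ∈ q.1.1 then sgn i q.1.1 * tot (G i) (q.1.1.erase i) q.2 else 0 := by
  unfold extD
  refine Finset.sum_congr rfl fun i _ => ?_
  split_ifs with h
  · have : (q.1.1.erase i).card = k := by simp [Finset.card_erase_of_mem h, q.1.2]
    simp [sgn, tot, this]
  · rfl

lemma codiff_eq (G : Fin n → Form n N (k+1)) (q : FormIdx n k × Fin N) :
    codiff G q = -∑ i, if i ∈ q.1.1 then 0 else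
      sgn i q.1.1 * tot (G i) (insert i q.1.1) q.2 := by
  unfold codiff
  congr 1
  refine Finset.sum_congr rfl fun i _ => ?_
  split_ifs with h
  · rfl
  · have : (insert i q.1.1).card = k + 1 := by simp [Finset.card_insert_of_notMem h, q.1.2]
    simp [sgn, tot, this]

lemma sgn_erase (i l : Fin n) (S : Finset (Fin n)) (hi : i ∈ S) :
    sgn l (S.erase i) = (if i < l then -1 else 1) * sgn l S := by
  unfold sgn
  rw [Finset.filter_erase]
  split_ifs with h
  · have hm : i ∈ S.filter (fun j => j < l) := by simp [hi, h]
    rw [← Finset.card_erase_add_one hm, pow_succ]; ring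
  · rw [Finset.erase_eq_of_notMem (by simp [h])]; simp

lemma sgn_insert (i l : Fin n) (S : Finset (Fin n)) (hi : i ∉ S) :
    sgn l (insert i S) = (if i < l then -1 else 1) * sgn l S := by
  have := sgn_erase i l (insert i S) (by simp)
  rw [Finset.erase_insert hi] at this
  rw [this]; split_ifs <;> ring

lemma sgn_mul_self (i : Fin n) (S : Finset (Fin n)) : sgn i S * sgn i S = 1 := by
  unfold sgn; rw [← mul_pow]; norm_num

lemma tot_extD (G : Fin n → Form n N k) (S : Finset (Fin n)) (h : S.card = k + 1) (c : Fin N) :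
    tot (extD G) S c = ∑ i, if i ∈ S then sgn i S * tot (G i) (S.erase i) c else 0 := by
  rw [tot, dif_pos h, extD_eq]

lemma tot_codiff (G : Fin n → Form n N (k+1)) (S : Finset (Fin n)) (h : S.card = k) (c : Fin N) :
    tot (codiff G) S c = -∑ i, if i ∈ S then 0 else sgn i S * tot (G i) (insert i S) c := by
  rw [tot, dif_pos h, codiff_eq]

lemma extD_extD (H : Fin n → Fin n → Form n N k) (hH : ∀ i l, H i l = H l i) :
    extD (fun i => extD (fun l => H i l)) = 0 := by
  funext q
  obtain ⟨⟨S, hS⟩, c⟩ := q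
  rw [extD_eq]
  simp only [Pi.zero_apply]
  set T : Fin n → Fin n → ℝ := fun i l => if i ∈ S then sgn i S *
    (if l ∈ S.erase i then sgn l (S.erase i) * tot (H i l) ((S.erase i).erase l) c else 0) else 0
    with hT
  have e : (∑ i, if i ∈ S then sgn i S * tot (extD (fun l => H i l)) (S.erase i) c else 0)
      = ∑ i, ∑ l, T i l := by
    refine Finset.sum_congr rfl fun i _ => ?_
    simp only [hT]
    split_ifs with h
    · rw [tot_extD _ _ (by simp [Finset.card_erase_of_mem h, hS]), Finset.mul_sum]
    · simp
  have anti : ∀ i l, T i l = - T l i := by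
    intro i l
    simp only [hT, Finset.mem_erase]
    by_cases hi : i ∈ S <;> by_cases hl : l ∈ S <;> by_cases hil : i = l <;>
      simp [hi, hl, hil, eq_comm]
    rw [sgn_erase i l S hi, sgn_erase l i S hl, hH i l,
      Finset.erase_right_comm]
    rcases lt_or_gt_of_ne hil with h | h
    · rw [if_pos h, if_neg (not_lt.2 h.le)]; ring
    · rw [if_pos h, if_neg (not_lt.2 h.le)]; ring
  have : ∑ i, ∑ l, T i l = - ∑ i, ∑ l, T i l := by
    conv_lhs => rw [Finset.sum_comm]
    rw [← Finset.sum_neg_distrib]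
    refine Finset.sum_congr rfl fun i _ => ?_
    rw [← Finset.sum_neg_distrib]
    exact Finset.sum_congr rfl fun l _ => anti l i
  show (∑ i, if i ∈ S then sgn i S * tot (extD (fun l => H i l)) (S.erase i) c else 0) = 0
  rw [e]; linarith

lemma cartan (Ψ : Fin n → Fin n → Form n N (k+1)) (q : FormIdx n (k+1) × Fin N) :
    extD (fun l => codiff (fun m => Ψ l m)) q + codiff (fun m => extD (fun l => Ψ l m)) q
      = - ∑ l, Ψ l l q := by
  obtain ⟨⟨S, hS⟩, c⟩ := q
  rw [extD_eq, codiff_eq]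
  set T₁ : Fin n → Fin n → ℝ := fun l m => if l ∈ S then sgn l S *
    (if m ∈ S.erase l then 0 else sgn m (S.erase l) * tot (Ψ l m) (insert m (S.erase l)) c) else 0
    with hT₁
  set T₂ : Fin n → Fin n → ℝ := fun l m => if m ∈ S then 0 else sgn m S *
    (if l ∈ insert m S then sgn l (insert m S) * tot (Ψ l m) ((insert m S).erase l) c else 0)
    with hT₂
  have e1 : (∑ l, if l ∈ S then sgn l S * tot (codiff (fun m => Ψ l m)) (S.erase l) c else 0)
      = - ∑ l, ∑ m, T₁ l m := by
    rw [← Finset.sum_neg_distrib]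
    refine Finset.sum_congr rfl fun l _ => ?_
    simp only [hT₁]
    split_ifs with h
    · rw [tot_codiff _ _ (by simp [Finset.card_erase_of_mem h, hS]), mul_neg, Finset.mul_sum]
    · simp
  have e2 : (∑ m, if m ∈ S then 0 else sgn m S * tot (extD (fun l => Ψ l m)) (insert m S) c)
      = ∑ l, ∑ m, T₂ l m := by
    rw [Finset.sum_comm]
    refine Finset.sum_congr rfl fun m _ => ?_
    simp only [hT₂]
    split_ifs with h
    · simp
    · rw [tot_extD _ _ (by simp [Finset.card_insert_of_notMem h, hS]), Finset.mul_sum]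
  have key : ∀ l m, T₁ l m + T₂ l m = if m = l then tot (Ψ l l) S c else 0 := by
    intro l m
    simp only [hT₁, hT₂, Finset.mem_erase, Finset.mem_insert]
    by_cases hlm : m = l
    · subst hlm
      by_cases hm : m ∈ S
      · simp only [hm, if_true, ne_eq, not_true_eq_false, false_and, if_false,
          Finset.insert_erase hm, sgn_erase m m S hm, lt_irrefl, one_mul, add_zero, ← mul_assoc,
          sgn_mul_self]
      · simp only [hm, if_true, if_false, true_or, sgn_insert m m S hm, lt_irrefl, one_mul,
          zero_add, Finset.erase_insert hm, ← mul_assoc, sgn_mul_self]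
    · by_cases hl : l ∈ S <;> by_cases hm : m ∈ S <;>
        simp [hl, hm, hlm]
      · rw [sgn_erase l m S hl, sgn_insert m l S hm, Finset.erase_insert_of_ne hlm]
        rcases lt_or_gt_of_ne hlm with h | h
        · rw [if_pos h, if_neg (not_lt.2 h.le)]; ring
        · rw [if_pos h, if_neg (not_lt.2 h.le)]; ring
      · intro h; exact absurd h.symm hlm
  show (∑ l, if l ∈ S then sgn l S * tot (codiff (fun m => Ψ l m)) (S.erase l) c else 0)
    + -(∑ m, if m ∈ S then 0 else sgn m S * tot (extD (fun l => Ψ l m)) (insert m S) c) = _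
  rw [e1, e2, ← neg_add, ← Finset.sum_add_distrib]
  congr 1
  refine Finset.sum_congr rfl fun l _ => ?_
  rw [← Finset.sum_add_distrib, Finset.sum_congr rfl fun m _ => key l m]
  simp [tot, hS]

lemma schur_pt {β : Type*} [MeasurableSpace β] (ν : Measure β) (K g : β → ℝ≥0∞)
    (hK : AEMeasurable K ν) (hg : AEMeasurable g ν) {p : ℝ} (hp : 1 < p) :
    (∫⁻ z, K z * g z ∂ν) ^ p ≤ (∫⁻ z, K z ∂ν) ^ (p - 1) * ∫⁻ z, K z * g z ^ p ∂ν := by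
  have hp0 : 0 < p := by linarith
  have hpq := Real.HolderConjugate.conjExponent hp
  set q := p.conjExponent with hq
  have hq0 : 0 < q := hpq.symm.pos
  have h := ENNReal.lintegral_mul_le_Lp_mul_Lq ν hpq.symm
    (f := fun z => K z ^ (1 / q)) (g := fun z => K z ^ (1 / p) * g z)
    (hK.pow_const _) ((hK.pow_const _).mul hg)
  have e1 : ∀ z, ((fun z => K z ^ (1 / q)) * fun z => K z ^ (1 / p) * g z) z = K z * g z := by
    intro z
    simp only [Pi.mul_apply]
    rw [← mul_assoc, ← ENNReal.rpow_add_of_nonneg _ _ (by positivity) (by positivity)]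
    have : 1 / q + 1 / p = 1 := by
      have := hpq.inv_add_inv_eq_one
      simp only [one_div]; rw [add_comm]; exact this
    rw [this, ENNReal.rpow_one]
  have e2 : ∀ z, (K z ^ (1 / q)) ^ q = K z := by
    intro z; rw [← ENNReal.rpow_mul, one_div, inv_mul_cancel₀ hq0.ne', ENNReal.rpow_one]
  have e3 : ∀ z, (K z ^ (1 / p) * g z) ^ p = K z * g z ^ p := by
    intro z
    rw [ENNReal.mul_rpow_of_nonneg _ _ hp0.le, ← ENNReal.rpow_mul, one_div,
      inv_mul_cancel₀ hp0.ne', ENNReal.rpow_one]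
  simp only [e1, e2, e3] at h
  calc (∫⁻ z, K z * g z ∂ν) ^ p
      ≤ ((∫⁻ z, K z ∂ν) ^ (1 / q) * (∫⁻ z, K z * g z ^ p ∂ν) ^ (1 / p)) ^ p :=
        ENNReal.rpow_le_rpow h hp0.le
    _ = _ := by
        rw [ENNReal.mul_rpow_of_nonneg _ _ hp0.le, ← ENNReal.rpow_mul, ← ENNReal.rpow_mul]
        congr 2
        · have := hpq.inv_add_inv_eq_one
          field_simp at this ⊢
          linarith
        · rw [one_div, inv_mul_cancel₀ hp0.ne', ENNReal.rpow_one]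

lemma schur_abs {α β : Type*} [MeasurableSpace α] [MeasurableSpace β] (μ : Measure α)
    (ν : Measure β) [SFinite μ] [SFinite ν] (K : α → β → ℝ≥0∞)
    (hK : Measurable (Function.uncurry K)) (g : β → ℝ≥0∞) (hg : AEMeasurable g ν)
    {p : ℝ} (hp : 1 < p) (C₁ C₂ : ℝ≥0∞) (h1 : ∀ᵐ x ∂μ, ∫⁻ z, K x z ∂ν ≤ C₁)
    (h2 : ∀ z, ∫⁻ x, K x z ∂μ ≤ C₂) :
    ∫⁻ x, (∫⁻ z, K x z * g z ∂ν) ^ p ∂μ ≤ C₁ ^ (p - 1) * C₂ * ∫⁻ z, g z ^ p ∂ν := by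
  have hp0 : 0 ≤ p - 1 := by linarith
  calc ∫⁻ x, (∫⁻ z, K x z * g z ∂ν) ^ p ∂μ
      ≤ ∫⁻ x, C₁ ^ (p - 1) * ∫⁻ z, K x z * g z ^ p ∂ν ∂μ := by
        refine lintegral_mono_ae ?_
        filter_upwards [h1] with x hx
        refine (schur_pt ν (K x) g (hK.of_uncurry_left).aemeasurable hg hp).trans ?_
        gcongr
    _ ≤ C₁ ^ (p - 1) * ∫⁻ x, ∫⁻ z, K x z * g z ^ p ∂ν ∂μ := by
        rw [lintegral_const_mul'']
        exact AEMeasurable.lintegral_prod_right'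
          (f := fun q : α × β => K q.1 q.2 * g q.2 ^ p)
          (hK.aemeasurable.mul (hg.pow_const p).comp_snd)
    _ = C₁ ^ (p - 1) * ∫⁻ z, ∫⁻ x, K x z * g z ^ p ∂μ ∂ν := by
        rw [lintegral_lintegral_swap]
        exact hK.aemeasurable.mul (hg.pow_const p).comp_snd
    _ ≤ C₁ ^ (p - 1) * ∫⁻ z, C₂ * g z ^ p ∂ν := by
        gcongr with z
        rw [lintegral_mul_const _ hK.of_uncurry_right]
        gcongr
        exact h2 z
    _ = _ := by
        rw [lintegral_const_mul'' _ (hg.pow_const p), mul_assoc]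

/-- the normalized variable `y` with `z = x - t (x - x₀ + y)`. -/
def yv (x₀ : En n) (t : ℝ) (x z : En n) : En n := t⁻¹ • (x - z) - (x - x₀)

/-- indicator kernel. -/
def kk (x₀ : En n) (r : ℝ) (t : En n → ℝ) (x z : En n) : ℝ≥0∞ :=
  if ‖yv x₀ (t x) x z‖ ≤ r then ENNReal.ofReal ((t x)⁻¹ ^ n) else 0

/-- Geometric hypotheses on the scale function `t`. -/
structure GeoOK (x₀ : En n) (R r a b : ℝ) (S : Set (En n)) (t d : En n → ℝ) : Prop where
  meas : Measurable t
  pos : ∀ x ∈ S, 0 < t x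
  geo : ∀ x ∈ S, ∀ z, ‖yv x₀ (t x) x z‖ ≤ r →
    z ∈ ball x₀ R ∧ 0 < d z ∧ d z ≤ a * t x ∧ ‖x - z‖ ≤ b * d z

/-- The Schur constant. -/
def schurC (n : ℕ) (p r a b : ℝ) : ℝ≥0∞ :=
  (ENNReal.ofReal (r ^ n) * volume (ball (0 : En n) 1)) ^ (p - 1) *
    (ENNReal.ofReal ((a * b) ^ n) * volume (ball (0 : En n) 1))

lemma schurC_ne_top {p r a b : ℝ} (hp : 1 < p) : schurC n p r a b ≠ ⊤ := by
  unfold schurC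
  refine ENNReal.mul_ne_top (ENNReal.rpow_ne_top_of_nonneg (by linarith) ?_) ?_
  · exact ENNReal.mul_ne_top ENNReal.ofReal_ne_top measure_ball_lt_top.ne
  · exact ENNReal.mul_ne_top ENNReal.ofReal_ne_top measure_ball_lt_top.ne

lemma measurable_kk {x₀ : En n} {r : ℝ} {t : En n → ℝ} (ht : Measurable t) :
    Measurable (Function.uncurry (kk x₀ r t)) := by
  unfold kk Function.uncurry yv
  refine Measurable.ite ?_ ?_ measurable_const
  · refine measurableSet_le ?_ measurable_const
    have h1 : Measurable fun q : En n × En n => t q.1 := ht.comp measurable_fst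
    exact (((h1.inv).smul (measurable_fst.sub measurable_snd)).sub
      (measurable_fst.sub measurable_const)).norm
  · exact (((ht.comp measurable_fst).inv).pow_const n).ennreal_ofReal

lemma volume_closedBall_le (x : En n) {r : ℝ} (hr : 0 ≤ r) :
    volume (closedBall x r) = ENNReal.ofReal (r ^ n) * volume (ball (0 : En n) 1) := by
  have := Measure.addHaar_closedBall (volume : Measure (En n)) x hr
  simpa using this

lemma yv_le_iff {x₀ : En n} {t r : ℝ} (ht : 0 < t) (x z : En n) :
    ‖yv x₀ t x z‖ ≤ r ↔ z ∈ closedBall (x - t • (x - x₀)) (t * r) := by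
  rw [mem_closedBall, dist_eq_norm, yv]
  have : z - (x - t • (x - x₀)) = -(t • (t⁻¹ • (x - z) - (x - x₀))) := by
    rw [smul_sub t (t⁻¹ • (x - z)), smul_inv_smul₀ ht.ne']; abel
  rw [this, norm_neg, norm_smul, Real.norm_of_nonneg ht.le]
  constructor
  · intro h; gcongr
  · intro h; exact le_of_mul_le_mul_left h ht

lemma schur_kk {x₀ : En n} {R r a b : ℝ} {S : Set (En n)} {t d : En n → ℝ}
    (hS : MeasurableSet S) (hr : 0 ≤ r) (ha : 0 ≤ a) (hb : 0 ≤ b)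
    (h : GeoOK x₀ R r a b S t d) {p : ℝ} (hp : 1 < p)
    (g : En n → ℝ≥0∞) (hg : AEMeasurable g (volume.restrict (ball x₀ R))) :
    ∫⁻ x in S, (∫⁻ z in ball x₀ R, kk x₀ r t x z * g z) ^ p ≤
      schurC n p r a b * ∫⁻ z in ball x₀ R, g z ^ p := by
  refine schur_abs _ _ _ (measurable_kk h.meas) g hg hp _ _ ?_ ?_
  · refine (ae_restrict_mem hS).mono fun x hx => ?_
    have htx := h.pos x hx
    calc ∫⁻ z in ball x₀ R, kk x₀ r t x z ≤ ∫⁻ z, kk x₀ r t x z := setLIntegral_le_lintegral _ _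
      _ = ∫⁻ z, (closedBall (x - t x • (x - x₀)) (t x * r)).indicator
            (fun _ => ENNReal.ofReal ((t x)⁻¹ ^ n)) z := by
          refine lintegral_congr fun z => ?_
          unfold kk
          by_cases hy : ‖yv x₀ (t x) x z‖ ≤ r
          · rw [if_pos hy, Set.indicator_of_mem ((yv_le_iff htx x z).1 hy)]
          · rw [if_neg hy, Set.indicator_of_notMem (fun h' => hy ((yv_le_iff htx x z).2 h'))]
      _ = _ := by
          rw [lintegral_indicator_const measurableSet_closedBall,
            volume_closedBall_le _ (by positivity), ← mul_assoc,
            ← ENNReal.ofReal_mul (by positivity)]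
          congr 2
          rw [← mul_pow, ← mul_assoc, inv_mul_cancel₀ htx.ne', one_mul]
      _ ≤ _ := le_rfl
  · intro z
    by_cases hz : 0 < d z
    · calc ∫⁻ x in S, kk x₀ r t x z
          ≤ ∫⁻ x in S, (closedBall z (b * d z)).indicator
            (fun _ => ENNReal.ofReal ((a / d z) ^ n)) x := by
            refine setLIntegral_mono' hS fun x hx => ?_
            unfold kk
            split_ifs with hy
            · obtain ⟨-, h2, h3, h4⟩ := h.geo x hx z hy
              have htx := h.pos x hx
              rw [Set.indicator_of_mem (by rw [mem_closedBall, dist_eq_norm]; exact h4)]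
              apply ENNReal.ofReal_le_ofReal
              gcongr
              rw [inv_le_iff_one_le_mul₀ htx, div_mul_eq_mul_div, le_div_iff₀ h2, one_mul]
              exact h3
            · exact zero_le
        _ ≤ ∫⁻ x, (closedBall z (b * d z)).indicator
            (fun _ => ENNReal.ofReal ((a / d z) ^ n)) x := setLIntegral_le_lintegral _ _
        _ = _ := by
          rw [lintegral_indicator_const measurableSet_closedBall,
            volume_closedBall_le _ (by positivity), ← mul_assoc,
            ← ENNReal.ofReal_mul (by positivity)]
          congr 2
          rw [← mul_pow]
          congr 1
          field_simp
    · calc ∫⁻ x in S, kk x₀ r t x z ≤ ∫⁻ x in S, 0 := by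
            refine setLIntegral_mono' hS fun x hx => ?_
            unfold kk
            split_ifs with hy
            · exact absurd (h.geo x hx z hy).2.1 hz
            · exact le_rfl
        _ ≤ _ := by simp

/-- Smooth kernels supported in the closed ball of radius `r`. -/
def KOK (r : ℝ) (κ : En n → ℝ) : Prop :=
  ContDiff ℝ (⊤ : ℕ∞) κ ∧ ∀ y, r < ‖y‖ → κ y = 0

/-- The smooth averaging kernel. -/
def Ker (x₀ : En n) (t : En n → ℝ) (κ : En n → ℝ) (x z : En n) : ℝ :=
  κ (yv x₀ (t x) x z) * (t x)⁻¹ ^ n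

/-- The averaging operator. -/
def Uop (x₀ : En n) (R : ℝ) (t : En n → ℝ) (κ w : En n → ℝ) (x : En n) : ℝ :=
  ∫ z in ball x₀ R, w z * Ker x₀ t κ x z

lemma KOK.bdd {r : ℝ} {κ : En n → ℝ} (h : KOK r κ) : ∃ M, 0 ≤ M ∧ ∀ y, |κ y| ≤ M := by
  have hc : HasCompactSupport κ :=
    HasCompactSupport.intro (isCompact_closedBall (0 : En n) r)
      (fun y hy => h.2 y (by simpa using hy))
  obtain ⟨M, hM⟩ := hc.exists_bound_of_continuous h.1.continuous
  exact ⟨M, (norm_nonneg _).trans (hM 0), fun y => hM y⟩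

lemma enorm_Ker_le {x₀ : En n} {r M : ℝ} {t κ : En n → ℝ} (hκ : KOK r κ) (hM : ∀ y, |κ y| ≤ M)
    {x : En n} (htx : 0 < t x) (z : En n) :
    ‖Ker x₀ t κ x z‖ₑ ≤ ENNReal.ofReal M * kk x₀ r t x z := by
  unfold Ker kk
  split_ifs with hy
  · rw [enorm_mul]
    refine mul_le_mul' ?_ ?_
    · rw [Real.enorm_eq_ofReal_abs]; exact ENNReal.ofReal_le_ofReal (hM _)
    · rw [Real.enorm_eq_ofReal_abs, abs_of_pos (by positivity)]
  · rw [hκ.2 _ (not_le.1 hy)]; simp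

lemma enorm_Uop_le {x₀ : En n} {R r M : ℝ} {t κ : En n → ℝ} (hκ : KOK r κ) (hM : ∀ y, |κ y| ≤ M)
    {x : En n} (htx : 0 < t x) (w : En n → ℝ) :
    ‖Uop x₀ R t κ w x‖ₑ ≤ ENNReal.ofReal M * ∫⁻ z in ball x₀ R, kk x₀ r t x z * ‖w z‖ₑ := by
  unfold Uop
  refine (enorm_integral_le_lintegral_enorm _).trans ?_
  rw [← lintegral_const_mul' _ _ ENNReal.ofReal_ne_top]
  refine lintegral_mono fun z => ?_
  rw [enorm_mul, ← mul_assoc, mul_comm]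
  gcongr
  exact enorm_Ker_le hκ hM htx z

lemma lintegral_kk_le {x₀ : En n} {R r : ℝ} (hr : 0 ≤ r) {t : En n → ℝ} {x : En n}
    (htx : 0 < t x) :
    ∫⁻ z in ball x₀ R, kk x₀ r t x z ≤ ENNReal.ofReal (r ^ n) * volume (ball (0 : En n) 1) := by
  calc ∫⁻ z in ball x₀ R, kk x₀ r t x z ≤ ∫⁻ z, kk x₀ r t x z := setLIntegral_le_lintegral _ _
      _ = ∫⁻ z, (closedBall (x - t x • (x - x₀)) (t x * r)).indicator
            (fun _ => ENNReal.ofReal ((t x)⁻¹ ^ n)) z := by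
          refine lintegral_congr fun z => ?_
          unfold kk
          by_cases hy : ‖yv x₀ (t x) x z‖ ≤ r
          · rw [if_pos hy, Set.indicator_of_mem ((yv_le_iff htx x z).1 hy)]
          · rw [if_neg hy, Set.indicator_of_notMem (fun h' => hy ((yv_le_iff htx x z).2 h'))]
      _ = _ := by
          rw [lintegral_indicator_const measurableSet_closedBall,
            volume_closedBall_le _ (by positivity), ← mul_assoc,
            ← ENNReal.ofReal_mul (by positivity)]
          congr 2
          rw [← mul_pow, ← mul_assoc, inv_mul_cancel₀ htx.ne', one_mul]

lemma measurable_Ker {x₀ : En n} {t κ : En n → ℝ} (hκ : Continuous κ) (ht : Measurable t) :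
    Measurable (Function.uncurry (Ker x₀ t κ)) := by
  unfold Ker Function.uncurry yv
  have h1 : Measurable fun q : En n × En n => t q.1 := ht.comp measurable_fst
  exact (hκ.measurable.comp (((h1.inv).smul (measurable_fst.sub measurable_snd)).sub
      (measurable_fst.sub measurable_const))).mul (h1.inv.pow_const n)

lemma aesm_Uop {x₀ : En n} {R : ℝ} {t κ w : En n → ℝ} (hκ : Continuous κ) (ht : Measurable t)
    (hw : AEStronglyMeasurable w (volume.restrict (ball x₀ R))) (S : Set (En n)) :
    AEStronglyMeasurable (Uop x₀ R t κ w) (volume.restrict S) := by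
  unfold Uop
  have : AEStronglyMeasurable (fun q : En n × En n => w q.2 * Ker x₀ t κ q.1 q.2)
      ((volume.restrict S).prod (volume.restrict (ball x₀ R))) :=
    hw.comp_snd.mul (measurable_Ker hκ ht).aestronglyMeasurable
  exact this.integral_prod_right'

lemma eLpNorm_mUop_le {x₀ : En n} {R r a b M M' : ℝ} {S : Set (En n)} {t d κ m w : En n → ℝ}
    (hS : MeasurableSet S) (hr : 0 ≤ r) (ha : 0 ≤ a) (hb : 0 ≤ b)
    (h : GeoOK x₀ R r a b S t d) {p : ℝ} (hp : 1 < p) (hκ : KOK r κ) (hM : ∀ y, |κ y| ≤ M)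
    (hm : ∀ x ∈ S, |m x| ≤ M') (hw : AEStronglyMeasurable w (volume.restrict (ball x₀ R))) :
    eLpNorm (fun x => m x * Uop x₀ R t κ w x) (ENNReal.ofReal p) (volume.restrict S) ≤
      ENNReal.ofReal M' * ENNReal.ofReal M * schurC n p r a b ^ (1 / p) *
        eLpNorm w (ENNReal.ofReal p) (volume.restrict (ball x₀ R)) := by
  have hp0 : 0 < p := by linarith
  have hP0 : ENNReal.ofReal p ≠ 0 := by simpa using hp0
  have htr : (ENNReal.ofReal p).toReal = p := ENNReal.toReal_ofReal hp0.le
  rw [eLpNorm_eq_lintegral_rpow_enorm_toReal hP0 ENNReal.ofReal_ne_top,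
    eLpNorm_eq_lintegral_rpow_enorm_toReal hP0 ENNReal.ofReal_ne_top, htr]
  set A := ENNReal.ofReal M' * ENNReal.ofReal M with hA
  have hAtop : A ≠ ⊤ := ENNReal.mul_ne_top ENNReal.ofReal_ne_top ENNReal.ofReal_ne_top
  have key : ∫⁻ x in S, ‖m x * Uop x₀ R t κ w x‖ₑ ^ p ≤
      A ^ p * (schurC n p r a b * ∫⁻ z in ball x₀ R, ‖w z‖ₑ ^ p) := by
    calc ∫⁻ x in S, ‖m x * Uop x₀ R t κ w x‖ₑ ^ p
        ≤ ∫⁻ x in S, A ^ p * (∫⁻ z in ball x₀ R, kk x₀ r t x z * ‖w z‖ₑ) ^ p := by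
          refine setLIntegral_mono' hS fun x hx => ?_
          rw [← ENNReal.mul_rpow_of_nonneg _ _ hp0.le]
          refine ENNReal.rpow_le_rpow ?_ hp0.le
          rw [enorm_mul, hA, mul_assoc]
          refine mul_le_mul' ?_ (enorm_Uop_le hκ hM (h.pos x hx) w)
          rw [Real.enorm_eq_ofReal_abs]; exact ENNReal.ofReal_le_ofReal (hm x hx)
      _ = A ^ p * ∫⁻ x in S, (∫⁻ z in ball x₀ R, kk x₀ r t x z * ‖w z‖ₑ) ^ p := by
          rw [lintegral_const_mul' _ _ (ENNReal.rpow_ne_top_of_nonneg hp0.le hAtop)]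
      _ ≤ _ := by
          gcongr
          exact schur_kk hS hr ha hb h hp _ hw.enorm
  clear_value A
  calc _ ≤ (A ^ p * (schurC n p r a b * ∫⁻ z in ball x₀ R, ‖w z‖ₑ ^ p)) ^ (1 / p) :=
        ENNReal.rpow_le_rpow key (by positivity)
    _ = _ := by
        rw [ENNReal.mul_rpow_of_nonneg _ _ (by positivity),
          ENNReal.mul_rpow_of_nonneg _ _ (by positivity), ← ENNReal.rpow_mul,
          mul_one_div_cancel hp0.ne', ENNReal.rpow_one, mul_assoc]

lemma eLpNorm_tendsto_bdd {α ι : Type*} [MeasurableSpace α] {μ : Measure α} [IsFiniteMeasure μ]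
    {l : Filter ι} [l.IsCountablyGenerated] {p : ℝ} (hp : 1 < p) (F : ι → α → ℝ)
    (hF : ∀ᶠ i in l, AEStronglyMeasurable (F i) μ) (M : ℝ≥0∞) (hMt : M ≠ ⊤)
    (hM : ∀ᶠ i in l, ∀ᵐ x ∂μ, ‖F i x‖ₑ ≤ M)
    (h0 : ∀ᵐ x ∂μ, Tendsto (fun i => F i x) l (nhds 0)) :
    Tendsto (fun i => eLpNorm (F i) (ENNReal.ofReal p) μ) l (nhds 0) := by
  have hp0 : 0 < p := by linarith
  have hP0 : ENNReal.ofReal p ≠ 0 := by simpa using hp0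
  have htr : (ENNReal.ofReal p).toReal = p := ENNReal.toReal_ofReal hp0.le
  simp only [eLpNorm_eq_lintegral_rpow_enorm_toReal hP0 ENNReal.ofReal_ne_top, htr]
  have key : Tendsto (fun i => ∫⁻ x, ‖F i x‖ₑ ^ p ∂μ) l (nhds (∫⁻ x, 0 ∂μ)) := by
    refine tendsto_lintegral_filter_of_dominated_convergence' (fun _ => M ^ p) ?_ ?_ ?_ ?_
    · filter_upwards [hF] with i hi
      exact hi.enorm.pow_const p
    · filter_upwards [hM] with i hi
      filter_upwards [hi] with x hx
      exact ENNReal.rpow_le_rpow hx hp0.le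
    · rw [lintegral_const]
      exact ENNReal.mul_ne_top (ENNReal.rpow_ne_top_of_nonneg hp0.le hMt) (measure_ne_top _ _)
    · filter_upwards [h0] with x hx
      have h1 : Tendsto (fun i => ‖F i x‖ₑ) l (nhds 0) := by
        have := hx.enorm
        simpa using this
      have := (ENNReal.continuous_rpow_const (y := p)).tendsto (0 : ℝ≥0∞)
      rw [ENNReal.zero_rpow_of_pos hp0] at this
      exact this.comp h1
  rw [lintegral_zero] at key
  have h2 := (ENNReal.continuous_rpow_const (y := 1 / p)).tendsto (0 : ℝ≥0∞)
  rw [ENNReal.zero_rpow_of_pos (by positivity)] at h2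
  exact h2.comp key

lemma tendsto_density {ι : Type*} {l : Filter ι} {p : ℝ} (hp : 1 < p) {S B : Set (En n)}
    (T : ι → (En n → ℝ) → En n → ℝ) (T₀ : (En n → ℝ) → En n → ℝ)
    (C : ℝ≥0∞) (hC : C ≠ ⊤)
    (hm : ∀ᶠ i in l, ∀ w, MemLp w (ENNReal.ofReal p) (volume.restrict B) →
      AEStronglyMeasurable (T i w) (volume.restrict S))
    (hm0 : ∀ w, MemLp w (ENNReal.ofReal p) (volume.restrict B) →
      AEStronglyMeasurable (T₀ w) (volume.restrict S))
    (hL : ∀ᶠ i in l, ∀ w w', MemLp w (ENNReal.ofReal p) (volume.restrict B) →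
      MemLp w' (ENNReal.ofReal p) (volume.restrict B) →
      eLpNorm (T i w - T i w') (ENNReal.ofReal p) (volume.restrict S) ≤
        C * eLpNorm (w - w') (ENNReal.ofReal p) (volume.restrict B))
    (hL0 : ∀ w w', MemLp w (ENNReal.ofReal p) (volume.restrict B) →
      MemLp w' (ENNReal.ofReal p) (volume.restrict B) →
      eLpNorm (T₀ w - T₀ w') (ENNReal.ofReal p) (volume.restrict S) ≤
        C * eLpNorm (w - w') (ENNReal.ofReal p) (volume.restrict B))
    (hc : ∀ w, Continuous w → HasCompactSupport w →
      Tendsto (fun i => eLpNorm (T i w - T₀ w) (ENNReal.ofReal p) (volume.restrict S)) l (nhds 0))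
    (w : En n → ℝ) (hw : MemLp w (ENNReal.ofReal p) (volume.restrict B)) :
    Tendsto (fun i => eLpNorm (T i w - T₀ w) (ENNReal.ofReal p) (volume.restrict S)) l
      (nhds 0) := by
  have h1p : 1 ≤ ENNReal.ofReal p := by
    rw [← ENNReal.ofReal_one]; exact ENNReal.ofReal_le_ofReal hp.le
  rw [ENNReal.tendsto_nhds_zero]
  intro ε hε
  by_cases hεt : ε = ⊤
  · simp [hεt]
  set η : ℝ≥0∞ := ε / 3 / (C + 1) with hη
  have hη0 : η ≠ 0 := by
    rw [hη]
    refine (ENNReal.div_pos (ENNReal.div_pos hε.ne' (by norm_num)).ne' ?_).ne'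
    simp [hC]
  have hCη : C * η ≤ ε / 3 := by
    rw [hη]
    calc C * (ε / 3 / (C + 1)) ≤ (C + 1) * (ε / 3 / (C + 1)) := by gcongr; exact le_self_add
      _ ≤ ε / 3 := ENNReal.mul_div_le
  have hε3 : 0 < ε / 3 := ENNReal.div_pos hε.ne' (by norm_num)
  obtain ⟨w', hw's, hw'n, hw'c, hw'm⟩ :=
    hw.exists_hasCompactSupport_eLpNorm_sub_le ENNReal.ofReal_ne_top hη0
  have hcc := hc w' hw'c hw's
  rw [ENNReal.tendsto_nhds_zero] at hcc
  filter_upwards [hm, hL, hcc (ε / 3) hε3] with i hmi hLi hci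
  have e : T i w - T₀ w = (T i w - T i w') + ((T i w' - T₀ w') + (T₀ w' - T₀ w)) := by
    funext x; simp
  rw [e]
  have m1 := hmi w hw
  have m2 := hmi w' hw'm
  have m3 := hm0 w hw
  have m4 := hm0 w' hw'm
  calc _ ≤ eLpNorm (T i w - T i w') (ENNReal.ofReal p) (volume.restrict S) +
        eLpNorm ((T i w' - T₀ w') + (T₀ w' - T₀ w)) (ENNReal.ofReal p) (volume.restrict S) :=
        eLpNorm_add_le (m1.sub m2) ((m2.sub m4).add (m4.sub m3)) h1p
    _ ≤ eLpNorm (T i w - T i w') (ENNReal.ofReal p) (volume.restrict S) +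
        (eLpNorm (T i w' - T₀ w') (ENNReal.ofReal p) (volume.restrict S) +
          eLpNorm (T₀ w' - T₀ w) (ENNReal.ofReal p) (volume.restrict S)) := by
        gcongr
        exact eLpNorm_add_le (m2.sub m4) (m4.sub m3) h1p
    _ ≤ ε / 3 + (ε / 3 + ε / 3) := by
        gcongr
        · exact (hLi w w' hw hw'm).trans ((mul_le_mul_right hw'n C).trans hCη)
        · refine (hL0 w' w hw'm hw).trans ?_
          rw [eLpNorm_sub_comm]
          exact (mul_le_mul_right hw'n C).trans hCη
    _ = ε := by rw [← add_assoc, ENNReal.add_thirds]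

lemma integrable_of_memLp {p : ℝ} (hp : 1 < p) {x₀ : En n} {R : ℝ} {w : En n → ℝ}
    (hw : MemLp w (ENNReal.ofReal p) (volume.restrict (ball x₀ R))) :
    IntegrableOn w (ball x₀ R) := by
  have h1p : 1 ≤ ENNReal.ofReal p := by
    rw [← ENNReal.ofReal_one]; exact ENNReal.ofReal_le_ofReal hp.le
  have : IsFiniteMeasure ((volume : Measure (En n)).restrict (ball x₀ R)) :=
    ⟨by rw [Measure.restrict_apply_univ]; exact measure_ball_lt_top⟩
  exact hw.integrable h1p

lemma continuous_Ker {x₀ : En n} {t κ : En n → ℝ} (hκ : Continuous κ) (x : En n) :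
    Continuous (Ker x₀ t κ x) := by
  unfold Ker yv; fun_prop

lemma integrable_wKer {x₀ : En n} {R r : ℝ} {t κ w : En n → ℝ} (hκ : KOK r κ)
    (hw : IntegrableOn w (ball x₀ R)) (x : En n) :
    IntegrableOn (fun z => w z * Ker x₀ t κ x z) (ball x₀ R) := by
  obtain ⟨M, hM0, hM⟩ := hκ.bdd
  refine Integrable.mul_bdd (c := M * |(t x)⁻¹ ^ n|) hw
    (continuous_Ker hκ.1.continuous x).aestronglyMeasurable (ae_of_all _ fun z => ?_)
  unfold Ker
  rw [Real.norm_eq_abs, abs_mul]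
  gcongr
  exact hM _

lemma Uop_sub {x₀ : En n} {R r : ℝ} {t κ w w' : En n → ℝ} (hκ : KOK r κ)
    (hw : IntegrableOn w (ball x₀ R)) (hw' : IntegrableOn w' (ball x₀ R)) (x : En n) :
    Uop x₀ R t κ (w - w') x = Uop x₀ R t κ w x - Uop x₀ R t κ w' x := by
  unfold Uop
  rw [← integral_sub (integrable_wKer hκ hw x) (integrable_wKer hκ hw' x)]
  congr 1; funext z; simp [sub_mul]

lemma enorm_Uop_le_const {x₀ : En n} {R r M W : ℝ} (hr : 0 ≤ r) {t κ : En n → ℝ} (hκ : KOK r κ)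
    (hM : ∀ y, |κ y| ≤ M) {x : En n} (htx : 0 < t x) (w : En n → ℝ) (hw : ∀ z, |w z| ≤ W) :
    ‖Uop x₀ R t κ w x‖ₑ ≤ ENNReal.ofReal M *
      ((ENNReal.ofReal (r ^ n) * volume (ball (0 : En n) 1)) * ENNReal.ofReal W) := by
  refine (enorm_Uop_le hκ hM htx w).trans ?_
  gcongr
  calc ∫⁻ z in ball x₀ R, kk x₀ r t x z * ‖w z‖ₑ
      ≤ ∫⁻ z in ball x₀ R, kk x₀ r t x z * ENNReal.ofReal W := by
        gcongr with z
        rw [Real.enorm_eq_ofReal_abs]; exact ENNReal.ofReal_le_ofReal (hw z)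
    _ = (∫⁻ z in ball x₀ R, kk x₀ r t x z) * ENNReal.ofReal W := by
        rw [lintegral_mul_const' _ _ ENNReal.ofReal_ne_top]
    _ ≤ _ := by gcongr; exact lintegral_kk_le hr htx

lemma mU_tendsto {ι : Type*} {l : Filter ι} [l.IsCountablyGenerated] {x₀ : En n} {R r a b : ℝ}
    {S : Set (En n)} (hS : MeasurableSet S) (hSf : volume S ≠ ⊤)
    (hr : 0 ≤ r) (ha : 0 ≤ a) (hb : 0 ≤ b) (t d : ι → En n → ℝ) (t₀ d₀ : En n → ℝ)
    (hg : ∀ᶠ i in l, GeoOK x₀ R r a b S (t i) (d i)) (hg0 : GeoOK x₀ R r a b S t₀ d₀)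
    (ht : ∀ x ∈ S, Tendsto (fun i => t i x) l (nhds (t₀ x)))
    (m : ι → En n → ℝ) (m₀ : En n → ℝ) (M' : ℝ)
    (hmm : ∀ᶠ i in l, AEStronglyMeasurable (m i) (volume.restrict S))
    (hmm0 : AEStronglyMeasurable m₀ (volume.restrict S))
    (hmb : ∀ᶠ i in l, ∀ x ∈ S, |m i x| ≤ M') (hmb0 : ∀ x ∈ S, |m₀ x| ≤ M')
    (hmt : ∀ x ∈ S, Tendsto (fun i => m i x) l (nhds (m₀ x)))
    {κ : En n → ℝ} (hκ : KOK r κ) {p : ℝ} (hp : 1 < p)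
    {w : En n → ℝ} (hw : MemLp w (ENNReal.ofReal p) (volume.restrict (ball x₀ R))) :
    Tendsto (fun i => eLpNorm ((fun x => m i x * Uop x₀ R (t i) κ w x) -
      fun x => m₀ x * Uop x₀ R t₀ κ w x) (ENNReal.ofReal p) (volume.restrict S)) l (nhds 0) := by
  obtain ⟨M, hM0, hM⟩ := hκ.bdd
  have lin : ∀ (m t : En n → ℝ) (w w' : En n → ℝ),
      MemLp w (ENNReal.ofReal p) (volume.restrict (ball x₀ R)) →
      MemLp w' (ENNReal.ofReal p) (volume.restrict (ball x₀ R)) →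
      ((fun x => m x * Uop x₀ R t κ w x) - fun x => m x * Uop x₀ R t κ w' x) =
        fun x => m x * Uop x₀ R t κ (w - w') x := by
    intro m t w w' hw hw'
    funext x
    rw [Uop_sub hκ (integrable_of_memLp hp hw) (integrable_of_memLp hp hw')]
    simp only [Pi.sub_apply]; ring
  refine tendsto_density hp (fun i w x => m i x * Uop x₀ R (t i) κ w x)
    (fun w x => m₀ x * Uop x₀ R t₀ κ w x)
    (ENNReal.ofReal M' * ENNReal.ofReal M * schurC n p r a b ^ (1 / p)) ?_ ?_ ?_ ?_ ?_ ?_ w hw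
  · refine ENNReal.mul_ne_top (ENNReal.mul_ne_top ENNReal.ofReal_ne_top ENNReal.ofReal_ne_top)
      (ENNReal.rpow_ne_top_of_nonneg (by positivity) (schurC_ne_top hp))
  · filter_upwards [hg, hmm] with i hi hmi w hw
    exact hmi.mul (aesm_Uop hκ.1.continuous hi.meas hw.1 S)
  · intro w hw
    exact hmm0.mul (aesm_Uop hκ.1.continuous hg0.meas hw.1 S)
  · filter_upwards [hg, hmb] with i hi hmi w w' hw hw'
    rw [lin _ _ w w' hw hw']
    exact eLpNorm_mUop_le hS hr ha hb hi hp hκ hM hmi (hw.1.sub hw'.1)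
  · intro w w' hw hw'
    rw [lin _ _ w w' hw hw']
    exact eLpNorm_mUop_le hS hr ha hb hg0 hp hκ hM hmb0 (hw.1.sub hw'.1)
  · intro w hwc hws
    obtain ⟨W, hW⟩ := hws.exists_bound_of_continuous hwc
    have hwi : IntegrableOn w (ball x₀ R) := (hwc.integrable_of_hasCompactSupport hws).integrableOn
    have : IsFiniteMeasure ((volume : Measure (En n)).restrict S) :=
      ⟨by rw [Measure.restrict_apply_univ]; exact hSf.lt_top⟩
    set Q : ℝ≥0∞ := ENNReal.ofReal M *
      ((ENNReal.ofReal (r ^ n) * volume (ball (0 : En n) 1)) * ENNReal.ofReal W) with hQ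
    have hQt : Q ≠ ⊤ := by
      refine ENNReal.mul_ne_top ENNReal.ofReal_ne_top (ENNReal.mul_ne_top
        (ENNReal.mul_ne_top ENNReal.ofReal_ne_top measure_ball_lt_top.ne) ENNReal.ofReal_ne_top)
    refine eLpNorm_tendsto_bdd hp _ ?_ (ENNReal.ofReal M' * Q + ENNReal.ofReal M' * Q) ?_ ?_ ?_
    · filter_upwards [hg, hmm] with i hi hmi
      exact (hmi.mul (aesm_Uop hκ.1.continuous hi.meas hwi.1 S)).sub
        (hmm0.mul (aesm_Uop hκ.1.continuous hg0.meas hwi.1 S))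
    · have := ENNReal.mul_ne_top (ENNReal.ofReal_ne_top (r := M')) hQt
      exact ENNReal.add_ne_top.2 ⟨this, this⟩
    · filter_upwards [hg, hmb] with i hi hmi
      refine (ae_restrict_mem hS).mono fun x hx => ?_
      simp only [Pi.sub_apply]
      refine (enorm_sub_le).trans (add_le_add ?_ ?_)
      · rw [enorm_mul]
        refine mul_le_mul' ?_ (enorm_Uop_le_const hr hκ hM (hi.pos x hx) w hW)
        rw [Real.enorm_eq_ofReal_abs]; exact ENNReal.ofReal_le_ofReal (hmi x hx)
      · rw [enorm_mul]
        refine mul_le_mul' ?_ (enorm_Uop_le_const hr hκ hM (hg0.pos x hx) w hW)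
        rw [Real.enorm_eq_ofReal_abs]; exact ENNReal.ofReal_le_ofReal (hmb0 x hx)
    · refine (ae_restrict_mem hS).mono fun x hx => ?_
      have h0 := hg0.pos x hx
      have hti : Tendsto (fun i => (t i x)⁻¹) l (nhds (t₀ x)⁻¹) := (ht x hx).inv₀ h0.ne'
      have hU : Tendsto (fun i => Uop x₀ R (t i) κ w x) l (nhds (Uop x₀ R t₀ κ w x)) := by
        unfold Uop
        have hb1 : ∀ᶠ i in l, |(t i x)⁻¹ ^ n| ≤ |(t₀ x)⁻¹ ^ n| + 1 := by
          have := (hti.pow n).abs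
          filter_upwards [this.eventually (gt_mem_nhds (lt_add_one _))] with i hi
          exact hi.le
        refine tendsto_integral_filter_of_dominated_convergence
          (fun z => ‖w z‖ * (M * (|(t₀ x)⁻¹ ^ n| + 1))) ?_ ?_ ?_ ?_
        · filter_upwards with i
          exact (integrable_wKer hκ hwi x).1
        · filter_upwards [hb1] with i hi
          refine ae_of_all _ fun z => ?_
          rw [norm_mul]
          gcongr
          unfold Ker
          rw [norm_mul]
          exact mul_le_mul (hM _) hi (abs_nonneg _) hM0
        · exact hwi.norm.mul_const _
        · refine ae_of_all _ fun z => ?_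
          refine tendsto_const_nhds.mul ?_
          unfold Ker yv
          refine Tendsto.mul ?_ (hti.pow n)
          exact (hκ.1.continuous.tendsto _).comp
            ((hti.smul tendsto_const_nhds).sub tendsto_const_nhds)
      have := ((hmt x hx).mul hU).sub_const (m₀ x * Uop x₀ R t₀ κ w x)
      simpa using this

lemma integral_Ker {x₀ : En n} {t κ : En n → ℝ} {x : En n} (htx : 0 < t x) :
    ∫ z, Ker x₀ t κ x z = ∫ y, κ y := by
  unfold Ker yv
  rw [integral_mul_const, integral_sub_left_eq_self (fun z => κ ((t x)⁻¹ • z - (x - x₀))) volume x,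
    Measure.integral_comp_inv_smul_of_nonneg volume (fun z => κ (z - (x - x₀))) htx.le,
    integral_sub_right_eq_self]
  simp only [finrank_euclideanSpace, Fintype.card_fin, smul_eq_mul]
  rw [mul_right_comm, ← mul_pow, mul_inv_cancel₀ htx.ne', one_pow, one_mul]

lemma z_eq {x₀ : En n} {t : ℝ} (ht : 0 < t) (x z : En n) :
    x - z = t • ((x - x₀) + yv x₀ t x z) := by
  unfold yv
  rw [add_sub_cancel, smul_inv_smul₀ ht.ne']

lemma geo_const {x₀ : En n} {R r τ : ℝ} (hrR : r < R) (hτ : 0 < τ) (hτ1 : τ < 1) :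
    GeoOK x₀ R r 1 (R + r) (ball x₀ R) (fun _ => τ) (fun _ => τ) where
  meas := measurable_const
  pos := fun _ _ => hτ
  geo := by
    intro x hx z hy
    have hx' : ‖x - x₀‖ < R := by simpa [dist_eq_norm] using hx
    have e := z_eq (x₀ := x₀) hτ x z
    refine ⟨?_, hτ, by simp, ?_⟩
    · rw [mem_ball, dist_eq_norm]
      have : z - x₀ = (1 - τ) • (x - x₀) - τ • yv x₀ τ x z := by
        have : z = x - τ • ((x - x₀) + yv x₀ τ x z) := by rw [← e]; abel
        conv_lhs => rw [this]
        rw [smul_add, sub_smul, one_smul]; abel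
      rw [this]
      calc _ ≤ ‖(1 - τ) • (x - x₀)‖ + ‖τ • yv x₀ τ x z‖ := norm_sub_le _ _
        _ = (1 - τ) * ‖x - x₀‖ + τ * ‖yv x₀ τ x z‖ := by
          rw [norm_smul, norm_smul, Real.norm_of_nonneg hτ.le, Real.norm_of_nonneg (by linarith)]
        _ ≤ (1 - τ) * R + τ * r := by
          gcongr
        _ < R := by nlinarith
    · rw [e, norm_smul, Real.norm_of_nonneg hτ.le, mul_comm]
      gcongr
      exact (norm_add_le _ _).trans (add_le_add hx'.le hy)

lemma V_tendsto {x₀ : En n} {R r : ℝ} (hr : 0 ≤ r) (hrR : r < R)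
    (c : ℝ → ℝ) (hc : Tendsto c (nhdsWithin 0 (Set.Ioi 0)) (nhds 1))
    {κ : En n → ℝ} (hκ : KOK r κ) (hκ1 : ∫ y, κ y = 1) {p : ℝ} (hp : 1 < p)
    {w : En n → ℝ} (hw : MemLp w (ENNReal.ofReal p) (volume.restrict (ball x₀ R))) :
    Tendsto (fun τ => eLpNorm ((fun x => c τ * Uop x₀ R (fun _ => τ) κ w x) - w)
      (ENNReal.ofReal p) (volume.restrict (ball x₀ R))) (nhdsWithin 0 (Set.Ioi 0)) (nhds 0) := by
  obtain ⟨M, hM0, hM⟩ := hκ.bdd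
  have hS : MeasurableSet (ball x₀ R) := measurableSet_ball
  have lin : ∀ (m t : En n → ℝ) (w w' : En n → ℝ),
      MemLp w (ENNReal.ofReal p) (volume.restrict (ball x₀ R)) →
      MemLp w' (ENNReal.ofReal p) (volume.restrict (ball x₀ R)) →
      ((fun x => m x * Uop x₀ R t κ w x) - fun x => m x * Uop x₀ R t κ w' x) =
        fun x => m x * Uop x₀ R t κ (w - w') x := by
    intro m t w w' hw hw'
    funext x
    rw [Uop_sub hκ (integrable_of_memLp hp hw) (integrable_of_memLp hp hw')]
    simp only [Pi.sub_apply]; ring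
  have hgeo : ∀ᶠ τ : ℝ in nhdsWithin 0 (Set.Ioi 0),
      GeoOK x₀ R r 1 (R + r) (ball x₀ R) (fun _ => τ) (fun _ => τ) := by
    filter_upwards [Ioo_mem_nhdsGT (zero_lt_one (α := ℝ))] with τ hτ
    exact geo_const hrR hτ.1 hτ.2
  have hcb : ∀ᶠ τ : ℝ in nhdsWithin 0 (Set.Ioi 0), |c τ| ≤ 2 := by
    have := hc.abs
    filter_upwards [this.eventually (gt_mem_nhds (show |(1:ℝ)| < 2 by norm_num))] with τ hτ
    exact hτ.le
  refine tendsto_density hp (fun τ w x => c τ * Uop x₀ R (fun _ => τ) κ w x)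
    (fun w => w)
    (ENNReal.ofReal 2 * ENNReal.ofReal M * schurC n p r 1 (R + r) ^ (1 / p) + 1)
    ?_ ?_ ?_ ?_ ?_ ?_ w hw
  · refine ENNReal.add_ne_top.2 ⟨ENNReal.mul_ne_top (ENNReal.mul_ne_top ENNReal.ofReal_ne_top
      ENNReal.ofReal_ne_top)
      (ENNReal.rpow_ne_top_of_nonneg (by positivity) (schurC_ne_top hp)), by simp⟩
  · filter_upwards with τ w hw
    exact aestronglyMeasurable_const.mul (aesm_Uop hκ.1.continuous measurable_const hw.1 _)
  · intro w hw
    exact hw.1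
  · filter_upwards [hgeo, hcb] with τ hτ hcτ w w' hw hw'
    have := lin (fun _ => c τ) (fun _ => τ) w w' hw hw'
    rw [this]
    refine (eLpNorm_mUop_le hS hr zero_le_one (by linarith) hτ hp hκ hM
      (fun x _ => hcτ) (hw.1.sub hw'.1)).trans ?_
    gcongr
    exact le_self_add
  · intro w w' hw hw'
    conv_lhs => rw [← one_mul (eLpNorm _ _ _)]
    gcongr
    exact le_add_self
  · intro w hwc hws
    obtain ⟨W, hW⟩ := hws.exists_bound_of_continuous hwc
    have hwi : IntegrableOn w (ball x₀ R) := (hwc.integrable_of_hasCompactSupport hws).integrableOn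
    have : IsFiniteMeasure ((volume : Measure (En n)).restrict (ball x₀ R)) :=
      ⟨by rw [Measure.restrict_apply_univ]; exact measure_ball_lt_top⟩
    set Q : ℝ≥0∞ := ENNReal.ofReal M *
      ((ENNReal.ofReal (r ^ n) * volume (ball (0 : En n) 1)) * ENNReal.ofReal W) with hQ
    have hQt : Q ≠ ⊤ := by
      refine ENNReal.mul_ne_top ENNReal.ofReal_ne_top (ENNReal.mul_ne_top
        (ENNReal.mul_ne_top ENNReal.ofReal_ne_top measure_ball_lt_top.ne) ENNReal.ofReal_ne_top)
    refine eLpNorm_tendsto_bdd hp _ ?_ (ENNReal.ofReal 2 * Q + ENNReal.ofReal W) ?_ ?_ ?_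
    · filter_upwards with τ
      exact (aestronglyMeasurable_const.mul
        (aesm_Uop hκ.1.continuous measurable_const hwi.1 _)).sub hwi.1
    · have := ENNReal.mul_ne_top (ENNReal.ofReal_ne_top (r := 2)) hQt
      exact ENNReal.add_ne_top.2 ⟨this, ENNReal.ofReal_ne_top⟩
    · filter_upwards [hgeo, hcb] with τ hi hcτ
      refine (ae_restrict_mem hS).mono fun x hx => ?_
      simp only [Pi.sub_apply]
      refine (enorm_sub_le).trans (add_le_add ?_ ?_)
      · rw [enorm_mul]
        refine mul_le_mul' ?_ (enorm_Uop_le_const hr hκ hM (hi.pos x hx) w hW)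
        rw [Real.enorm_eq_ofReal_abs]; exact ENNReal.ofReal_le_ofReal hcτ
      · rw [Real.enorm_eq_ofReal_abs]; exact ENNReal.ofReal_le_ofReal (hW x)
    · refine (ae_restrict_mem hS).mono fun x hx => ?_
      have hU : Tendsto (fun τ : ℝ => Uop x₀ R (fun _ => τ) κ w x) (nhdsWithin 0 (Set.Ioi 0))
          (nhds (w x)) := by
        rw [Metric.tendsto_nhds]
        intro ε hε
        set K1 : ℝ := M * (r ^ n * (volume (ball (0 : En n) 1)).toReal) with hK1
        have hK10 : 0 ≤ K1 := by positivity
        have hη : 0 < ε / (K1 + 1) := by positivity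
        obtain ⟨δ, hδ, hδw⟩ := Metric.continuous_iff.1 hwc x _ hη
        have hRr : 0 < R + r := by linarith
        filter_upwards [hgeo, Ioo_mem_nhdsGT (show (0:ℝ) < δ / (R + r) by positivity)] with τ hτ hτ2
        have hτ0 := hτ2.1
        have hbig : ∀ z, z ∉ ball x₀ R → Ker x₀ (fun _ => τ) κ x z = 0 := by
          intro z hz
          unfold Ker
          by_cases hy : ‖yv x₀ τ x z‖ ≤ r
          · exact absurd (hτ.geo x hx z hy).1 hz
          · rw [hκ.2 _ (not_le.1 hy), zero_mul]
        have e1 : w x = ∫ z in ball x₀ R, w x * Ker x₀ (fun _ => τ) κ x z := by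
          rw [integral_const_mul, setIntegral_eq_integral_of_forall_compl_eq_zero hbig,
            integral_Ker hτ0, hκ1, mul_one]
        have e2 : Uop x₀ R (fun _ => τ) κ w x - w x =
            ∫ z in ball x₀ R, (w z - w x) * Ker x₀ (fun _ => τ) κ x z := by
          conv_lhs => rw [e1]
          unfold Uop
          rw [← integral_sub (integrable_wKer hκ hwi x)
            (integrable_wKer hκ (integrable_const _) x)]
          congr 1; funext z; ring
        rw [dist_eq_norm, e2]
        have e3 : ‖∫ z in ball x₀ R, (w z - w x) * Ker x₀ (fun _ => τ) κ x z‖ₑ ≤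
            ENNReal.ofReal (ε / (K1 + 1)) * (ENNReal.ofReal M *
              (ENNReal.ofReal (r ^ n) * volume (ball (0 : En n) 1))) := by
          refine (enorm_integral_le_lintegral_enorm _).trans ?_
          calc _ ≤ ∫⁻ z in ball x₀ R, ENNReal.ofReal (ε / (K1 + 1)) * (ENNReal.ofReal M *
                kk x₀ r (fun _ => τ) x z) := by
                refine lintegral_mono fun z => ?_
                rw [enorm_mul]
                by_cases hy : ‖yv x₀ τ x z‖ ≤ r
                · refine mul_le_mul' ?_ (enorm_Ker_le hκ hM hτ0 z)
                  rw [Real.enorm_eq_ofReal_abs]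
                  apply ENNReal.ofReal_le_ofReal
                  have h4 := (hτ.geo x hx z hy).2.2.2
                  have : dist z x < δ := by
                    rw [dist_comm, dist_eq_norm]
                    refine h4.trans_lt ?_
                    have := hτ2.2
                    rw [lt_div_iff₀ hRr] at this
                    linarith
                  exact (hδw z this).le
                · unfold Ker
                  rw [hκ.2 _ (not_le.1 hy)]; simp
            _ = ENNReal.ofReal (ε / (K1 + 1)) * (ENNReal.ofReal M *
                ∫⁻ z in ball x₀ R, kk x₀ r (fun _ => τ) x z) := by
                rw [lintegral_const_mul' _ _ ENNReal.ofReal_ne_top,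
                  lintegral_const_mul' _ _ ENNReal.ofReal_ne_top]
            _ ≤ _ := by gcongr; exact lintegral_kk_le hr hτ0
        have e4 : ENNReal.ofReal (ε / (K1 + 1)) * (ENNReal.ofReal M *
              (ENNReal.ofReal (r ^ n) * volume (ball (0 : En n) 1))) =
              ENNReal.ofReal (ε / (K1 + 1) * K1) := by
          rw [hK1, ENNReal.ofReal_mul (by positivity), ENNReal.ofReal_mul hM0,
            ENNReal.ofReal_mul (by positivity), ENNReal.ofReal_toReal measure_ball_lt_top.ne]
        rw [e4, Real.enorm_eq_ofReal_abs] at e3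
        rw [Real.norm_eq_abs]
        have e5 := (ENNReal.ofReal_le_ofReal_iff (by positivity)).1 e3
        refine e5.trans_lt ?_
        rw [div_mul_eq_mul_div, div_lt_iff₀ (by positivity)]
        nlinarith
      have := (hc.mul hU).sub_const (w x)
      simpa using this

lemma param_hasFDerivAt {G : Type} [NormedAddCommGroup G] [NormedSpace ℝ G] {x₀ : En n} {R : ℝ}
    {w : En n → ℝ} (hw : IntegrableOn w (ball x₀ R)) (F : En n × En n → G)
    (hF : ContDiff ℝ (⊤ : ℕ∞) F) (x : En n) :
    HasFDerivAt (fun x => ∫ z in ball x₀ R, w z • F (x, z))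
      (∫ z in ball x₀ R, w z • (fderiv ℝ F (x, z)).comp (ContinuousLinearMap.inl ℝ (En n) (En n)))
      x := by
  have hcont : Continuous F := hF.continuous
  have hD : Continuous (fun q => (fderiv ℝ F q).comp (ContinuousLinearMap.inl ℝ (En n) (En n))) :=
    (hF.continuous_fderiv (by simp)).clm_comp continuous_const
  obtain ⟨C, hC⟩ := ((isCompact_closedBall x 1).prod
    (isCompact_closedBall x₀ R)).exists_bound_of_continuousOn hD.continuousOn
  have hmeas : ∀ x', AEStronglyMeasurable (fun z => w z • F (x', z))
      (volume.restrict (ball x₀ R)) := fun x' =>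
    hw.1.smul (hcont.comp (by fun_prop : Continuous fun z => (x', z))).aestronglyMeasurable
  have hb : ∀ᵐ z ∂volume.restrict (ball x₀ R), z ∈ closedBall x₀ R :=
    (ae_restrict_mem measurableSet_ball).mono fun z hz => ball_subset_closedBall hz
  refine hasFDerivAt_integral_of_dominated_of_fderiv_le (bound := fun z => ‖w z‖ * C)
    (s := ball x 1) (ball_mem_nhds x one_pos)
    (F' := fun x z => w z • (fderiv ℝ F (x, z)).comp (ContinuousLinearMap.inl ℝ (En n) (En n)))
    (Eventually.of_forall hmeas) ?_ ?_ ?_ ?_ ?_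
  · obtain ⟨C', hC'⟩ := (isCompact_closedBall x₀ R).exists_bound_of_continuousOn
      (hcont.comp (by fun_prop : Continuous fun z => (x, z))).continuousOn
    refine Integrable.mono' (hw.norm.mul_const C') (hmeas x) ?_
    filter_upwards [hb] with z hz
    rw [norm_smul]
    gcongr
    exact hC' z hz
  · exact hw.1.smul (hD.comp (by fun_prop : Continuous fun z => (x, z))).aestronglyMeasurable
  · filter_upwards [hb] with z hz x' hx'
    rw [norm_smul]
    gcongr
    exact hC (x', z) ⟨ball_subset_closedBall hx', hz⟩
  · exact hw.norm.mul_const C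
  · refine ae_of_all _ fun z x' _ => ?_
    have h1 : HasFDerivAt (fun x => F (x, z))
        ((fderiv ℝ F (x', z)).comp (ContinuousLinearMap.inl ℝ (En n) (En n))) x' := by
      have h2 := (hF.differentiable (by simp) (x', z)).hasFDerivAt
      exact h2.comp x' (hasFDerivAt_prodMk_left x' z)
    exact h1.const_smul (w z)

lemma param_contDiff {x₀ : En n} {R : ℝ}
    {w : En n → ℝ} (hw : IntegrableOn w (ball x₀ R)) (m : ℕ) :
    ∀ {G : Type} [NormedAddCommGroup G] [NormedSpace ℝ G] (F : En n × En n → G)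
      (_ : ContDiff ℝ (⊤ : ℕ∞) F), ContDiff ℝ m (fun x => ∫ z in ball x₀ R, w z • F (x, z)) := by
  induction m with
  | zero =>
    intro G _ _ F hF
    rw [CharP.cast_eq_zero, contDiff_zero, continuous_iff_continuousAt]
    exact fun x => (param_hasFDerivAt hw F hF x).continuousAt
  | succ m ih =>
    intro G _ _ F hF
    push_cast
    rw [contDiff_succ_iff_fderiv]
    refine ⟨fun x => (param_hasFDerivAt hw F hF x).differentiableAt, by simp, ?_⟩
    have : fderiv ℝ (fun x => ∫ z in ball x₀ R, w z • F (x, z)) = fun x =>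
        ∫ z in ball x₀ R, w z •
          (fun q => (fderiv ℝ F q).comp (ContinuousLinearMap.inl ℝ (En n) (En n))) (x, z) :=
      funext fun x => (param_hasFDerivAt hw F hF x).fderiv
    rw [this]
    exact ih (fun q => (fderiv ℝ F q).comp (ContinuousLinearMap.inl ℝ (En n) (En n)))
      ((hF.fderiv_right (m := (⊤ : ℕ∞)) (by simp)).clm_comp contDiff_const)

/-- partial derivative -/
def pd (m : Fin n) (κ : En n → ℝ) : En n → ℝ := fun y => fderiv ℝ κ y (basisVec m)

/-- multiplication by a coordinate -/
def mulc (m : Fin n) (κ : En n → ℝ) : En n → ℝ := fun y => y m * κ y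

lemma contDiff_pd {κ : En n → ℝ} (h : ContDiff ℝ (⊤ : ℕ∞) κ) (m : Fin n) :
    ContDiff ℝ (⊤ : ℕ∞) (pd m κ) :=
  (h.fderiv_right (m := (⊤ : ℕ∞)) (by simp)).clm_apply contDiff_const

lemma contDiff_coord (m : Fin n) : ContDiff ℝ (⊤ : ℕ∞) (fun y : En n => y m) :=
  (EuclideanSpace.proj m : En n →L[ℝ] ℝ).contDiff

lemma hasFDerivAt_coord (m : Fin n) (x : En n) :
    HasFDerivAt (fun y : En n => y m) (EuclideanSpace.proj m : En n →L[ℝ] ℝ) x :=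
  (EuclideanSpace.proj m : En n →L[ℝ] ℝ).hasFDerivAt

lemma contDiff_mulc {κ : En n → ℝ} (h : ContDiff ℝ (⊤ : ℕ∞) κ) (m : Fin n) :
    ContDiff ℝ (⊤ : ℕ∞) (mulc m κ) := (contDiff_coord m).mul h

lemma KOK.pd {r : ℝ} {κ : En n → ℝ} (h : KOK r κ) (m : Fin n) : KOK r (pd m κ) := by
  refine ⟨contDiff_pd h.1 m, fun y hy => ?_⟩
  have : κ =ᶠ[nhds y] fun _ => 0 := by
    filter_upwards [(isOpen_lt continuous_const continuous_norm).mem_nhds hy] with y' hy'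
    exact h.2 y' hy'
  unfold _root_.pd
  rw [this.fderiv_eq]; simp

lemma KOK.mulc {r : ℝ} {κ : En n → ℝ} (h : KOK r κ) (m : Fin n) : KOK r (mulc m κ) :=
  ⟨contDiff_mulc h.1 m, fun y hy => by unfold _root_.mulc; rw [h.2 y hy, mul_zero]⟩

lemma vec_expand (v : En n) : v = ∑ m, v m • (basisVec m : En n) := by
  ext i
  simp [basisVec, Pi.single_apply]

lemma fderiv_expand (κ : En n → ℝ) (y v : En n) : fderiv ℝ κ y v = ∑ m, v m * pd m κ y := by
  conv_lhs => rw [vec_expand v, map_sum]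
  simp [pd]

lemma contDiff_KerF {x₀ : En n} {t κ : En n → ℝ} (hκ : ContDiff ℝ (⊤ : ℕ∞) κ)
    (ht : ContDiff ℝ (⊤ : ℕ∞) t) (ht0 : ∀ x, 0 < t x) :
    ContDiff ℝ (⊤ : ℕ∞) (fun q : En n × En n => Ker x₀ t κ q.1 q.2) := by
  unfold Ker yv
  have h1 : ContDiff ℝ (⊤ : ℕ∞) fun q : En n × En n => (t q.1)⁻¹ :=
    (ht.comp contDiff_fst).inv (fun q => (ht0 q.1).ne')
  refine (hκ.comp ?_).mul (h1.pow n)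
  exact (h1.smul (contDiff_fst.sub contDiff_snd)).sub (contDiff_fst.sub contDiff_const)

lemma contDiff_Uop {x₀ : En n} {R : ℝ} {t κ w : En n → ℝ} (hκ : ContDiff ℝ (⊤ : ℕ∞) κ)
    (ht : ContDiff ℝ (⊤ : ℕ∞) t) (ht0 : ∀ x, 0 < t x) (hw : IntegrableOn w (ball x₀ R)) :
    ContDiff ℝ (⊤ : ℕ∞) (Uop x₀ R t κ w) := by
  have h := contDiff_KerF (x₀ := x₀) hκ ht ht0
  exact contDiff_infty.2 fun m => param_contDiff hw m _ h

lemma Ker_deriv {x₀ : En n} {t κ : En n → ℝ} (hκ : ContDiff ℝ (⊤ : ℕ∞) κ)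
    (ht : ContDiff ℝ (⊤ : ℕ∞) t) (ht0 : ∀ x, 0 < t x) (x z : En n) (j : Fin n) :
    fderiv ℝ (fun x => Ker x₀ t κ x z) x (basisVec j) =
      (t x)⁻¹ * ((1 - t x) * Ker x₀ t (pd j κ) x z - pd j t x * ∑ m, ((x - x₀) m *
        Ker x₀ t (pd m κ) x z + Ker x₀ t (mulc m (pd m κ)) x z) -
        n * pd j t x * Ker x₀ t κ x z) := by
  have h0 := (ht0 x).ne'
  have hT : HasFDerivAt t (fderiv ℝ t x) x := (ht.differentiable (by simp) x).hasFDerivAt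
  have hTi : HasFDerivAt (fun x => (t x)⁻¹) (-(t x ^ 2)⁻¹ • fderiv ℝ t x) x :=
    (hasDerivAt_inv h0).comp_hasFDerivAt x hT
  have hy : HasFDerivAt (fun x => yv x₀ (t x) x z)
      (((t x)⁻¹ • (ContinuousLinearMap.id ℝ (En n)) +
        (-(t x ^ 2)⁻¹ • fderiv ℝ t x).smulRight (x - z)) - ContinuousLinearMap.id ℝ (En n)) x := by
    unfold yv
    exact (hTi.smul ((hasFDerivAt_id x).sub_const z)).sub ((hasFDerivAt_id x).sub_const x₀)
  have hk := ((hκ.differentiable (by simp) (yv x₀ (t x) x z)).hasFDerivAt).comp x hy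
  have hp := hTi.pow n
  have := (hk.mul hp).fderiv
  unfold Ker
  simp only [Function.comp_def] at this
  erw [this]
  have ez := z_eq (x₀ := x₀) (ht0 x) x z
  set y := yv x₀ (t x) x z with hyd
  have ey : (((t x)⁻¹ • (ContinuousLinearMap.id ℝ (En n)) +
        (-(t x ^ 2)⁻¹ • fderiv ℝ t x).smulRight (x - z)) - ContinuousLinearMap.id ℝ (En n))
        (basisVec j) = ((t x)⁻¹ - 1) • basisVec j + (-(t x)⁻¹ * pd j t x) • ((x - x₀) + y) := by
    simp only [_root_.sub_apply, _root_.add_apply,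
      _root_.smul_apply, ContinuousLinearMap.id_apply,
      ContinuousLinearMap.smulRight_apply, smul_eq_mul]
    rw [ez, smul_smul, sub_smul, one_smul, pd]
    have : -(t x ^ 2)⁻¹ * (fderiv ℝ t x) (basisVec j) * t x =
      -(t x)⁻¹ * fderiv ℝ t x (basisVec j) := by field_simp
    rw [this]; abel
  have ek : ((fderiv ℝ κ y).comp (((t x)⁻¹ • (ContinuousLinearMap.id ℝ (En n)) +
        (-(t x ^ 2)⁻¹ • fderiv ℝ t x).smulRight (x - z)) - ContinuousLinearMap.id ℝ (En n)))
        (basisVec j) = ((t x)⁻¹ - 1) * pd j κ y + (-(t x)⁻¹ * pd j t x) *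
          ∑ m, ((x - x₀) m * pd m κ y + y m * pd m κ y) := by
    rw [ContinuousLinearMap.comp_apply, ey, map_add, map_smul, map_smul,
      fderiv_expand κ y ((x - x₀) + y)]
    simp only [smul_eq_mul]
    congr 2
    refine Finset.sum_congr rfl fun m _ => ?_
    simp [add_mul]
  simp only [_root_.add_apply, _root_.smul_apply, ek, smul_eq_mul,
    mulc, ← Finset.sum_mul, ← mul_assoc, ← add_mul]
  have en : (n : ℝ) * (t x)⁻¹ ^ (n - 1) * (t x ^ 2)⁻¹ = n * (t x)⁻¹ ^ n * (t x)⁻¹ := by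
    rcases Nat.eq_zero_or_pos n with h | h
    · simp [h]
    · obtain ⟨k, hk⟩ := Nat.exists_eq_add_of_le' h
      have : (t x)⁻¹ ^ n = (t x)⁻¹ ^ (n - 1) * (t x)⁻¹ := by
        rw [← pow_succ]; congr 1; omega
      rw [this, ← inv_pow]; ring
  have e1 : (t x)⁻¹ * (1 - t x) = (t x)⁻¹ - 1 := by field_simp
  have e2 : (fderiv ℝ t x) (basisVec j) = pd j t x := rfl
  rw [nsmul_eq_mul, e2]
  linear_combination (-(κ y * pd j t x)) * en - (t x)⁻¹ ^ n * pd j κ y * e1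


lemma Uop_deriv {x₀ : En n} {R : ℝ} {t κ w : En n → ℝ} (hκ : ContDiff ℝ (⊤ : ℕ∞) κ)
    (ht : ContDiff ℝ (⊤ : ℕ∞) t) (ht0 : ∀ x, 0 < t x) (hw : IntegrableOn w (ball x₀ R))
    (x : En n) (j : Fin n) :
    pd j (Uop x₀ R t κ w) x =
      (t x)⁻¹ * ((1 - t x) * Uop x₀ R t (pd j κ) w x - pd j t x * ∑ m, ((x - x₀) m *
        Uop x₀ R t (pd m κ) w x + Uop x₀ R t (mulc m (pd m κ)) w x) -
        n * pd j t x * Uop x₀ R t κ w x) := by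
  have hF := contDiff_KerF (x₀ := x₀) hκ ht ht0
  have h1 := (param_hasFDerivAt hw _ hF x).fderiv
  have hI : ∀ κ' : En n → ℝ, ContDiff ℝ (⊤ : ℕ∞) κ' →
      IntegrableOn (fun z => w z * Ker x₀ t κ' x z) (ball x₀ R) := by
    intro κ' hκ'
    have hc : Continuous fun z => Ker x₀ t κ' x z :=
      (contDiff_KerF (x₀ := x₀) hκ' ht ht0).continuous.comp
        (by fun_prop : Continuous fun z => (x, z))
    obtain ⟨C', hC'⟩ := (isCompact_closedBall x₀ R).exists_bound_of_continuousOn hc.continuousOn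
    refine Integrable.mono' (hw.norm.mul_const C') (hw.1.mul hc.aestronglyMeasurable) ?_
    filter_upwards [ae_restrict_mem measurableSet_ball] with z hz
    rw [norm_mul]
    gcongr
    exact hC' z (ball_subset_closedBall hz)
  have hI2 : IntegrableOn (fun z => w z • (fderiv ℝ (fun q : En n × En n => Ker x₀ t κ q.1 q.2)
      (x, z)).comp (ContinuousLinearMap.inl ℝ (En n) (En n))) (ball x₀ R) := by
    have hc : Continuous fun z => (fderiv ℝ (fun q : En n × En n => Ker x₀ t κ q.1 q.2)
      (x, z)).comp (ContinuousLinearMap.inl ℝ (En n) (En n)) :=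
      ((hF.continuous_fderiv (by simp)).clm_comp continuous_const).comp
        (by fun_prop : Continuous fun z => (x, z))
    obtain ⟨C', hC'⟩ := (isCompact_closedBall x₀ R).exists_bound_of_continuousOn hc.continuousOn
    refine Integrable.mono' (hw.norm.mul_const C') (hw.1.smul hc.aestronglyMeasurable) ?_
    filter_upwards [ae_restrict_mem measurableSet_ball] with z hz
    rw [norm_smul]
    gcongr
    exact hC' z (ball_subset_closedBall hz)
  have h2 : pd j (Uop x₀ R t κ w) x = ∫ z in ball x₀ R, w z *
      fderiv ℝ (fun x => Ker x₀ t κ x z) x (basisVec j) := by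
    unfold pd
    have e : Uop x₀ R t κ w = fun x => ∫ z in ball x₀ R, w z • Ker x₀ t κ x z := rfl
    rw [e, h1, ContinuousLinearMap.integral_apply hI2]
    refine integral_congr_ae (ae_of_all _ fun z => ?_)
    have h3 : HasFDerivAt (fun x => Ker x₀ t κ x z)
        ((fderiv ℝ (fun q : En n × En n => Ker x₀ t κ q.1 q.2) (x, z)).comp
          (ContinuousLinearMap.inl ℝ (En n) (En n))) x := by
      have h2 := (hF.differentiable (by simp) (x, z)).hasFDerivAt
      have h4 : HasFDerivAt (fun x : En n => (x, z))
        (ContinuousLinearMap.inl ℝ (En n) (En n)) x := hasFDerivAt_prodMk_left x z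
      have h5 := HasFDerivAt.comp (f := fun x : En n => (x, z)) x h2 h4
      exact h5
    simp only [_root_.smul_apply, smul_eq_mul, h3.fderiv]
  rw [h2]
  simp only [Ker_deriv hκ ht ht0]
  have hs : ∀ m, IntegrableOn (fun z => (x - x₀) m * (w z * Ker x₀ t (pd m κ) x z) +
      w z * Ker x₀ t (mulc m (pd m κ)) x z) (ball x₀ R) := fun m =>
    ((hI _ (contDiff_pd hκ m)).const_mul _).add (hI _ (contDiff_mulc (contDiff_pd hκ m) m))
  have e3 : ∀ z, w z * ((t x)⁻¹ * ((1 - t x) * Ker x₀ t (pd j κ) x z - pd j t x * ∑ m,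
        ((x - x₀) m * Ker x₀ t (pd m κ) x z + Ker x₀ t (mulc m (pd m κ)) x z) -
        n * pd j t x * Ker x₀ t κ x z)) =
      (t x)⁻¹ * ((1 - t x) * (w z * Ker x₀ t (pd j κ) x z) - pd j t x * ∑ m,
        ((x - x₀) m * (w z * Ker x₀ t (pd m κ) x z) + w z * Ker x₀ t (mulc m (pd m κ)) x z) -
        n * pd j t x * (w z * Ker x₀ t κ x z)) := by
    intro z
    have : ∑ m, ((x - x₀) m * (w z * Ker x₀ t (pd m κ) x z) + w z *
        Ker x₀ t (mulc m (pd m κ)) x z) = w z * ∑ m,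
        ((x - x₀) m * Ker x₀ t (pd m κ) x z + Ker x₀ t (mulc m (pd m κ)) x z) := by
      rw [Finset.mul_sum]; refine Finset.sum_congr rfl fun m _ => by ring
    rw [this]; ring
  simp only [e3]
  rw [integral_const_mul, integral_sub, integral_sub, integral_const_mul, integral_const_mul,
    integral_const_mul, integral_finsetSum _ (fun m _ => hs m)]
  · congr 4
    refine Finset.sum_congr rfl fun m _ => ?_
    rw [integral_add ((hI _ (contDiff_pd hκ m)).const_mul _)
      (hI _ (contDiff_mulc (contDiff_pd hκ m) m)), integral_const_mul]
    rfl
  · exact (hI _ (contDiff_pd hκ j)).const_mul _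
  · exact (integrable_finsetSum _ (fun m _ => hs m)).const_mul _
  · exact ((hI _ (contDiff_pd hκ j)).const_mul _).sub
      ((integrable_finsetSum _ (fun m _ => hs m)).const_mul _)
  · exact (hI _ hκ).const_mul _

lemma Uop_ibp {x₀ : En n} {R r : ℝ} {t κ v g : En n → ℝ} (hκ : KOK r κ) {m : Fin n}
    (hv : HasWeakPartial (ball x₀ R) v g m) {x : En n} (ht : 0 < t x)
    (hz : ∀ z, ‖yv x₀ (t x) x z‖ ≤ r → z ∈ ball x₀ R) :
    Uop x₀ R t (pd m κ) v x = t x * Uop x₀ R t κ g x := by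
  have hd : ∀ z, fderiv ℝ (fun z => Ker x₀ t κ x z) z (basisVec m) =
      -(t x)⁻¹ * Ker x₀ t (pd m κ) x z := by
    intro z
    have hy : HasFDerivAt (fun z => yv x₀ (t x) x z) (-(t x)⁻¹ • ContinuousLinearMap.id ℝ (En n))
        z := by
      unfold yv
      have := ((((hasFDerivAt_id z : HasFDerivAt (𝕜 := ℝ) id _ z)).const_sub x).const_smul ((t x)⁻¹)).sub_const (x - x₀)
      refine this.congr_fderiv ?_
      ext v
      simp
    have hk := ((hκ.1.differentiable (by simp) (yv x₀ (t x) x z)).hasFDerivAt).comp z hy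
    have := (hk.mul_const ((t x)⁻¹ ^ n)).fderiv
    unfold Ker
    simp only [Function.comp_def] at this
    erw [this]
    simp [pd]
    ring
  have hT : IsTestFun (ball x₀ R) (fun z => Ker x₀ t κ x z) := by
    have hs : tsupport (fun z => Ker x₀ t κ x z) ⊆ closedBall (x - t x • (x - x₀)) (t x * r) := by
      refine closure_minimal (fun z hz' => ?_) isClosed_closedBall
      rw [← yv_le_iff ht]
      by_contra hc
      exact hz' (by simp [Ker, hκ.2 _ (not_le.1 hc)])
    refine ⟨?_, ?_, fun z h => hz z ((yv_le_iff ht x z).2 (hs h))⟩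
    · unfold Ker yv
      refine (hκ.1.comp ?_).mul contDiff_const
      fun_prop
    · exact HasCompactSupport.of_support_subset_isCompact (isCompact_closedBall _ _)
        (subset_closure.trans hs)
  have h := hv _ hT
  simp only [hd] at h
  have e : ∀ z, v z * (-(t x)⁻¹ * Ker x₀ t (pd m κ) x z) =
    -(t x)⁻¹ * (v z * Ker x₀ t (pd m κ) x z) := fun z => by ring
  simp only [e] at h
  rw [integral_const_mul] at h
  unfold Uop
  have h0 := ht.ne'
  field_simp at h
  linarith

lemma pd_mulc {κ : En n → ℝ} (hκ : ContDiff ℝ (⊤ : ℕ∞) κ) (m : Fin n) :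
    pd m (mulc m κ) = fun y => mulc m (pd m κ) y + κ y := by
  funext y
  have := ((hasFDerivAt_coord m y).mul (hκ.differentiable (by simp) y).hasFDerivAt).fderiv
  unfold pd mulc
  erw [this]
  simp [basisVec]

lemma Uop_deriv' {x₀ : En n} {R r : ℝ} {t κ v : En n → ℝ} {g : Fin n → En n → ℝ}
    (hκ : KOK r κ) (ht : ContDiff ℝ (⊤ : ℕ∞) t) (ht0 : ∀ x, 0 < t x)
    (hw : IntegrableOn v (ball x₀ R))
    (hv : ∀ m, HasWeakPartial (ball x₀ R) v (g m) m) {x : En n}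
    (hz : ∀ z, ‖yv x₀ (t x) x z‖ ≤ r → z ∈ ball x₀ R) (j : Fin n) :
    pd j (Uop x₀ R t κ v) x =
      (1 - t x) * Uop x₀ R t κ (g j) x - pd j t x * ∑ m, ((x - x₀) m *
        Uop x₀ R t κ (g m) x + Uop x₀ R t (mulc m κ) (g m) x) := by
  rw [Uop_deriv hκ.1 ht ht0 hw]
  have hI : ∀ κ' : En n → ℝ, ContDiff ℝ (⊤ : ℕ∞) κ' →
      IntegrableOn (fun z => v z * Ker x₀ t κ' x z) (ball x₀ R) := by
    intro κ' hκ'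
    have hc : Continuous fun z => Ker x₀ t κ' x z :=
      (contDiff_KerF (x₀ := x₀) hκ' ht ht0).continuous.comp
        (by fun_prop : Continuous fun z => (x, z))
    obtain ⟨C', hC'⟩ := (isCompact_closedBall x₀ R).exists_bound_of_continuousOn hc.continuousOn
    refine Integrable.mono' (hw.norm.mul_const C') (hw.1.mul hc.aestronglyMeasurable) ?_
    filter_upwards [ae_restrict_mem measurableSet_ball] with z hz
    rw [norm_mul]
    gcongr
    exact hC' z (ball_subset_closedBall hz)
  have h1 : ∀ m, Uop x₀ R t (mulc m (pd m κ)) v x =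
      t x * Uop x₀ R t (mulc m κ) (g m) x - Uop x₀ R t κ v x := by
    intro m
    rw [← Uop_ibp (hκ.mulc m) (hv m) (ht0 x) hz, pd_mulc hκ.1]
    unfold Uop
    rw [← integral_sub]
    · refine integral_congr_ae (ae_of_all _ fun z => ?_)
      simp only [Ker]; ring
    · exact hI _ ((contDiff_mulc (contDiff_pd hκ.1 m) m).add hκ.1)
    · exact hI _ hκ.1
  have h2 : ∑ m, ((x - x₀) m * Uop x₀ R t (pd m κ) v x + Uop x₀ R t (mulc m (pd m κ)) v x) =
      t x * ∑ m, ((x - x₀) m * Uop x₀ R t κ (g m) x + Uop x₀ R t (mulc m κ) (g m) x)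
        - n * Uop x₀ R t κ v x := by
    simp only [h1, Uop_ibp hκ (hv _) (ht0 x) hz]
    rw [Finset.mul_sum, eq_sub_iff_add_eq]
    have : (n : ℝ) * Uop x₀ R t κ v x = ∑ m : Fin n, Uop x₀ R t κ v x := by simp
    rw [this, ← Finset.sum_add_distrib]
    exact Finset.sum_congr rfl fun m _ => by ring
  rw [h2, Uop_ibp hκ (hv _) (ht0 x) hz]
  have := (ht0 x).ne'
  field_simp
  ring

/-- bounded convergent multipliers -/
def GM (S : Set (En n)) (m : ℝ → En n → ℝ) : Prop := ∃ (m₀ : En n → ℝ) (M' : ℝ),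
  (∀ᶠ ε in nhdsWithin 0 (Set.Ioi 0), AEStronglyMeasurable (m ε) (volume.restrict S)) ∧
  AEStronglyMeasurable m₀ (volume.restrict S) ∧
  (∀ᶠ ε in nhdsWithin 0 (Set.Ioi 0), ∀ x ∈ S, |m ε x| ≤ M') ∧ (∀ x ∈ S, |m₀ x| ≤ M') ∧
  ∀ x ∈ S, Tendsto (fun ε => m ε x) (nhdsWithin 0 (Set.Ioi 0)) (nhds (m₀ x))

lemma GM.mul {S : Set (En n)} {m m' : ℝ → En n → ℝ} (h : GM S m) (h' : GM S m') :
    GM S (fun ε x => m ε x * m' ε x) := by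
  obtain ⟨m₀, M, h1, h2, h3, h4, h5⟩ := h
  obtain ⟨m₀', M', h1', h2', h3', h4', h5'⟩ := h'
  refine ⟨fun x => m₀ x * m₀' x, |M| * |M'|, ?_, h2.mul h2', ?_, ?_, ?_⟩
  · filter_upwards [h1, h1'] with ε a b using a.mul b
  · filter_upwards [h3, h3'] with ε a b x hx
    rw [abs_mul]
    have := (a x hx).trans (le_abs_self M)
    have := (b x hx).trans (le_abs_self M')
    gcongr
  · intro x hx
    rw [abs_mul]
    have := (h4 x hx).trans (le_abs_self M)
    have := (h4' x hx).trans (le_abs_self M')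
    gcongr
  · exact fun x hx => (h5 x hx).mul (h5' x hx)

lemma GM.add {S : Set (En n)} {m m' : ℝ → En n → ℝ} (h : GM S m) (h' : GM S m') :
    GM S (fun ε x => m ε x + m' ε x) := by
  obtain ⟨m₀, M, h1, h2, h3, h4, h5⟩ := h
  obtain ⟨m₀', M', h1', h2', h3', h4', h5'⟩ := h'
  refine ⟨fun x => m₀ x + m₀' x, M + M', ?_, h2.add h2', ?_, ?_, ?_⟩
  · filter_upwards [h1, h1'] with ε a b using a.add b
  · filter_upwards [h3, h3'] with ε a b x hx
    exact (abs_add_le _ _).trans (add_le_add (a x hx) (b x hx))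
  · intro x hx
    exact (abs_add_le _ _).trans (add_le_add (h4 x hx) (h4' x hx))
  · exact fun x hx => (h5 x hx).add (h5' x hx)

lemma GM.const {S : Set (En n)} (c : ℝ) : GM S (fun _ _ => c) :=
  ⟨fun _ => c, |c|, Eventually.of_forall fun _ => aestronglyMeasurable_const,
    aestronglyMeasurable_const, Eventually.of_forall fun _ _ _ => le_rfl, fun _ _ => le_rfl,
    fun _ _ => tendsto_const_nhds⟩

lemma GM.neg {S : Set (En n)} {m : ℝ → En n → ℝ} (h : GM S m) : GM S (fun ε x => -m ε x) := by
  simpa using (GM.const (S := S) (-1)).mul h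

lemma GM.sub {S : Set (En n)} {m m' : ℝ → En n → ℝ} (h : GM S m) (h' : GM S m') :
    GM S (fun ε x => m ε x - m' ε x) := by
  simpa [sub_eq_add_neg] using h.add h'.neg

lemma GM.of_cont {S : Set (En n)} {x₀ : En n} {R : ℝ} (hS : S ⊆ closedBall x₀ R)
    {c : En n → ℝ} (hc : Continuous c) : GM S (fun _ => c) := by
  obtain ⟨C, hC⟩ := (isCompact_closedBall x₀ R).exists_bound_of_continuousOn hc.continuousOn
  exact ⟨c, C, Eventually.of_forall fun _ => hc.aestronglyMeasurable,
    hc.aestronglyMeasurable, Eventually.of_forall fun _ x hx => hC x (hS hx),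
    fun x hx => hC x (hS hx), fun _ _ => tendsto_const_nhds⟩

lemma GM.congr {S : Set (En n)} (hS : MeasurableSet S) {m m' : ℝ → En n → ℝ} (h : GM S m)
    (he : ∀ᶠ ε in nhdsWithin 0 (Set.Ioi 0), ∀ x ∈ S, m ε x = m' ε x) : GM S m' := by
  obtain ⟨m₀, M, h1, h2, h3, h4, h5⟩ := h
  refine ⟨m₀, M, ?_, h2, ?_, h4, ?_⟩
  · filter_upwards [h1, he] with ε a b
    exact a.congr ((ae_restrict_mem hS).mono fun x hx => b x hx)
  · filter_upwards [h3, he] with ε a b x hx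
    rw [← b x hx]; exact a x hx
  · intro x hx
    refine (h5 x hx).congr' ?_
    filter_upwards [he] with ε a using a x hx

/-- families which converge in `L^p` after multiplication by good multipliers -/
def GF (S : Set (En n)) (p : ℝ) (F : ℝ → En n → ℝ) : Prop := ∀ m, GM S m →
  (∀ᶠ ε in nhdsWithin 0 (Set.Ioi 0),
    AEStronglyMeasurable (fun x => m ε x * F ε x) (volume.restrict S)) ∧
  ∃ L : En n → ℝ, AEStronglyMeasurable L (volume.restrict S) ∧
    Tendsto (fun ε => eLpNorm ((fun x => m ε x * F ε x) - L) (ENNReal.ofReal p)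
      (volume.restrict S)) (nhdsWithin 0 (Set.Ioi 0)) (nhds 0)

lemma GF.mul {S : Set (En n)} {p : ℝ} {F : ℝ → En n → ℝ} {m : ℝ → En n → ℝ} (hm : GM S m)
    (h : GF S p F) : GF S p (fun ε x => m ε x * F ε x) := by
  intro m' hm'
  have := h _ (hm'.mul hm)
  simpa only [mul_assoc] using this

lemma GF.add {S : Set (En n)} {p : ℝ} (hp : 1 < p) {F F' : ℝ → En n → ℝ}
    (h : GF S p F) (h' : GF S p F') : GF S p (fun ε x => F ε x + F' ε x) := by
  intro m hm
  obtain ⟨a, L, hL, hl⟩ := h m hm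
  obtain ⟨a', L', hL', hl'⟩ := h' m hm
  have h1p : 1 ≤ ENNReal.ofReal p := by
    rw [← ENNReal.ofReal_one]; exact ENNReal.ofReal_le_ofReal hp.le
  refine ⟨?_, L + L', hL.add hL', ?_⟩
  · filter_upwards [a, a'] with ε b b'
    simp only [mul_add]
    exact b.add b'
  · refine tendsto_of_tendsto_of_tendsto_of_le_of_le' tendsto_const_nhds
      (by simpa using hl.add hl') (Eventually.of_forall fun _ => zero_le) ?_
    filter_upwards [a, a'] with ε b b'
    have e : ((fun x => m ε x * (F ε x + F' ε x)) - (L + L')) =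
        ((fun x => m ε x * F ε x) - L) + ((fun x => m ε x * F' ε x) - L') := by
      funext x; simp only [Pi.sub_apply, Pi.add_apply]; ring
    rw [e]
    exact eLpNorm_add_le (b.sub hL) (b'.sub hL') h1p

lemma GF.congr {S : Set (En n)} {p : ℝ} (hS : MeasurableSet S) {F F' : ℝ → En n → ℝ} (h : GF S p F)
    (he : ∀ᶠ ε in nhdsWithin 0 (Set.Ioi 0), ∀ x ∈ S, F ε x = F' ε x) : GF S p F' := by
  intro m hm
  obtain ⟨a, L, hL, hl⟩ := h m hm
  refine ⟨?_, L, hL, ?_⟩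
  · filter_upwards [a, he] with ε b c
    exact b.congr ((ae_restrict_mem hS).mono fun x hx => by simp only [c x hx])
  · refine hl.congr' ?_
    filter_upwards [he] with ε c
    exact eLpNorm_congr_ae ((ae_restrict_mem hS).mono fun x hx => by
      simp only [Pi.sub_apply, c x hx])

lemma GF.neg {S : Set (En n)} {p : ℝ} {F : ℝ → En n → ℝ}
    (h : GF S p F) : GF S p (fun ε x => -F ε x) := by
  simpa using h.mul (GM.const (S := S) (-1))

lemma GF.sub {S : Set (En n)} {p : ℝ} (hp : 1 < p) {F F' : ℝ → En n → ℝ}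
    (h : GF S p F) (h' : GF S p F') : GF S p (fun ε x => F ε x - F' ε x) := by
  simpa [sub_eq_add_neg] using h.add hp h'.neg

lemma GF.zero {S : Set (En n)} {p : ℝ} : GF S p (fun _ _ => 0) := by
  intro m hm
  refine ⟨Eventually.of_forall fun _ => by simpa using aestronglyMeasurable_const, fun _ => 0,
    aestronglyMeasurable_const, ?_⟩
  have : ((fun _ => 0 : En n → ℝ) - fun _ => 0) = 0 := by ext; simp
  simp

lemma GF.sum {S : Set (En n)} {p : ℝ} (hp : 1 < p) {ι : Type*} (s : Finset ι)
    {F : ι → ℝ → En n → ℝ} (h : ∀ i, GF S p (F i)) : GF S p (fun ε x => ∑ i ∈ s, F i ε x) := by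
  classical
  induction s using Finset.induction_on with
  | empty => simpa using GF.zero
  | insert a s ha ih =>
    simp only [Finset.sum_insert ha]
    exact (h a).add hp ih

lemma GF.U {x₀ : En n} {R r a b : ℝ}
    {S : Set (En n)} (hS : MeasurableSet S) (hSf : volume S ≠ ⊤)
    (hr : 0 ≤ r) (ha : 0 ≤ a) (hb : 0 ≤ b) (t : ℝ → En n → ℝ) (d : En n → ℝ)
    (hg : ∀ᶠ i in nhdsWithin 0 (Set.Ioi 0), GeoOK x₀ R r a b S (t i) d)
    (hg0 : GeoOK x₀ R r a b S (t 0) d)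
    (ht : ∀ x ∈ S, Tendsto (fun i => t i x) (nhdsWithin 0 (Set.Ioi 0)) (nhds (t 0 x)))
    {κ : En n → ℝ} (hκ : KOK r κ) {p : ℝ} (hp : 1 < p)
    {w : En n → ℝ} (hw : MemLp w (ENNReal.ofReal p) (volume.restrict (ball x₀ R))) :
    GF S p (fun ε => Uop x₀ R (t ε) κ w) := by
  rintro m ⟨m₀, M, h1, h2, h3, h4, h5⟩
  refine ⟨?_, fun x => m₀ x * Uop x₀ R (t 0) κ w x, ?_, ?_⟩
  · filter_upwards [h1, hg] with ε a b
    exact a.mul (aesm_Uop hκ.1.continuous b.meas hw.1 S)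
  · exact h2.mul (aesm_Uop hκ.1.continuous hg0.meas hw.1 S)
  · exact mU_tendsto hS hSf hr ha hb t (fun _ => d) (t 0) d hg hg0 ht m m₀ M h1 h2 h3 h4 h5
      hκ hp hw

/-- defining function of the ball -/
def rho (x₀ : En n) (R : ℝ) (x : En n) : ℝ := R ^ 2 - ‖x - x₀‖ ^ 2

/-- regularized absolute value of `rho` -/
def qe (x₀ : En n) (R ε : ℝ) (x : En n) : ℝ := Real.sqrt (rho x₀ R x ^ 2 + ε ^ 2)

/-- scale -/
def te (x₀ : En n) (R ε : ℝ) (x : En n) : ℝ := 2 / R ^ 2 * qe x₀ R ε x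

/-- shell -/
def shell (x₀ : En n) (R δ : ℝ) : Set (En n) := {x | 0 < |rho x₀ R x| ∧ |rho x₀ R x| < δ}

lemma contDiff_rho (x₀ : En n) (R : ℝ) : ContDiff ℝ (⊤ : ℕ∞) (rho x₀ R) := by
  unfold rho
  exact contDiff_const.sub ((contDiff_id.sub contDiff_const).norm_sq ℝ)

lemma qe_pos {x₀ : En n} {R ε : ℝ} (hε : 0 < ε) (x : En n) : 0 < qe x₀ R ε x :=
  Real.sqrt_pos.2 (by positivity)

lemma contDiff_qe {x₀ : En n} {R ε : ℝ} (hε : 0 < ε) : ContDiff ℝ (⊤ : ℕ∞) (qe x₀ R ε) := by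
  unfold qe
  exact (((contDiff_rho x₀ R).pow 2).add contDiff_const).sqrt
    (fun x => (by positivity : rho x₀ R x ^ 2 + ε ^ 2 ≠ 0))

lemma continuous_qe {x₀ : En n} {R ε : ℝ} : Continuous (qe x₀ R ε) := by
  unfold qe
  have := (contDiff_rho x₀ R).continuous
  fun_prop

lemma rho_le_qe {x₀ : En n} {R ε : ℝ} (x : En n) : |rho x₀ R x| ≤ qe x₀ R ε x :=
  Real.abs_le_sqrt (by nlinarith [sq_nonneg ε])

lemma qe_le {x₀ : En n} {R ε : ℝ} (hε : 0 ≤ ε) (x : En n) : qe x₀ R ε x ≤ |rho x₀ R x| + ε := by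
  unfold qe
  refine Real.sqrt_le_iff.2 ⟨by positivity, ?_⟩
  nlinarith [sq_abs (rho x₀ R x), mul_nonneg (abs_nonneg (rho x₀ R x)) hε]

lemma shell_subset {x₀ : En n} {R R' δ : ℝ} (hR' : 0 ≤ R') (h : R ^ 2 + δ ≤ R' ^ 2) :
    shell x₀ R δ ⊆ ball x₀ R' := by
  rintro x ⟨_, hx⟩
  rw [mem_ball, dist_eq_norm]
  have := (abs_lt.1 hx).1
  unfold rho at this
  nlinarith [norm_nonneg (x - x₀)]

lemma isOpen_shell {x₀ : En n} {R δ : ℝ} : IsOpen (shell x₀ R δ) := by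
  have := (contDiff_rho x₀ R).continuous.abs
  exact (isOpen_lt continuous_const this).inter (isOpen_lt this continuous_const)

lemma geo_te {x₀ : En n} {R δ ε : ℝ} (hR : 0 < R) (hδ : δ ≤ R ^ 2 / 16) (hε : 0 ≤ ε)
    (hε' : ε ≤ R ^ 2 / 16) :
    GeoOK x₀ R (R / 4) (2 * R) 3 (shell x₀ R δ) (te x₀ R ε) (fun z => R - ‖z - x₀‖) where
  meas := (continuous_const.mul continuous_qe).measurable
  pos := fun x hx => by
    have := hx.1.trans_le (rho_le_qe (ε := ε) x)
    unfold te; positivity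
  geo := by
    intro x hx z hy
    have hq1 := rho_le_qe (x₀ := x₀) (R := R) (ε := ε) x
    have hq2 := qe_le (x₀ := x₀) (R := R) hε x
    have hT0 : 0 < te x₀ R ε x := by
      have := hx.1.trans_le (rho_le_qe (ε := ε) x)
      unfold te; positivity
    have hq : qe x₀ R ε x = te x₀ R ε x * R ^ 2 / 2 := by unfold te; field_simp
    have ez := z_eq (x₀ := x₀) hT0 x z
    set T := te x₀ R ε x
    set y := yv x₀ T x z
    have hT : T ≤ 1 / 4 := by
      have h1 : T * R ^ 2 / 2 ≤ R ^ 2 / 8 := by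
        rw [← hq]; linarith [hx.2]
      have : 0 < R ^ 2 := by positivity
      by_contra hc
      push Not at hc
      nlinarith
    set L := ‖x - x₀‖ with hL
    have hL0 : 0 ≤ L := norm_nonneg _
    have hab := abs_le.1 (hq1.trans_eq hq)
    have hrho : rho x₀ R x = R ^ 2 - L ^ 2 := rfl
    rw [hrho] at hab
    have hLu : L ≤ R + T * R / 4 := by
      refine abs_le_of_sq_le_sq' ?_ (by positivity) |>.2
      nlinarith [sq_nonneg (T * R)]
    have hLl : R * (1 - T / 2) ≤ L := by
      refine abs_le_of_sq_le_sq' ?_ hL0 |>.2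
      have : 0 ≤ R ^ 2 * T * (1 / 2 - T / 4) := by
        have : 0 ≤ 1 / 2 - T / 4 := by linarith
        positivity
      nlinarith
    have e1 : z - x₀ = (1 - T) • (x - x₀) - T • y := by
      have : z = x - T • ((x - x₀) + y) := by rw [← ez]; abel
      rw [this, smul_add, sub_smul, one_smul]; abel
    have n1 : ‖(1 - T) • (x - x₀)‖ = (1 - T) * L := by
      rw [norm_smul, Real.norm_of_nonneg (by linarith)]
    have n2 : ‖T • y‖ ≤ T * (R / 4) := by
      rw [norm_smul, Real.norm_of_nonneg hT0.le]; gcongr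
    have hzu : ‖z - x₀‖ ≤ R - T * R / 2 := by
      rw [e1]
      refine (norm_sub_le _ _).trans ?_
      rw [n1]
      have : (1 - T) * L ≤ (1 - T) * (R + T * R / 4) := by
        gcongr; linarith
      nlinarith [mul_nonneg (sq_nonneg T) hR.le]
    have hzl : R - 2 * R * T ≤ ‖z - x₀‖ := by
      rw [e1]
      refine le_trans ?_ (norm_sub_norm_le _ _)
      rw [n1]
      have : (1 - T) * (R * (1 - T / 2)) ≤ (1 - T) * L := by
        gcongr; linarith
      nlinarith [mul_nonneg (sq_nonneg T) hR.le, mul_pos hT0 hR]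
    have hxz : ‖x - z‖ ≤ T * (3 / 2 * R) := by
      rw [ez, norm_smul, Real.norm_of_nonneg hT0.le]
      gcongr
      refine (norm_add_le _ _).trans ?_
      nlinarith
    have hTR := mul_pos hT0 hR
    refine ⟨?_, ?_, ?_, ?_⟩
    · rw [mem_ball, dist_eq_norm]; nlinarith
    · linarith
    · nlinarith
    · nlinarith

lemma pd_congr {j : Fin n} {f g : En n → ℝ} {x : En n} (h : f =ᶠ[nhds x] g) :
    pd j f x = pd j g x := by unfold pd; rw [h.fderiv_eq]

lemma ContDiff.dif {f : En n → ℝ} (hf : ContDiff ℝ (⊤ : ℕ∞) f) (x : En n) :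
    DifferentiableAt ℝ f x := hf.differentiable (by simp) x

lemma pd_mul {j : Fin n} {f g : En n → ℝ} (hf : ContDiff ℝ (⊤ : ℕ∞) f)
    (hg : ContDiff ℝ (⊤ : ℕ∞) g) (x : En n) :
    pd j (fun x => f x * g x) x = pd j f x * g x + f x * pd j g x := by
  unfold pd
  rw [show (fun x => f x * g x) = f * g from rfl, fderiv_mul (hf.dif x) (hg.dif x)]
  simp; ring

lemma pd_add {j : Fin n} {f g : En n → ℝ} (hf : ContDiff ℝ (⊤ : ℕ∞) f)
    (hg : ContDiff ℝ (⊤ : ℕ∞) g) (x : En n) :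
    pd j (fun x => f x + g x) x = pd j f x + pd j g x := by
  unfold pd
  rw [show (fun x => f x + g x) = f + g from rfl, fderiv_add (hf.dif x) (hg.dif x)]
  simp

lemma pd_sub {j : Fin n} {f g : En n → ℝ} (hf : ContDiff ℝ (⊤ : ℕ∞) f)
    (hg : ContDiff ℝ (⊤ : ℕ∞) g) (x : En n) :
    pd j (fun x => f x - g x) x = pd j f x - pd j g x := by
  unfold pd
  rw [show (fun x => f x - g x) = f - g from rfl, fderiv_sub (hf.dif x) (hg.dif x)]
  simp

lemma pd_const (j : Fin n) (c : ℝ) (x : En n) : pd j (fun _ => c) x = 0 := by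
  unfold pd; simp

lemma pd_sum {j : Fin n} {ι : Type*} (s : Finset ι) {f : ι → En n → ℝ}
    (hf : ∀ i, ContDiff ℝ (⊤ : ℕ∞) (f i)) (x : En n) :
    pd j (fun x => ∑ i ∈ s, f i x) x = ∑ i ∈ s, pd j (f i) x := by
  unfold pd
  rw [fderiv_fun_sum (fun i _ => (hf i).dif x)]
  simp

lemma contDiff_X (x₀ : En n) (m : Fin n) : ContDiff ℝ (⊤ : ℕ∞) (fun x : En n => (x - x₀) m) :=
  (contDiff_coord m).comp (contDiff_id.sub contDiff_const)

lemma pd_rho (x₀ : En n) (R : ℝ) (l : Fin n) (x : En n) :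
    pd l (rho x₀ R) x = -2 * (x - x₀) l := by
  have h : HasFDerivAt (fun x : En n => x - x₀) (ContinuousLinearMap.id ℝ (En n)) x :=
    (hasFDerivAt_id x).sub_const x₀
  have := (h.norm_sq.const_sub (R ^ 2)).fderiv
  unfold pd rho
  erw [this]
  simp [basisVec, PiLp.inner_apply]

lemma pd_X (x₀ : En n) (m l : Fin n) (x : En n) :
    pd l (fun x : En n => (x - x₀) m) x = if m = l then 1 else 0 := by
  have h : HasFDerivAt (fun x : En n => x - x₀) (ContinuousLinearMap.id ℝ (En n)) x :=
    (hasFDerivAt_id x).sub_const x₀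
  have := ((hasFDerivAt_coord m (x - x₀)).comp x h).fderiv
  unfold pd
  simp only [Function.comp_def] at this
  rw [this]
  simp [basisVec]

/-- sign-like quotient -/
def we (x₀ : En n) (R ε : ℝ) (x : En n) : ℝ := rho x₀ R x * (qe x₀ R ε x)⁻¹

lemma contDiff_we {x₀ : En n} {R ε : ℝ} (hε : 0 < ε) : ContDiff ℝ (⊤ : ℕ∞) (we x₀ R ε) :=
  (contDiff_rho x₀ R).mul ((contDiff_qe hε).inv fun x => (qe_pos hε x).ne')

lemma pd_qe {x₀ : En n} {R ε : ℝ} (hε : 0 < ε) (l : Fin n) (x : En n) :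
    pd l (qe x₀ R ε) x = we x₀ R ε x * pd l (rho x₀ R) x := by
  have h1 : (fun x => qe x₀ R ε x * qe x₀ R ε x) = fun x => rho x₀ R x * rho x₀ R x + ε ^ 2 := by
    funext x
    unfold qe
    rw [Real.mul_self_sqrt (by positivity)]; ring
  have h2 := pd_mul (j := l) (contDiff_qe (x₀ := x₀) (R := R) hε)
    (contDiff_qe (x₀ := x₀) (R := R) hε) x
  have h3 := pd_add (j := l) ((contDiff_rho x₀ R).mul (contDiff_rho x₀ R))
    (contDiff_const (c := ε ^ 2)) x
  rw [pd_mul (contDiff_rho x₀ R) (contDiff_rho x₀ R), pd_const] at h3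
  rw [h1, h3] at h2
  have := qe_pos (x₀ := x₀) (R := R) hε x
  unfold we
  field_simp
  linarith

lemma pd_we {x₀ : En n} {R ε : ℝ} (hε : 0 < ε) (i : Fin n) (x : En n) :
    pd i (we x₀ R ε) x = (qe x₀ R ε x)⁻¹ * (1 - we x₀ R ε x ^ 2) * pd i (rho x₀ R) x := by
  have h1 : rho x₀ R = fun x => we x₀ R ε x * qe x₀ R ε x := by
    funext x
    have := qe_pos (x₀ := x₀) (R := R) hε x
    unfold we; field_simp
  have h2 : pd i (rho x₀ R) x = _ :=
    (congrArg (fun F => pd i F x) h1).trans (pd_mul (contDiff_we hε) (contDiff_qe hε) x)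
  have := qe_pos (x₀ := x₀) (R := R) hε x
  rw [pd_qe hε] at h2
  field_simp
  linear_combination -h2

lemma contDiff_te {x₀ : En n} {R ε : ℝ} (hε : 0 < ε) : ContDiff ℝ (⊤ : ℕ∞) (te x₀ R ε) :=
  contDiff_const.mul (contDiff_qe hε)

lemma te_pos {x₀ : En n} {R ε : ℝ} (hR : 0 < R) (hε : 0 < ε) (x : En n) : 0 < te x₀ R ε x := by
  have := qe_pos (x₀ := x₀) (R := R) hε x
  unfold te; positivity

lemma pd_te {x₀ : En n} {R ε : ℝ} (hε : 0 < ε) (l : Fin n) :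
    pd l (te x₀ R ε) = fun x => 2 / R ^ 2 * (we x₀ R ε x * pd l (rho x₀ R) x) := by
  funext x
  have := pd_mul (j := l) (contDiff_const (c := 2 / R ^ 2))
    (contDiff_qe (x₀ := x₀) (R := R) hε) x
  rw [pd_const, pd_qe hε] at this
  change pd l (fun x => 2 / R ^ 2 * qe x₀ R ε x) x = _
  simpa using this

lemma pd_pd_te {x₀ : En n} {R ε : ℝ} (hε : 0 < ε) (i l : Fin n) (x : En n) :
    pd i (pd l (te x₀ R ε)) x = 2 / R ^ 2 * ((qe x₀ R ε x)⁻¹ * (1 - we x₀ R ε x ^ 2) *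
      pd i (rho x₀ R) x * pd l (rho x₀ R) x + we x₀ R ε x * pd i (pd l (rho x₀ R)) x) := by
  rw [pd_te hε]
  have h1 := pd_mul (j := i) (contDiff_we (x₀ := x₀) (R := R) hε)
    (contDiff_pd (contDiff_rho x₀ R) l) x
  have := pd_mul (j := i) (contDiff_const (c := 2 / R ^ 2))
    ((contDiff_we (x₀ := x₀) (R := R) hε).mul (contDiff_pd (contDiff_rho x₀ R) l)) x
  rw [pd_const, h1, pd_we hε] at this
  simpa using this

lemma ev_pos : ∀ᶠ ε in nhdsWithin (0 : ℝ) (Set.Ioi 0), 0 < ε := self_mem_nhdsWithin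

lemma tendsto_qe {x₀ : En n} {R : ℝ} (x : En n) :
    Tendsto (fun ε => qe x₀ R ε x) (nhdsWithin 0 (Set.Ioi 0)) (nhds (qe x₀ R 0 x)) := by
  have : Continuous fun ε => qe x₀ R ε x := by unfold qe; fun_prop
  exact (this.tendsto 0).mono_left nhdsWithin_le_nhds

lemma GM.we {x₀ : En n} {R δ : ℝ} : GM (shell x₀ R δ) (we x₀ R) := by
  have hb : ∀ ε x, |_root_.we x₀ R ε x| ≤ 1 := by
    intro ε x
    unfold _root_.we
    have h := rho_le_qe (x₀ := x₀) (R := R) (ε := ε) x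
    have h0 : 0 ≤ qe x₀ R ε x := Real.sqrt_nonneg _
    rw [abs_mul, abs_inv, abs_of_nonneg h0]
    exact mul_inv_le_one_of_le₀ h h0
  have hm : ∀ ε, Measurable (_root_.we x₀ R ε) := fun ε =>
    (contDiff_rho x₀ R).continuous.measurable.mul continuous_qe.measurable.inv
  refine ⟨_root_.we x₀ R 0, 1, Eventually.of_forall fun ε => (hm ε).aestronglyMeasurable,
    (hm 0).aestronglyMeasurable, Eventually.of_forall fun ε x _ => hb ε x, fun x _ => hb 0 x,
    fun x hx => ?_⟩
  exact tendsto_const_nhds.mul ((tendsto_qe x).inv₀ (hx.1.trans_le (rho_le_qe x)).ne')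

lemma GM.qe {x₀ : En n} {R δ : ℝ} : GM (shell x₀ R δ) (qe x₀ R) := by
  refine ⟨_root_.qe x₀ R 0, δ + 1,
    Eventually.of_forall fun ε => continuous_qe.aestronglyMeasurable,
    continuous_qe.aestronglyMeasurable, ?_, fun x hx => ?_, fun x hx => tendsto_qe x⟩
  · filter_upwards [ev_pos, mem_nhdsWithin_of_mem_nhds (Iio_mem_nhds one_pos)] with ε h0 h1 x hx
    rw [abs_of_nonneg (show 0 ≤ _root_.qe x₀ R _ x from Real.sqrt_nonneg _)]
    have h1 : ε < 1 := h1
    linarith [qe_le (x₀ := x₀) (R := R) h0.le x, hx.2]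
  · rw [abs_of_nonneg (show 0 ≤ _root_.qe x₀ R _ x from Real.sqrt_nonneg _)]
    linarith [qe_le (x₀ := x₀) (R := R) le_rfl x, hx.2]

lemma GM.te {x₀ : En n} {R δ : ℝ} : GM (shell x₀ R δ) (te x₀ R) :=
  (GM.const (2 / R ^ 2)).mul GM.qe

/-- cutoff near the sphere -/
def chi (x₀ : En n) (R δ : ℝ) (x : En n) : ℝ :=
  Real.smoothTransition (2 - 4 * (rho x₀ R x / δ) ^ 2)

lemma contDiff_chi (x₀ : En n) (R δ : ℝ) : ContDiff ℝ (⊤ : ℕ∞) (chi x₀ R δ) := by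
  have h : ContDiff ℝ (⊤ : ℕ∞) fun x => 2 - 4 * (rho x₀ R x / δ) ^ 2 :=
    contDiff_const.sub (contDiff_const.mul (((contDiff_rho x₀ R).div_const δ).pow 2))
  exact Real.smoothTransition.contDiff.comp h

lemma chi_one {x₀ : En n} {R δ : ℝ} {x : En n} (h : rho x₀ R x = 0) : chi x₀ R δ x = 1 := by
  unfold chi; rw [h]; exact Real.smoothTransition.one_of_one_le (by norm_num)

lemma tsupport_chi {x₀ : En n} {R δ : ℝ} (hδ : 0 < δ) :
    tsupport (chi x₀ R δ) ⊆ {x | |rho x₀ R x| < δ} := by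
  have h : tsupport (chi x₀ R δ) ⊆ {x | 4 * (rho x₀ R x / δ) ^ 2 ≤ 2} := by
    have hc := (contDiff_rho x₀ R).continuous
    refine closure_minimal (fun x hx => ?_) (isClosed_le (by fun_prop) continuous_const)
    by_contra hc
    simp only [Set.mem_ofPred_eq, not_le] at hc
    exact hx (Real.smoothTransition.zero_of_nonpos (by linarith))
  intro x hx
  have h1 : 4 * (rho x₀ R x / δ) ^ 2 ≤ 2 := h hx
  simp only [Set.mem_ofPred_eq]
  have h2 : |rho x₀ R x / δ| < 1 := by
    rw [← sq_lt_one_iff_abs_lt_one]; linarith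
  rwa [abs_div, abs_of_pos hδ, div_lt_one hδ] at h2

/-- the lifted function -/
def he (x₀ : En n) (R δ : ℝ) (k v : En n → ℝ) (ε : ℝ) (x : En n) : ℝ :=
  (rho x₀ R x * chi x₀ R δ x) * Uop x₀ R (te x₀ R ε) k v x

lemma contDiff_bb (x₀ : En n) (R δ : ℝ) :
    ContDiff ℝ (⊤ : ℕ∞) (fun x => rho x₀ R x * chi x₀ R δ x) :=
  (contDiff_rho x₀ R).mul (contDiff_chi x₀ R δ)


lemma shell_sub2 {x₀ : En n} {R δ p : ℝ} (hR : 0 < R) (hδ0 : 0 < δ) (hδ : δ ≤ R ^ 2 / 16) (hp : 1 < p)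
    : shell x₀ R δ ⊆ closedBall x₀ (2 * R) :=
  (shell_subset (by positivity) (by nlinarith)).trans ball_subset_closedBall

lemma GF.U' {x₀ : En n} {R δ p : ℝ} (hR : 0 < R) (hδ0 : 0 < δ) (hδ : δ ≤ R ^ 2 / 16) (hp : 1 < p)
    {κ w : En n → ℝ} (hκ : KOK (R / 4) κ)
    (hw : MemLp w (ENNReal.ofReal p) (volume.restrict (ball x₀ R))) :
    GF (shell x₀ R δ) p (fun ε => Uop x₀ R (te x₀ R ε) κ w) := by
  refine GF.U isOpen_shell.measurableSet ?_ (by positivity) (by positivity)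
    (by norm_num : (0 : ℝ) ≤ 3) (te x₀ R) (fun z => R - ‖z - x₀‖) ?_
    (geo_te hR hδ le_rfl (by positivity)) ?_ hκ hp hw
  · exact ((measure_mono (shell_sub2 hR hδ0 hδ hp)).trans_lt measure_closedBall_lt_top).ne
  · filter_upwards [ev_pos, mem_nhdsWithin_of_mem_nhds (Iio_mem_nhds
      (by positivity : 0 < R ^ 2 / 16))] with ε h0 h1
    exact geo_te hR hδ h0.le (le_of_lt h1)
  · exact fun x hx => tendsto_const_nhds.mul (tendsto_qe x)

lemma GM.pdte {x₀ : En n} {R δ p : ℝ} (hR : 0 < R) (hδ0 : 0 < δ) (hδ : δ ≤ R ^ 2 / 16) (hp : 1 < p)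
    (l : Fin n) : GM (shell x₀ R δ) (fun ε => pd l (_root_.te x₀ R ε)) := by
  refine GM.congr isOpen_shell.measurableSet ((GM.const (2 / R ^ 2)).mul (GM.we.mul
    (GM.of_cont (shell_sub2 hR hδ0 hδ hp) (contDiff_pd (contDiff_rho x₀ R) l).continuous))) ?_
  filter_upwards [ev_pos] with ε h0 x hx
  rw [pd_te h0]

lemma GM.bt {x₀ : En n} {R δ p : ℝ} (hR : 0 < R) (hδ0 : 0 < δ) (hδ : δ ≤ R ^ 2 / 16) (hp : 1 < p)
    : GM (shell x₀ R δ) (fun ε x => (rho x₀ R x * chi x₀ R δ x) *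
    (_root_.te x₀ R ε x)⁻¹) := by
  refine GM.congr isOpen_shell.measurableSet ((GM.const (R ^ 2 / 2)).mul (GM.we.mul
    (GM.of_cont (shell_sub2 hR hδ0 hδ hp) (contDiff_chi x₀ R δ).continuous))) ?_
  filter_upwards [ev_pos] with ε h0 x hx
  have := qe_pos (x₀ := x₀) (R := R) h0 x
  unfold _root_.we _root_.te
  field_simp

lemma GM.bpdpdte {x₀ : En n} {R δ p : ℝ} (hR : 0 < R) (hδ0 : 0 < δ) (hδ : δ ≤ R ^ 2 / 16) (hp : 1 < p)
    (i l : Fin n) : GM (shell x₀ R δ) (fun ε x => (rho x₀ R x * chi x₀ R δ x) *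
    pd i (pd l (_root_.te x₀ R ε)) x) := by
  have hc : ∀ {f : En n → ℝ}, ContDiff ℝ (⊤ : ℕ∞) f → GM (shell x₀ R δ) fun _ => f := fun h =>
    GM.of_cont (shell_sub2 hR hδ0 hδ hp) h.continuous
  have h1 := contDiff_rho x₀ R
  refine GM.congr isOpen_shell.measurableSet ((GM.const (2 / R ^ 2)).mul
    ((hc (contDiff_chi x₀ R δ)).mul (((GM.we.mul ((GM.const 1).sub (GM.we.mul GM.we))).mul
      ((hc (contDiff_pd h1 i)).mul (hc (contDiff_pd h1 l)))).add
      ((hc h1).mul (GM.we.mul (hc (contDiff_pd (contDiff_pd h1 l) i))))))) ?_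
  filter_upwards [ev_pos] with ε h0 x hx
  have := qe_pos (x₀ := x₀) (R := R) h0 x
  rw [pd_pd_te h0]
  have e : rho x₀ R x * (_root_.qe x₀ R ε x)⁻¹ = _root_.we x₀ R ε x := rfl
  linear_combination (-(2 / R ^ 2 * chi x₀ R δ x * (1 - _root_.we x₀ R ε x ^ 2) *
    pd i (rho x₀ R) x * pd l (rho x₀ R) x)) * e

/-- first derivatives of `U` times `b` -/
lemma GF.bpdU {x₀ : En n} {R δ p : ℝ} (hR : 0 < R) (hδ0 : 0 < δ) (hδ : δ ≤ R ^ 2 / 16) (hp : 1 < p)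
    {κ w : En n → ℝ} (hκ : KOK (R / 4) κ)
    (hw : MemLp w (ENNReal.ofReal p) (volume.restrict (ball x₀ R))) (i : Fin n) :
    GF (shell x₀ R δ) p (fun ε x => (rho x₀ R x * chi x₀ R δ x) *
      pd i (Uop x₀ R (te x₀ R ε) κ w) x) := by
  have hc : ∀ {f : En n → ℝ}, ContDiff ℝ (⊤ : ℕ∞) f → GM (shell x₀ R δ) fun _ => f := fun h =>
    GM.of_cont (shell_sub2 hR hδ0 hδ hp) h.continuous
  have hU : ∀ {κ : En n → ℝ}, KOK (R / 4) κ → _ := fun {κ} h =>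
    GF.U' (x₀ := x₀) (κ := κ) hR hδ0 hδ hp h hw
  have hdt := GM.pdte (x₀ := x₀) hR hδ0 hδ hp i
  refine GF.congr isOpen_shell.measurableSet (GF.mul (GM.bt (x₀ := x₀) hR hδ0 hδ hp)
    ((((hU (hκ.pd i)).mul ((GM.const 1).sub GM.te)).sub hp
    ((GF.sum hp Finset.univ (fun m => ((hU (hκ.pd m)).mul (hc (contDiff_X x₀ m))).add hp
      (hU ((hκ.pd m).mulc m)))).mul hdt)).sub hp ((hU hκ).mul ((GM.const (n : ℝ)).mul hdt)))) ?_
  filter_upwards [ev_pos] with ε h0 x hx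
  rw [Uop_deriv hκ.1 (contDiff_te h0) (te_pos hR h0) (integrable_of_memLp hp hw)]
  ring


lemma ev_pds {x₀ : En n} {R δ p : ℝ} (hR : 0 < R) (hδ0 : 0 < δ) (hδ : δ ≤ R ^ 2 / 16) (hp : 1 < p)
    {k v : En n → ℝ} {g : Fin n → En n → ℝ} (hk : KOK (R / 4) k)
    (hv : MemLp v (ENNReal.ofReal p) (volume.restrict (ball x₀ R)))
    (hg : ∀ m, MemLp (g m) (ENNReal.ofReal p) (volume.restrict (ball x₀ R)))
    (hvg : ∀ m, HasWeakPartial (ball x₀ R) v (g m) m)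
    (l : Fin n) : ∀ᶠ ε in nhdsWithin (0 : ℝ) (Set.Ioi 0), ∀ x ∈ shell x₀ R δ,
    pd l (Uop x₀ R (te x₀ R ε) k v) x =
      (1 - te x₀ R ε x) * Uop x₀ R (te x₀ R ε) k (g l) x - pd l (te x₀ R ε) x *
        ∑ m, ((x - x₀) m * Uop x₀ R (te x₀ R ε) k (g m) x +
          Uop x₀ R (te x₀ R ε) (mulc m k) (g m) x) := by
  filter_upwards [ev_pos, mem_nhdsWithin_of_mem_nhds (Iio_mem_nhds
      (by positivity : 0 < R ^ 2 / 16))] with ε h0 h1 x hx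
  exact Uop_deriv' hk (contDiff_te h0) (te_pos hR h0) (integrable_of_memLp hp hv) hvg
    (fun z hz => ((geo_te hR hδ h0.le (le_of_lt h1)).geo x hx z hz).1) l

lemma GF.pds {x₀ : En n} {R δ p : ℝ} (hR : 0 < R) (hδ0 : 0 < δ) (hδ : δ ≤ R ^ 2 / 16) (hp : 1 < p)
    {k v : En n → ℝ} {g : Fin n → En n → ℝ} (hk : KOK (R / 4) k)
    (hv : MemLp v (ENNReal.ofReal p) (volume.restrict (ball x₀ R)))
    (hg : ∀ m, MemLp (g m) (ENNReal.ofReal p) (volume.restrict (ball x₀ R)))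
    (hvg : ∀ m, HasWeakPartial (ball x₀ R) v (g m) m)
    (l : Fin n) :
    GF (shell x₀ R δ) p (fun ε => pd l (Uop x₀ R (te x₀ R ε) k v)) := by
  have hc : ∀ {f : En n → ℝ}, ContDiff ℝ (⊤ : ℕ∞) f → GM (shell x₀ R δ) fun _ => f := fun h =>
    GM.of_cont (shell_sub2 hR hδ0 hδ hp) h.continuous
  have hU : ∀ {κ : En n → ℝ} m, KOK (R / 4) κ → _ := fun {κ} m h =>
    GF.U' (x₀ := x₀) (κ := κ) hR hδ0 hδ hp h (hg m)
  refine GF.congr isOpen_shell.measurableSet ((((hU l hk).mul ((GM.const 1).sub GM.te))).sub hp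
    ((GF.sum hp Finset.univ (fun m => ((hU m hk).mul (hc (contDiff_X x₀ m))).add hp
      (hU m (hk.mulc m)))).mul (GM.pdte (x₀ := x₀) hR hδ0 hδ hp l))) ?_
  filter_upwards [ev_pds hR hδ0 hδ hp hk hv hg hvg l] with ε h x hx
  rw [h x hx]

lemma GF.bpdpds {x₀ : En n} {R δ p : ℝ} (hR : 0 < R) (hδ0 : 0 < δ) (hδ : δ ≤ R ^ 2 / 16) (hp : 1 < p)
    {k v : En n → ℝ} {g : Fin n → En n → ℝ} (hk : KOK (R / 4) k)
    (hv : MemLp v (ENNReal.ofReal p) (volume.restrict (ball x₀ R)))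
    (hg : ∀ m, MemLp (g m) (ENNReal.ofReal p) (volume.restrict (ball x₀ R)))
    (hvg : ∀ m, HasWeakPartial (ball x₀ R) v (g m) m)
    (i l : Fin n) :
    GF (shell x₀ R δ) p (fun ε x => (rho x₀ R x * chi x₀ R δ x) *
      pd i (pd l (Uop x₀ R (te x₀ R ε) k v)) x) := by
  have hc : ∀ {f : En n → ℝ}, ContDiff ℝ (⊤ : ℕ∞) f → GM (shell x₀ R δ) fun _ => f := fun h =>
    GM.of_cont (shell_sub2 hR hδ0 hδ hp) h.continuous
  have hU : ∀ {κ : En n → ℝ} m, KOK (R / 4) κ → _ := fun {κ} m h =>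
    GF.U' (x₀ := x₀) (κ := κ) hR hδ0 hδ hp h (hg m)
  have hdU : ∀ {κ : En n → ℝ} m, KOK (R / 4) κ → _ := fun {κ} m h =>
    GF.bpdU (x₀ := x₀) (κ := κ) hR hδ0 hδ hp h (hg m) i
  have hb := hc (contDiff_bb x₀ R δ)
  have hdt := fun l => GM.pdte (x₀ := x₀) hR hδ0 hδ hp l
  refine GF.congr isOpen_shell.measurableSet
    ((((hU l hk).mul (hb.mul (hdt i).neg)).add hp ((hdU l hk).mul ((GM.const 1).sub GM.te))).sub hp
    (((GF.sum hp Finset.univ (fun m => ((hU m hk).mul (hc (contDiff_X x₀ m))).add hp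
      (hU m (hk.mulc m)))).mul (GM.bpdpdte (x₀ := x₀) hR hδ0 hδ hp i l)).add hp
    ((GF.sum hp Finset.univ (fun m => (((hU m hk).mul (hb.mul (hc (contDiff_pd
      (contDiff_X x₀ m) i)))).add hp ((hdU m hk).mul (hc (contDiff_X x₀ m)))).add hp
      (hdU m (hk.mulc m)))).mul (hdt l)))) ?_
  filter_upwards [ev_pds hR hδ0 hδ hp hk hv hg hvg l, ev_pos] with ε h h0 x hx
  have he : pd l (Uop x₀ R (te x₀ R ε) k v) =ᶠ[nhds x] fun x =>
      (1 - te x₀ R ε x) * Uop x₀ R (te x₀ R ε) k (g l) x - pd l (te x₀ R ε) x *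
        ∑ m, ((x - x₀) m * Uop x₀ R (te x₀ R ε) k (g m) x +
          Uop x₀ R (te x₀ R ε) (mulc m k) (g m) x) := by
    filter_upwards [isOpen_shell.mem_nhds hx] with y hy using h y hy
  have cU : ∀ {κ : En n → ℝ} m, KOK (R / 4) κ →
      ContDiff ℝ (⊤ : ℕ∞) (Uop x₀ R (te x₀ R ε) κ (g m)) := fun m h =>
    contDiff_Uop h.1 (contDiff_te h0) (te_pos hR h0) (integrable_of_memLp hp (hg m))
  have ct : ContDiff ℝ (⊤ : ℕ∞) (te x₀ R ε) := contDiff_te h0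
  have c1 : ContDiff ℝ (⊤ : ℕ∞) (fun x => 1 - te x₀ R ε x) := contDiff_const.sub ct
  have cXU := fun m => (contDiff_X x₀ m).mul (cU m hk)
  have cs := fun m => (cXU m).add (cU m (hk.mulc m))
  have cS := ContDiff.sum (s := Finset.univ) fun m _ => cs m
  rw [pd_congr he, pd_sub (c1.mul (cU l hk)) ((contDiff_pd ct l).mul cS), pd_mul c1 (cU l hk),
    pd_mul (contDiff_pd ct l) cS, pd_sum _ cs, pd_sub contDiff_const ct, pd_const]
  have e2 : ∀ m, pd i (fun x => (x - x₀) m * Uop x₀ R (te x₀ R ε) k (g m) x +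
      Uop x₀ R (te x₀ R ε) (mulc m k) (g m) x) x = pd i (fun x : En n => (x - x₀) m) x *
      Uop x₀ R (te x₀ R ε) k (g m) x + (x - x₀) m * pd i (Uop x₀ R (te x₀ R ε) k (g m)) x +
      pd i (Uop x₀ R (te x₀ R ε) (mulc m k) (g m)) x := by
    intro m
    rw [pd_add (cXU m) (cU m (hk.mulc m)), pd_mul (contDiff_X x₀ m) (cU m hk)]
  simp only [e2]
  have e3 : ∑ m, (rho x₀ R x * chi x₀ R δ x * pd i (fun x : En n => (x - x₀) m) x *
      Uop x₀ R (te x₀ R ε) k (g m) x + (x - x₀) m * (rho x₀ R x * chi x₀ R δ x *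
      pd i (Uop x₀ R (te x₀ R ε) k (g m)) x) + rho x₀ R x * chi x₀ R δ x *
      pd i (Uop x₀ R (te x₀ R ε) (mulc m k) (g m)) x) = rho x₀ R x * chi x₀ R δ x *
      ∑ m, (pd i (fun x : En n => (x - x₀) m) x *
      Uop x₀ R (te x₀ R ε) k (g m) x + (x - x₀) m * pd i (Uop x₀ R (te x₀ R ε) k (g m)) x +
      pd i (Uop x₀ R (te x₀ R ε) (mulc m k) (g m)) x) := by
    rw [Finset.mul_sum]
    exact Finset.sum_congr rfl fun m _ => by ring
  rw [e3]
  ring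

lemma contDiff_s {x₀ : En n} {R δ p : ℝ} (hR : 0 < R) (hδ0 : 0 < δ) (hδ : δ ≤ R ^ 2 / 16) (hp : 1 < p)
    {k v : En n → ℝ} {g : Fin n → En n → ℝ} (hk : KOK (R / 4) k)
    (hv : MemLp v (ENNReal.ofReal p) (volume.restrict (ball x₀ R)))
    (hg : ∀ m, MemLp (g m) (ENNReal.ofReal p) (volume.restrict (ball x₀ R)))
    (hvg : ∀ m, HasWeakPartial (ball x₀ R) v (g m) m)
    {ε : ℝ} (h0 : 0 < ε) : ContDiff ℝ (⊤ : ℕ∞) (Uop x₀ R (te x₀ R ε) k v) :=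
  contDiff_Uop hk.1 (contDiff_te h0) (te_pos hR h0) (integrable_of_memLp hp hv)

lemma pd_he {x₀ : En n} {R δ p : ℝ} (hR : 0 < R) (hδ0 : 0 < δ) (hδ : δ ≤ R ^ 2 / 16) (hp : 1 < p)
    {k v : En n → ℝ} {g : Fin n → En n → ℝ} (hk : KOK (R / 4) k)
    (hv : MemLp v (ENNReal.ofReal p) (volume.restrict (ball x₀ R)))
    (hg : ∀ m, MemLp (g m) (ENNReal.ofReal p) (volume.restrict (ball x₀ R)))
    (hvg : ∀ m, HasWeakPartial (ball x₀ R) v (g m) m)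
    {ε : ℝ} (h0 : 0 < ε) (l : Fin n) : pd l (he x₀ R δ k v ε) = fun x =>
    pd l (fun x => rho x₀ R x * chi x₀ R δ x) x * Uop x₀ R (te x₀ R ε) k v x +
      (rho x₀ R x * chi x₀ R δ x) * pd l (Uop x₀ R (te x₀ R ε) k v) x := by
  funext x
  exact pd_mul (contDiff_bb x₀ R δ) (contDiff_s hR hδ0 hδ hp hk hv hg hvg h0) x

lemma GF.pdhe {x₀ : En n} {R δ p : ℝ} (hR : 0 < R) (hδ0 : 0 < δ) (hδ : δ ≤ R ^ 2 / 16) (hp : 1 < p)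
    {k v : En n → ℝ} {g : Fin n → En n → ℝ} (hk : KOK (R / 4) k)
    (hv : MemLp v (ENNReal.ofReal p) (volume.restrict (ball x₀ R)))
    (hg : ∀ m, MemLp (g m) (ENNReal.ofReal p) (volume.restrict (ball x₀ R)))
    (hvg : ∀ m, HasWeakPartial (ball x₀ R) v (g m) m)
    (l : Fin n) : GF (shell x₀ R δ) p (fun ε => pd l (he x₀ R δ k v ε)) := by
  have hc : ∀ {f : En n → ℝ}, ContDiff ℝ (⊤ : ℕ∞) f → GM (shell x₀ R δ) fun _ => f := fun h =>
    GM.of_cont (shell_sub2 hR hδ0 hδ hp) h.continuous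
  have hb := contDiff_bb x₀ R δ
  refine GF.congr isOpen_shell.measurableSet
    (((GF.U' (x₀ := x₀) hR hδ0 hδ hp hk hv).mul (hc (contDiff_pd hb l))).add hp
      ((GF.pds hR hδ0 hδ hp hk hv hg hvg l).mul (hc hb))) ?_
  filter_upwards [ev_pos] with ε h0 x hx
  rw [pd_he hR hδ0 hδ hp hk hv hg hvg h0]

lemma GF.pdpdhe {x₀ : En n} {R δ p : ℝ} (hR : 0 < R) (hδ0 : 0 < δ) (hδ : δ ≤ R ^ 2 / 16) (hp : 1 < p)
    {k v : En n → ℝ} {g : Fin n → En n → ℝ} (hk : KOK (R / 4) k)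
    (hv : MemLp v (ENNReal.ofReal p) (volume.restrict (ball x₀ R)))
    (hg : ∀ m, MemLp (g m) (ENNReal.ofReal p) (volume.restrict (ball x₀ R)))
    (hvg : ∀ m, HasWeakPartial (ball x₀ R) v (g m) m)
    (i l : Fin n) :
    GF (shell x₀ R δ) p (fun ε => pd i (pd l (he x₀ R δ k v ε))) := by
  have hc : ∀ {f : En n → ℝ}, ContDiff ℝ (⊤ : ℕ∞) f → GM (shell x₀ R δ) fun _ => f := fun h =>
    GM.of_cont (shell_sub2 hR hδ0 hδ hp) h.continuous
  have hb := contDiff_bb x₀ R δ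
  refine GF.congr isOpen_shell.measurableSet
    ((((GF.U' (x₀ := x₀) hR hδ0 hδ hp hk hv).mul (hc (contDiff_pd (contDiff_pd hb l) i))).add hp
      ((GF.pds hR hδ0 hδ hp hk hv hg hvg i).mul (hc (contDiff_pd hb l)))).add hp
      (((GF.pds hR hδ0 hδ hp hk hv hg hvg l).mul (hc (contDiff_pd hb i))).add hp
      (GF.bpdpds hR hδ0 hδ hp hk hv hg hvg i l))) ?_
  filter_upwards [ev_pos] with ε h0 x hx
  have cs := contDiff_s hR hδ0 hδ hp hk hv hg hvg h0
  rw [pd_he hR hδ0 hδ hp hk hv hg hvg h0, pd_add ((contDiff_pd hb l).mul cs)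
    (hb.mul (contDiff_pd cs l)), pd_mul (contDiff_pd hb l) cs, pd_mul hb (contDiff_pd cs l)]



/-- boundary pairing -/
def bt (x₀ : En n) (R : ℝ) (i : Fin n) (w g τ : En n → ℝ) : ℝ :=
  (∫ x in ball x₀ R, w x * pd i τ x) + ∫ x in ball x₀ R, g x * τ x

/-- interior cutoff -/
def cut (x₀ : En n) (R ε : ℝ) (x : En n) : ℝ := Real.smoothTransition (rho x₀ R x / ε - 1)

lemma contDiff_cut (x₀ : En n) (R ε : ℝ) : ContDiff ℝ (⊤ : ℕ∞) (cut x₀ R ε) := by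
  have h : ContDiff ℝ (⊤ : ℕ∞) fun x => rho x₀ R x / ε - 1 :=
    ((contDiff_rho x₀ R).div_const ε).sub contDiff_const
  exact Real.smoothTransition.contDiff.comp h

lemma rho_pos_iff {x₀ : En n} {R : ℝ} (hR : 0 < R) (x : En n) : 0 < rho x₀ R x ↔ x ∈ ball x₀ R := by
  unfold rho
  rw [mem_ball, dist_eq_norm]
  constructor
  · intro h
    nlinarith [norm_nonneg (x - x₀)]
  · intro h
    nlinarith [norm_nonneg (x - x₀)]

lemma abs_cut_le (x₀ : En n) (R ε : ℝ) (x : En n) : |cut x₀ R ε x| ≤ 1 := by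
  unfold cut
  rw [abs_of_nonneg (Real.smoothTransition.nonneg _)]
  exact Real.smoothTransition.le_one _

lemma isTestFun_cut {x₀ : En n} {R ε : ℝ} (hR : 0 < R) (hε : 0 < ε) {τ : En n → ℝ}
    (hτ : ContDiff ℝ (⊤ : ℕ∞) τ) :
    IsTestFun (ball x₀ R) (fun x => cut x₀ R ε x * τ x) := by
  have hs : tsupport (fun x => cut x₀ R ε x * τ x) ⊆ {x | ε ≤ rho x₀ R x} := by
    have hc := (contDiff_rho x₀ R).continuous
    refine closure_minimal (fun x hx => ?_) (isClosed_le continuous_const hc)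
    by_contra hc
    simp only [Set.mem_ofPred_eq, not_le] at hc
    refine hx ?_
    have : cut x₀ R ε x = 0 := Real.smoothTransition.zero_of_nonpos (by
      rw [sub_nonpos, div_le_one hε]; exact hc.le)
    simp [this]
  have hs' : tsupport (fun x => cut x₀ R ε x * τ x) ⊆ ball x₀ R := fun x hx =>
    (rho_pos_iff hR x).1 (hε.trans_le (hs hx))
  refine ⟨(contDiff_cut x₀ R ε).mul hτ, ?_, hs'⟩
  exact HasCompactSupport.of_support_subset_isCompact (isCompact_closedBall x₀ R)
    ((subset_closure.trans hs').trans ball_subset_closedBall)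

lemma exists_deriv_sT : ∃ K : ℝ, 0 ≤ K ∧ ∀ s, |deriv Real.smoothTransition s| ≤ K := by
  have hc : Continuous (deriv Real.smoothTransition) :=
    (Real.smoothTransition.contDiff (n := 1)).continuous_deriv le_rfl
  obtain ⟨C, hC⟩ := (isCompact_Icc (a := (0 : ℝ)) (b := 1)).exists_bound_of_continuousOn
    hc.continuousOn
  refine ⟨|C|, abs_nonneg _, fun s => ?_⟩
  by_cases h : s ∈ Set.Icc (0 : ℝ) 1
  · exact (hC s h).trans (le_abs_self C)
  · have : deriv Real.smoothTransition s = 0 := by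
      rw [Set.mem_Icc, not_and_or, not_le, not_le] at h
      rcases h with h | h
      · have : Real.smoothTransition =ᶠ[nhds s] fun _ => 0 := by
          filter_upwards [Iio_mem_nhds h] with y hy
          exact Real.smoothTransition.zero_of_nonpos (le_of_lt hy)
        rw [this.deriv_eq]; simp
      · have : Real.smoothTransition =ᶠ[nhds s] fun _ => 1 := by
          filter_upwards [Ioi_mem_nhds h] with y hy
          exact Real.smoothTransition.one_of_one_le (le_of_lt hy)
        rw [this.deriv_eq]; simp
    rw [this]; simp

lemma pd_cut (x₀ : En n) (R ε : ℝ) (i : Fin n) (x : En n) :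
    pd i (cut x₀ R ε) x = deriv Real.smoothTransition (rho x₀ R x / ε - 1) *
      (pd i (rho x₀ R) x / ε) := by
  have h1 : HasFDerivAt (rho x₀ R) (fderiv ℝ (rho x₀ R) x) x :=
    ((contDiff_rho x₀ R).dif x).hasFDerivAt
  have h2 : HasFDerivAt (fun x => rho x₀ R x / ε - 1) (ε⁻¹ • fderiv ℝ (rho x₀ R) x) x := by
    have := (h1.const_smul ε⁻¹).sub_const 1
    refine this.congr_of_eventuallyEq (Eventually.of_forall fun y => ?_)
    simp [div_eq_inv_mul]
  have h3 : HasDerivAt Real.smoothTransition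
      (deriv Real.smoothTransition (rho x₀ R x / ε - 1)) (rho x₀ R x / ε - 1) :=
    ((Real.smoothTransition.contDiff (n := 1)).differentiable (by simp) _).hasDerivAt
  have := (h3.comp_hasFDerivAt x h2).fderiv
  unfold pd cut
  simp only [Function.comp_def] at this
  rw [this]
  simp [div_eq_inv_mul]

lemma cut_bound (x₀ : En n) {R : ℝ} (hR : 0 < R) : ∃ M : ℝ, 0 ≤ M ∧ ∀ ε, 0 < ε → ∀ i,
    ∀ x ∈ ball x₀ R, |pd i (cut x₀ R ε) x| * rho x₀ R x ≤ M := by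
  obtain ⟨K, hK0, hK⟩ := exists_deriv_sT
  refine ⟨K * (2 * R) * 2, by positivity, fun ε hε i x hx => ?_⟩
  have hx0 := (rho_pos_iff hR x).2 hx
  by_cases h : rho x₀ R x ≤ 2 * ε
  · rw [pd_cut, abs_mul, abs_div, abs_of_pos hε, pd_rho]
    have h2 : |(x - x₀) i| ≤ R := by
      have := PiLp.norm_apply_le (x - x₀) i
      have h3 : ‖x - x₀‖ < R := by simpa [dist_eq_norm] using hx
      rw [Real.norm_eq_abs] at this
      linarith
    have h1 : |-2 * (x - x₀) i| ≤ 2 * R := by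
      rw [abs_mul, abs_neg, abs_two]; linarith
    calc _ ≤ K * (2 * R / ε) * (2 * ε) := by
          gcongr
          exact hK _
      _ = K * (2 * R) * 2 := by field_simp
  · push Not at h
    have : cut x₀ R ε =ᶠ[nhds x] fun _ => 1 := by
      filter_upwards [(isOpen_lt continuous_const (contDiff_rho x₀ R).continuous).mem_nhds h]
        with y hy
      refine Real.smoothTransition.one_of_one_le ?_
      have hy : 2 * ε < rho x₀ R y := hy
      rw [le_sub_iff_add_le, le_div_iff₀ hε]; linarith
    rw [pd_congr this, pd_const]
    simp; positivity

lemma cut_ev {x₀ : En n} {R : ℝ} (hR : 0 < R) {x : En n} (hx : x ∈ ball x₀ R) :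
    ∀ᶠ ε in nhdsWithin (0 : ℝ) (Set.Ioi 0), cut x₀ R ε x = 1 ∧ ∀ i, pd i (cut x₀ R ε) x = 0 := by
  have hx0 := (rho_pos_iff hR x).2 hx
  filter_upwards [ev_pos, mem_nhdsWithin_of_mem_nhds (Iio_mem_nhds
    (by positivity : 0 < rho x₀ R x / 2))] with ε hε h2
  have h2 : ε < rho x₀ R x / 2 := h2
  have : cut x₀ R ε =ᶠ[nhds x] fun _ => 1 := by
    filter_upwards [(isOpen_lt continuous_const (contDiff_rho x₀ R).continuous).mem_nhds
      (by linarith : 2 * ε < rho x₀ R x)] with y hy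
    refine Real.smoothTransition.one_of_one_le ?_
    have hy : 2 * ε < rho x₀ R y := hy
    rw [le_sub_iff_add_le, le_div_iff₀ hε]; linarith
  exact ⟨this.self_of_nhds, fun i => by rw [pd_congr this, pd_const]⟩

lemma bdd_ball (x₀ : En n) (R : ℝ) {c : En n → ℝ} (hc : Continuous c) :
    ∃ C, 0 ≤ C ∧ ∀ x ∈ ball x₀ R, |c x| ≤ C := by
  obtain ⟨C, hC⟩ := (isCompact_closedBall x₀ R).exists_bound_of_continuousOn hc.continuousOn
  exact ⟨|C|, abs_nonneg _, fun x hx =>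
    (hC x (ball_subset_closedBall hx)).trans (le_abs_self C)⟩

lemma int_mul_cont {x₀ : En n} {R : ℝ} {w c : En n → ℝ} (hw : IntegrableOn w (ball x₀ R))
    (hc : Continuous c) : IntegrableOn (fun x => w x * c x) (ball x₀ R) := by
  obtain ⟨C, _, hC⟩ := bdd_ball x₀ R hc
  refine Integrable.mono' (hw.norm.mul_const C) (hw.1.mul hc.aestronglyMeasurable) ?_
  filter_upwards [ae_restrict_mem measurableSet_ball] with z hz
  rw [norm_mul]
  gcongr
  exact hC z hz

/-- dominated convergence with cutoffs -/
lemma cut_dct {x₀ : En n} {R : ℝ} {w : En n → ℝ} (hw : IntegrableOn w (ball x₀ R))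
    (F : ℝ → En n → ℝ) (F₀ : En n → ℝ) (hF : ∀ ε, 0 < ε → Continuous (F ε)) (M : ℝ)
    (hM : ∀ ε, 0 < ε → ∀ x ∈ ball x₀ R, |w x * F ε x| ≤ M * |w x|)
    (hl : ∀ x ∈ ball x₀ R, ∀ᶠ ε in nhdsWithin (0 : ℝ) (Set.Ioi 0), F ε x = F₀ x) :
    Tendsto (fun ε => ∫ x in ball x₀ R, w x * F ε x) (nhdsWithin 0 (Set.Ioi 0))
      (nhds (∫ x in ball x₀ R, w x * F₀ x)) := by
  refine tendsto_integral_filter_of_dominated_convergence (fun x => M * |w x|) ?_ ?_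
    (hw.norm.const_mul M) ?_
  · filter_upwards [ev_pos] with ε hε
    exact hw.1.mul (hF ε hε).aestronglyMeasurable
  · filter_upwards [ev_pos] with ε hε
    filter_upwards [ae_restrict_mem measurableSet_ball] with x hx
    exact hM ε hε x hx
  · filter_upwards [ae_restrict_mem measurableSet_ball] with x hx
    refine tendsto_const_nhds.congr' ?_
    filter_upwards [hl x hx] with ε h
    rw [h]

lemma bt_lim {x₀ : En n} {R : ℝ} (hR : 0 < R) {i : Fin n} {w g τ : En n → ℝ}
    (hw : IntegrableOn w (ball x₀ R)) (hg : IntegrableOn g (ball x₀ R))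
    (h : HasWeakPartial (ball x₀ R) w g i) (hτ : ContDiff ℝ (⊤ : ℕ∞) τ) :
    Tendsto (fun ε => -∫ x in ball x₀ R, w x * (pd i (cut x₀ R ε) x * τ x))
      (nhdsWithin 0 (Set.Ioi 0)) (nhds (bt x₀ R i w g τ)) := by
  have hcp := (contDiff_pd hτ i).continuous
  obtain ⟨C1, _, hC1⟩ := bdd_ball x₀ R hcp
  obtain ⟨C2, _, hC2⟩ := bdd_ball x₀ R hτ.continuous
  have t1 := cut_dct hw (fun ε x => cut x₀ R ε x * pd i τ x) (pd i τ)
    (fun ε _ => (contDiff_cut x₀ R ε).continuous.mul hcp) C1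
    (fun ε _ x hx => by
      rw [abs_mul, abs_mul, mul_comm]
      have := mul_le_mul (abs_cut_le x₀ R ε x) (hC1 x hx) (abs_nonneg _) zero_le_one
      rw [one_mul] at this
      gcongr)
    (fun x hx => (cut_ev hR hx).mono fun ε h => by simp only [h.1, one_mul])
  have t2 := cut_dct hg (fun ε x => cut x₀ R ε x * τ x) τ
    (fun ε _ => (contDiff_cut x₀ R ε).continuous.mul hτ.continuous) C2
    (fun ε _ x hx => by
      rw [abs_mul, abs_mul, mul_comm]
      have := mul_le_mul (abs_cut_le x₀ R ε x) (hC2 x hx) (abs_nonneg _) zero_le_one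
      rw [one_mul] at this
      gcongr)
    (fun x hx => (cut_ev hR hx).mono fun ε h => by simp only [h.1, one_mul])
  refine (t1.add t2).congr' ?_
  filter_upwards [ev_pos] with ε hε
  have h1 := h _ (isTestFun_cut (x₀ := x₀) hR hε hτ)
  have e : ∀ x, fderiv ℝ (fun x => cut x₀ R ε x * τ x) x (basisVec i) =
      pd i (cut x₀ R ε) x * τ x + cut x₀ R ε x * pd i τ x := fun x =>
    pd_mul (contDiff_cut x₀ R ε) hτ x
  simp only [e, mul_add] at h1
  rw [integral_add] at h1
  · linarith
  · exact int_mul_cont hw ((contDiff_pd (contDiff_cut x₀ R ε) i).continuous.mul hτ.continuous)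
  · exact int_mul_cont hw ((contDiff_cut x₀ R ε).continuous.mul hcp)

lemma bt_rho {x₀ : En n} {R : ℝ} (hR : 0 < R) {i : Fin n} {w g τ : En n → ℝ}
    (hw : IntegrableOn w (ball x₀ R)) (hg : IntegrableOn g (ball x₀ R))
    (h : HasWeakPartial (ball x₀ R) w g i) (hτ : ContDiff ℝ (⊤ : ℕ∞) τ) :
    bt x₀ R i w g (fun x => rho x₀ R x * τ x) = 0 := by
  have t := bt_lim hR hw hg h ((contDiff_rho x₀ R).mul hτ)
  obtain ⟨M, hM0, hM⟩ := cut_bound x₀ hR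
  obtain ⟨C2, _, hC2⟩ := bdd_ball x₀ R hτ.continuous
  have t2 := (cut_dct hw (fun ε x => pd i (cut x₀ R ε) x * (rho x₀ R x * τ x)) (fun _ => 0)
    (fun ε _ => (contDiff_pd (contDiff_cut x₀ R ε) i).continuous.mul
      ((contDiff_rho x₀ R).mul hτ).continuous) (M * C2)
    (fun ε hε x hx => by
      rw [abs_mul, mul_comm, ← mul_assoc, abs_mul, abs_mul]
      have h1 := hM ε hε i x hx
      have h2 := hC2 x hx
      rw [abs_of_pos ((rho_pos_iff hR x).2 hx)]
      gcongr)
    (fun x hx => (cut_ev hR hx).mono fun ε h => by simp only [h.2 i, zero_mul])).neg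
  simp only [mul_zero, integral_zero, neg_zero] at t2
  exact tendsto_nhds_unique t t2

lemma bt_rot {x₀ : En n} {R : ℝ} (hR : 0 < R) {i l : Fin n} {w gi gl τ : En n → ℝ}
    (hw : IntegrableOn w (ball x₀ R)) (hgi : IntegrableOn gi (ball x₀ R))
    (hgl : IntegrableOn gl (ball x₀ R))
    (hi : HasWeakPartial (ball x₀ R) w gi i) (hl : HasWeakPartial (ball x₀ R) w gl l)
    (hτ : ContDiff ℝ (⊤ : ℕ∞) τ) :
    bt x₀ R i w gi (fun x => (x - x₀) l * τ x) = bt x₀ R l w gl (fun x => (x - x₀) i * τ x) := by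
  have t := bt_lim hR hw hgi hi ((contDiff_X x₀ l).mul hτ)
  have t' := bt_lim hR hw hgl hl ((contDiff_X x₀ i).mul hτ)
  have e : ∀ ε x, pd i (cut x₀ R ε) x * ((x - x₀) l * τ x) =
      pd l (cut x₀ R ε) x * ((x - x₀) i * τ x) := by
    intro ε x
    rw [pd_cut, pd_cut, pd_rho, pd_rho]; ring
  simp only [e] at t
  exact tendsto_nhds_unique t t'

lemma exists_sphere {x₀ : En n} {R : ℝ} (hR : 0 < R) (i : Fin n) {x : En n} (hx : x ∈ ball x₀ R) :
    ∃ y, ‖y - x₀‖ = R ∧ ‖x - y‖ = R - ‖x - x₀‖ := by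
  have hx' : ‖x - x₀‖ < R := by simpa [dist_eq_norm] using hx
  have hb : ‖(basisVec i : En n)‖ = 1 := by simp [basisVec]
  obtain ⟨e, he, hxe⟩ : ∃ e : En n, ‖e‖ = 1 ∧ x - x₀ = ‖x - x₀‖ • e := by
    by_cases h : x - x₀ = 0
    · exact ⟨basisVec i, hb, by simp [h]⟩
    · have h' : ‖x - x₀‖ ≠ 0 := norm_ne_zero_iff.2 h
      refine ⟨‖x - x₀‖⁻¹ • (x - x₀), ?_, ?_⟩
      · rw [norm_smul, norm_inv, norm_norm, inv_mul_cancel₀ h']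
      · rw [smul_smul, mul_inv_cancel₀ h', one_smul]
  refine ⟨x₀ + R • e, ?_, ?_⟩
  · rw [add_sub_cancel_left, norm_smul, he, Real.norm_of_nonneg hR.le, mul_one]
  · have : x - (x₀ + R • e) = -((R - ‖x - x₀‖) • e) := by
      rw [← sub_sub, hxe, sub_smul, norm_smul, he, norm_norm, mul_one]; abel
    rw [this, norm_neg, norm_smul, he, Real.norm_of_nonneg (by linarith), mul_one]

lemma le_rho {x₀ : En n} {R : ℝ} (hR : 0 < R) (i : Fin n) {w : En n → ℝ}
    (hw : ContDiff ℝ (⊤ : ℕ∞) w) (h0 : ∀ x, rho x₀ R x = 0 → w x = 0) :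
    ∃ C, 0 ≤ C ∧ ∀ x ∈ ball x₀ R, |w x| ≤ C * rho x₀ R x := by
  obtain ⟨C, hC⟩ := (isCompact_closedBall x₀ R).exists_bound_of_continuousOn
    (hw.continuous_fderiv (by simp)).continuousOn
  refine ⟨|C| / R, by positivity, fun x hx => ?_⟩
  obtain ⟨y, hy1, hy2⟩ := exists_sphere hR i hx
  have hy0 : w y = 0 := h0 y (by unfold rho; rw [hy1]; ring)
  have := (convex_closedBall x₀ R).norm_image_sub_le_of_norm_fderiv_le (𝕜 := ℝ) (f := w)
    (fun z _ => hw.dif z) hC (by simp [dist_eq_norm, hy1] : y ∈ closedBall x₀ R)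
    (ball_subset_closedBall hx)
  rw [hy0, sub_zero, hy2, Real.norm_eq_abs] at this
  have hx' : ‖x - x₀‖ < R := by simpa [dist_eq_norm] using hx
  have h2 : C * (R - ‖x - x₀‖) ≤ |C| * (R - ‖x - x₀‖) := by
    exact mul_le_mul_of_nonneg_right (le_abs_self C) (by linarith)
  refine this.trans (h2.trans ?_)
  rw [div_mul_eq_mul_div, mul_div_assoc]
  gcongr
  rw [le_div_iff₀ hR]
  unfold rho
  nlinarith [norm_nonneg (x - x₀)]

lemma hasWeakPartial_smooth {S : Set (En n)} {w : En n → ℝ} (hw : ContDiff ℝ (⊤ : ℕ∞) w)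
    (i : Fin n) : HasWeakPartial S w (pd i w) i := by
  intro φ hφ
  have hsub : ∀ (F : En n → ℝ), (∀ x, x ∉ tsupport φ → F x = 0) → ∫ x in S, F x = ∫ x, F x := by
    intro F hF
    refine setIntegral_eq_integral_of_forall_compl_eq_zero fun x hx => hF x fun h => hx (hφ.2.2 h)
  have hd : ∀ x, x ∉ tsupport φ → fderiv ℝ φ x = 0 := fun x hx => by
    by_contra hc
    exact hx (support_fderiv_subset ℝ (f := φ) hc)
  rw [hsub _ fun x hx => by rw [hd x hx]; simp,
    hsub _ fun x hx => by rw [image_eq_zero_of_notMem_tsupport hx, mul_zero]]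
  have cs : HasCompactSupport φ := hφ.2.1
  refine integral_mul_fderiv_eq_neg_fderiv_mul_of_integrable (𝕜 := ℝ) ?_ ?_ ?_
    (fun x _ => hw.dif x) (fun x _ => hφ.1.dif x)
  · exact ((contDiff_pd hw i).continuous.mul hφ.1.continuous).integrable_of_hasCompactSupport
      cs.mul_left
  · refine (hw.continuous.mul (contDiff_pd hφ.1 i).continuous).integrable_of_hasCompactSupport
      (HasCompactSupport.mul_left ?_)
    exact cs.fderiv_apply ℝ _
  · exact (hw.continuous.mul hφ.1.continuous).integrable_of_hasCompactSupport cs.mul_left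

lemma integrableOn_cont {x₀ : En n} {R : ℝ} {c : En n → ℝ} (hc : Continuous c) :
    IntegrableOn c (ball x₀ R) :=
  (hc.continuousOn.integrableOn_compact (isCompact_closedBall x₀ R)).mono_set
    ball_subset_closedBall

lemma bt_sphere {x₀ : En n} {R : ℝ} (hR : 0 < R) (i : Fin n) {w τ : En n → ℝ}
    (hw : ContDiff ℝ (⊤ : ℕ∞) w) (h0 : ∀ x, rho x₀ R x = 0 → w x = 0)
    (hτ : ContDiff ℝ (⊤ : ℕ∞) τ) : bt x₀ R i w (pd i w) τ = 0 := by
  have t := bt_lim hR (integrableOn_cont (x₀ := x₀) (R := R) hw.continuous)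
    (integrableOn_cont (contDiff_pd hw i).continuous) (hasWeakPartial_smooth hw i) hτ
  obtain ⟨M, hM0, hM⟩ := cut_bound x₀ hR
  obtain ⟨C2, _, hC2⟩ := bdd_ball x₀ R hτ.continuous
  obtain ⟨C, hC0, hC⟩ := le_rho hR i hw h0
  have t2 := (cut_dct (integrableOn_cont (x₀ := x₀) (R := R) (continuous_const (y := (1 : ℝ))))
    (fun ε x => w x * (pd i (cut x₀ R ε) x * τ x)) (fun _ => 0)
    (fun ε _ => hw.continuous.mul ((contDiff_pd (contDiff_cut x₀ R ε) i).continuous.mul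
      hτ.continuous)) (C * M * C2)
    (fun ε hε x hx => by
      rw [one_mul, abs_one, mul_one, abs_mul, abs_mul, ← mul_assoc]
      have h1 := hM ε hε i x hx
      have h2 := hC2 x hx
      have h3 := hC x hx
      refine mul_le_mul ?_ h2 (abs_nonneg _) (by positivity)
      calc _ ≤ (C * rho x₀ R x) * |pd i (cut x₀ R ε) x| := by gcongr
        _ = C * (|pd i (cut x₀ R ε) x| * rho x₀ R x) := by ring
        _ ≤ _ := by gcongr)
    (fun x hx => (cut_ev hR hx).mono fun ε h => by simp only [h.2 i, zero_mul, mul_zero])).neg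
  simp only [mul_zero, integral_zero, neg_zero, one_mul] at t2
  exact tendsto_nhds_unique t t2

lemma bt_sub {x₀ : En n} {R : ℝ} {i : Fin n} {w g w' g' τ : En n → ℝ}
    (hw : IntegrableOn w (ball x₀ R)) (hg : IntegrableOn g (ball x₀ R))
    (hw' : IntegrableOn w' (ball x₀ R)) (hg' : IntegrableOn g' (ball x₀ R))
    (hτ : ContDiff ℝ (⊤ : ℕ∞) τ) :
    bt x₀ R i (fun x => w x - w' x) (fun x => g x - g' x) τ =
      bt x₀ R i w g τ - bt x₀ R i w' g' τ := by
  have h1 := (contDiff_pd hτ i).continuous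
  have h2 := hτ.continuous
  unfold bt
  simp only [sub_mul]
  rw [integral_sub (int_mul_cont hw h1) (int_mul_cont hw' h1),
    integral_sub (int_mul_cont hg h2) (int_mul_cont hg' h2)]
  ring

lemma bt_prod {x₀ : En n} {R : ℝ} {i : Fin n} {w g a τ : En n → ℝ}
    (hw : IntegrableOn w (ball x₀ R)) (hg : IntegrableOn g (ball x₀ R))
    (ha : ContDiff ℝ (⊤ : ℕ∞) a) (hτ : ContDiff ℝ (⊤ : ℕ∞) τ) :
    bt x₀ R i (fun x => a x * w x) (fun x => pd i a x * w x + a x * g x) τ =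
      bt x₀ R i w g (fun x => a x * τ x) := by
  have h1 := (contDiff_pd hτ i).continuous
  have h2 := (contDiff_pd ha i).continuous
  have h3 := hτ.continuous
  have h4 := ha.continuous
  unfold bt
  have e1 : ∀ x, w x * pd i (fun x => a x * τ x) x =
      w x * (pd i a x * τ x) + w x * (a x * pd i τ x) := by
    intro x; rw [pd_mul ha hτ]; ring
  have e2 : ∀ x, (pd i a x * w x + a x * g x) * τ x =
      w x * (pd i a x * τ x) + g x * (a x * τ x) := by
    intro x; ring
  have e3 : ∀ x, a x * w x * pd i τ x = w x * (a x * pd i τ x) := by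
    intro x; ring
  simp only [e1, e2, e3]
  have i1 : IntegrableOn (fun x => w x * (pd i a x * τ x)) (ball x₀ R) :=
    int_mul_cont hw (h2.mul h3)
  have i2 : IntegrableOn (fun x => w x * (a x * pd i τ x)) (ball x₀ R) :=
    int_mul_cont hw (h4.mul h1)
  have i3 : IntegrableOn (fun x => g x * (a x * τ x)) (ball x₀ R) :=
    int_mul_cont hg (h4.mul h3)
  rw [integral_add i1 i2, integral_add i1 i3]
  ring

lemma one_le_ofReal {p : ℝ} (hp : 1 < p) : 1 ≤ ENNReal.ofReal p := by
  rw [← ENNReal.ofReal_one]; exact ENNReal.ofReal_le_ofReal hp.le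

lemma l1_le (x₀ : En n) (R : ℝ) {p : ℝ} (hp : 1 < p) {c : En n → ℝ} (hc : Continuous c) :
    ∃ K : ℝ≥0∞, K ≠ ⊤ ∧ ∀ w : En n → ℝ, AEStronglyMeasurable w (volume.restrict (ball x₀ R)) →
      ∫⁻ x in ball x₀ R, ‖w x * c x‖ₑ ≤
        K * eLpNorm w (ENNReal.ofReal p) (volume.restrict (ball x₀ R)) := by
  obtain ⟨C, hC0, hC⟩ := bdd_ball x₀ R hc
  have h1p := one_le_ofReal hp
  refine ⟨ENNReal.ofReal C * (volume.restrict (ball x₀ R)) Set.univ ^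
    (1 / (1 : ℝ≥0∞).toReal - 1 / (ENNReal.ofReal p).toReal), ?_, fun w hw => ?_⟩
  · refine ENNReal.mul_ne_top ENNReal.ofReal_ne_top (ENNReal.rpow_ne_top_of_nonneg ?_ ?_)
    · rw [ENNReal.toReal_ofReal (by linarith), ENNReal.toReal_one, sub_nonneg, div_one]
      rw [div_le_one (by linarith)]; exact hp.le
    · rw [Measure.restrict_apply_univ]; exact measure_ball_lt_top.ne
  · have := eLpNorm_le_eLpNorm_mul_rpow_measure_univ h1p hw
    rw [eLpNorm_one_eq_lintegral_enorm] at this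
    calc _ ≤ ∫⁻ x in ball x₀ R, ENNReal.ofReal C * ‖w x‖ₑ := by
          refine setLIntegral_mono_ae' measurableSet_ball (Eventually.of_forall fun x hx => ?_)
          rw [enorm_mul, mul_comm]
          gcongr
          rw [← ofReal_norm]
          exact ENNReal.ofReal_le_ofReal (hC x hx)
      _ = ENNReal.ofReal C * ∫⁻ x in ball x₀ R, ‖w x‖ₑ :=
          lintegral_const_mul' _ _ ENNReal.ofReal_ne_top
      _ ≤ _ := by
          rw [mul_assoc, mul_comm (_ ^ _)]
          gcongr

lemma int_tendsto {ι : Type*} {l : Filter ι} {x₀ : En n} {R : ℝ} {p : ℝ} (hp : 1 < p)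
    {c : En n → ℝ} (hc : Continuous c) {w : En n → ℝ} {W : ι → En n → ℝ}
    (hw : IntegrableOn w (ball x₀ R)) (hW : ∀ᶠ i in l, IntegrableOn (W i) (ball x₀ R))
    (ht : Tendsto (fun i => eLpNorm (W i - w) (ENNReal.ofReal p) (volume.restrict (ball x₀ R)))
      l (nhds 0)) :
    Tendsto (fun i => ∫ x in ball x₀ R, W i x * c x) l (nhds (∫ x in ball x₀ R, w x * c x)) := by
  obtain ⟨K, hK, hK'⟩ := l1_le x₀ R hp hc
  refine tendsto_integral_of_L1 _ (int_mul_cont hw hc).1 (hW.mono fun i h => int_mul_cont h hc) ?_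
  have t0 := ENNReal.Tendsto.const_mul ht (Or.inr hK)
  rw [mul_zero] at t0
  refine tendsto_of_tendsto_of_tendsto_of_le_of_le' tendsto_const_nhds t0
    (Eventually.of_forall fun _ => zero_le) (hW.mono fun i h => ?_)
  have := hK' (W i - w) (h.1.sub hw.1)
  simpa only [Pi.sub_apply, sub_mul] using this

lemma bt_tendsto {ι : Type*} {l : Filter ι} {x₀ : En n} {R : ℝ} {p : ℝ} (hp : 1 < p) {i : Fin n}
    {τ w g : En n → ℝ} (hτ : ContDiff ℝ (⊤ : ℕ∞) τ) {W Γ : ι → En n → ℝ}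
    (hw : IntegrableOn w (ball x₀ R)) (hW : ∀ᶠ j in l, IntegrableOn (W j) (ball x₀ R))
    (ht : Tendsto (fun j => eLpNorm (W j - w) (ENNReal.ofReal p) (volume.restrict (ball x₀ R)))
      l (nhds 0))
    (hg : IntegrableOn g (ball x₀ R)) (hΓ : ∀ᶠ j in l, IntegrableOn (Γ j) (ball x₀ R))
    (ht' : Tendsto (fun j => eLpNorm (Γ j - g) (ENNReal.ofReal p) (volume.restrict (ball x₀ R)))
      l (nhds 0)) :
    Tendsto (fun j => bt x₀ R i (W j) (Γ j) τ) l (nhds (bt x₀ R i w g τ)) :=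
  (int_tendsto hp (contDiff_pd hτ i).continuous hw hW ht).add
    (int_tendsto hp hτ.continuous hg hΓ ht')

/-- weak product rule -/
lemma weak_prod {x₀ : En n} {R : ℝ} {i : Fin n} {w g a : En n → ℝ}
    (hw : IntegrableOn w (ball x₀ R)) (hg : IntegrableOn g (ball x₀ R))
    (h : HasWeakPartial (ball x₀ R) w g i) (ha : ContDiff ℝ (⊤ : ℕ∞) a) :
    HasWeakPartial (ball x₀ R) (fun x => a x * w x) (fun x => pd i a x * w x + a x * g x) i := by
  intro φ hφ
  have h1 := bt_prod (i := i) hw hg ha hφ.1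
  have hφ' : IsTestFun (ball x₀ R) (fun x => a x * φ x) :=
    ⟨ha.mul hφ.1, hφ.2.1.mul_left, (tsupport_mul_subset_right).trans hφ.2.2⟩
  have h2 : bt x₀ R i w g (fun x => a x * φ x) = 0 := by
    have := h _ hφ'
    unfold bt
    unfold pd
    rw [this]; ring
  rw [h2] at h1
  unfold bt at h1
  exact eq_neg_of_add_eq_zero_left h1

/-- derivative along constant scale -/
lemma pd_V {x₀ : En n} {R r τ : ℝ} (hrR : r < R) (hτ : 0 < τ) (hτ1 : τ < 1)
    {κ v : En n → ℝ} {g : Fin n → En n → ℝ} (hκ : KOK r κ) (hw : IntegrableOn v (ball x₀ R))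
    (hv : ∀ m, HasWeakPartial (ball x₀ R) v (g m) m) {x : En n} (hx : x ∈ ball x₀ R) (j : Fin n) :
    pd j (Uop x₀ R (fun _ => τ) κ v) x = (1 - τ) * Uop x₀ R (fun _ => τ) κ (g j) x := by
  rw [Uop_deriv' hκ contDiff_const (fun _ => hτ) hw hv
    (fun z hz => ((geo_const (x₀ := x₀) hrR hτ hτ1).geo x hx z hz).1) j, pd_const]
  ring

lemma bt_he {x₀ : En n} {R δ p : ℝ} (hR : 0 < R) (hδ0 : 0 < δ) (hδ : δ ≤ R ^ 2 / 16) (hp : 1 < p)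
    {k v : En n → ℝ} {g : Fin n → En n → ℝ} (hk : KOK (R / 4) k)
    (hv : MemLp v (ENNReal.ofReal p) (volume.restrict (ball x₀ R)))
    (hg : ∀ m, MemLp (g m) (ENNReal.ofReal p) (volume.restrict (ball x₀ R)))
    (hvg : ∀ m, HasWeakPartial (ball x₀ R) v (g m) m)
    {ε : ℝ} (h0 : 0 < ε) (h1 : 2 / R ^ 2 * ε < 1) (i l : Fin n) {τ : En n → ℝ}
    (hτ : ContDiff ℝ (⊤ : ℕ∞) τ) :
    bt x₀ R i (pd l (he x₀ R δ k v ε)) (pd i (pd l (he x₀ R δ k v ε))) τ =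
      bt x₀ R i (fun x => 1 * Uop x₀ R (fun _ => 2 / R ^ 2 * ε) k v x)
        (fun x => (1 - 2 / R ^ 2 * ε) * Uop x₀ R (fun _ => 2 / R ^ 2 * ε) k (g i) x)
        (fun x => pd l (rho x₀ R) x * τ x) := by
  have hvi := integrable_of_memLp hp hv
  set s : ℝ := 2 / R ^ 2 * ε with hs
  have hs0 : 0 < s := by positivity
  have hV : ContDiff ℝ (⊤ : ℕ∞) (Uop x₀ R (fun _ => s) k v) :=
    contDiff_Uop hk.1 contDiff_const (fun _ => hs0) hvi
  have hU := contDiff_s hR hδ0 hδ hp hk hv hg hvg h0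
  have hb := contDiff_bb x₀ R δ
  have hr := contDiff_pd (contDiff_rho x₀ R) l
  have hhe : ContDiff ℝ (⊤ : ℕ∞) (he x₀ R δ k v ε) := hb.mul hU
  have hh := contDiff_pd hhe l
  have hrV : ContDiff ℝ (⊤ : ℕ∞) (fun x => pd l (rho x₀ R) x * Uop x₀ R (fun _ => s) k v x) :=
    hr.mul hV
  have hz := bt_sphere (x₀ := x₀) hR i (w := fun x => pd l (he x₀ R δ k v ε) x -
    pd l (rho x₀ R) x * Uop x₀ R (fun _ => s) k v x) (hh.sub hrV) (fun x hx => by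
      rw [pd_he hR hδ0 hδ hp hk hv hg hvg h0 l]
      have e1 : Uop x₀ R (te x₀ R ε) k v x = Uop x₀ R (fun _ => s) k v x := by
        have : te x₀ R ε x = s := by
          unfold te qe; rw [hx]; simp [Real.sqrt_sq h0.le, hs]
        unfold Uop Ker; rw [this]
      have e2 : pd l (fun x => rho x₀ R x * chi x₀ R δ x) x = pd l (rho x₀ R) x := by
        rw [pd_mul (contDiff_rho x₀ R) (contDiff_chi x₀ R δ), chi_one hx, hx]; ring
      simp only [e1, e2, hx]; ring) hτ
  have e3 : pd i (fun x => pd l (he x₀ R δ k v ε) x -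
      pd l (rho x₀ R) x * Uop x₀ R (fun _ => s) k v x) = fun x =>
      pd i (pd l (he x₀ R δ k v ε)) x -
        pd i (fun x => pd l (rho x₀ R) x * Uop x₀ R (fun _ => s) k v x) x := by
    funext x; exact pd_sub hh hrV x
  rw [e3, bt_sub (integrableOn_cont hh.continuous) (integrableOn_cont (contDiff_pd hh i).continuous)
    (integrableOn_cont hrV.continuous) (integrableOn_cont (contDiff_pd hrV i).continuous) hτ,
    sub_eq_zero] at hz
  rw [hz]
  have e4 : pd i (fun x => pd l (rho x₀ R) x * Uop x₀ R (fun _ => s) k v x) = fun x =>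
      pd i (pd l (rho x₀ R)) x * Uop x₀ R (fun _ => s) k v x +
        pd l (rho x₀ R) x * pd i (Uop x₀ R (fun _ => s) k v) x := by
    funext x; exact pd_mul hr hV x
  rw [e4, bt_prod (integrableOn_cont hV.continuous) (integrableOn_cont (contDiff_pd hV i).continuous)
    hr hτ]
  unfold bt
  congr 1
  · simp only [one_mul]
  · refine setIntegral_congr_fun measurableSet_ball fun x hx => ?_
    simp only [pd_V (by linarith : R / 4 < R) hs0 h1 hk hvi hvg hx i]

lemma bt_he_tendsto {x₀ : En n} {R δ p : ℝ} (hR : 0 < R) (hδ0 : 0 < δ) (hδ : δ ≤ R ^ 2 / 16)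
    (hp : 1 < p) {k v : En n → ℝ} {g : Fin n → En n → ℝ} (hk : KOK (R / 4) k) (hk1 : ∫ y, k y = 1)
    (hv : MemLp v (ENNReal.ofReal p) (volume.restrict (ball x₀ R)))
    (hg : ∀ m, MemLp (g m) (ENNReal.ofReal p) (volume.restrict (ball x₀ R)))
    (hvg : ∀ m, HasWeakPartial (ball x₀ R) v (g m) m) (i l : Fin n) {τ : En n → ℝ}
    (hτ : ContDiff ℝ (⊤ : ℕ∞) τ) :
    Tendsto (fun ε => bt x₀ R i (pd l (he x₀ R δ k v ε)) (pd i (pd l (he x₀ R δ k v ε))) τ)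
      (nhdsWithin 0 (Set.Ioi 0)) (nhds (bt x₀ R i v (g i) (fun x => pd l (rho x₀ R) x * τ x))) := by
  have hvi := integrable_of_memLp hp hv
  have hsc : Tendsto (fun ε : ℝ => 2 / R ^ 2 * ε) (nhdsWithin 0 (Set.Ioi 0))
      (nhdsWithin 0 (Set.Ioi 0)) := by
    refine tendsto_nhdsWithin_iff.2 ⟨?_, ?_⟩
    · have : Tendsto (fun ε : ℝ => 2 / R ^ 2 * ε) (nhds 0) (nhds (2 / R ^ 2 * 0)) :=
        (continuous_const.mul continuous_id).tendsto 0
      rw [mul_zero] at this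
      exact this.mono_left nhdsWithin_le_nhds
    · filter_upwards [ev_pos] with ε hε
      exact (by positivity : 0 < 2 / R ^ 2 * ε)
  have hlt : ∀ᶠ ε in nhdsWithin (0 : ℝ) (Set.Ioi 0), 2 / R ^ 2 * ε < 1 :=
    hsc.eventually (mem_nhdsWithin_of_mem_nhds (Iio_mem_nhds one_pos))
  have hc1 : Tendsto (fun τ : ℝ => 1 - τ) (nhdsWithin 0 (Set.Ioi 0)) (nhds 1) := by
    have : Tendsto (fun τ : ℝ => 1 - τ) (nhds 0) (nhds (1 - 0)) :=
      (continuous_const.sub continuous_id).tendsto 0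
    rw [sub_zero] at this
    exact this.mono_left nhdsWithin_le_nhds
  have t1 := (V_tendsto (x₀ := x₀) (by positivity : 0 ≤ R / 4) (by linarith : R / 4 < R)
    (fun _ => 1) tendsto_const_nhds hk hk1 hp hv).comp hsc
  have t2 := (V_tendsto (x₀ := x₀) (by positivity : 0 ≤ R / 4) (by linarith : R / 4 < R)
    (fun τ => 1 - τ) hc1 hk hk1 hp (hg i)).comp hsc
  have hci : ∀ (c : ℝ) {w : En n → ℝ}, IntegrableOn w (ball x₀ R) → ∀ ε : ℝ, 0 < ε →
      IntegrableOn (fun x => c * Uop x₀ R (fun _ => 2 / R ^ 2 * ε) k w x) (ball x₀ R) := by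
    intro c w hw ε hε
    exact integrableOn_cont (continuous_const.mul (contDiff_Uop hk.1 contDiff_const
      (fun _ => by positivity) hw).continuous)
  have t := bt_tendsto (i := i) hp ((contDiff_pd (contDiff_rho x₀ R) l).mul hτ) hvi
    (ev_pos.mono fun ε hε => hci 1 hvi ε hε) t1 (integrable_of_memLp hp (hg i))
    (ev_pos.mono fun ε hε => hci (1 - 2 / R ^ 2 * ε) (integrable_of_memLp hp (hg i)) ε hε) t2
  refine t.congr' ?_
  filter_upwards [ev_pos, hlt] with ε hε h1
  exact (bt_he hR hδ0 hδ hp hk hv hg hvg hε h1 i l hτ).symm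

lemma tsupport_pd (l : Fin n) (f : En n → ℝ) : tsupport (pd l f) ⊆ tsupport f :=
  tsupport_fderiv_apply_subset ℝ (basisVec l)

lemma fast_cauchy {J : Type*} [Finite J] {S : Set (En n)} {p : ℝ} (hp : 1 < p)
    (F : J → ℝ → En n → ℝ) (hF : ∀ a, GF S p (F a)) {c : ℝ≥0∞} (hc : 0 < c) :
    ∃ e : ℝ, 0 < e ∧ ∀ ε ε', 0 < ε → ε < e → 0 < ε' → ε' < e → ∀ a,
      eLpNorm (F a ε - F a ε') (ENNReal.ofReal p) (volume.restrict S) ≤ c := by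
  have h1p := one_le_ofReal hp
  have key : ∀ a, ∃ L : En n → ℝ, AEStronglyMeasurable L (volume.restrict S) ∧
      ∀ᶠ ε in nhdsWithin (0 : ℝ) (Set.Ioi 0), AEStronglyMeasurable (F a ε) (volume.restrict S) ∧
        eLpNorm (F a ε - L) (ENNReal.ofReal p) (volume.restrict S) ≤ c / 2 := by
    intro a
    obtain ⟨h1, L, hL, ht⟩ := hF a _ (GM.const 1)
    simp only [one_mul] at h1 ht
    refine ⟨L, hL, h1.and (ht.eventually (Iic_mem_nhds ?_))⟩
    exact ENNReal.half_pos hc.ne'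
  choose L hL hev using key
  have hall := eventually_all.2 hev
  rw [eventually_nhdsWithin_iff, Metric.eventually_nhds_iff] at hall
  obtain ⟨e, he, h⟩ := hall
  refine ⟨e, he, fun ε ε' h0 h1 h0' h1' a => ?_⟩
  obtain ⟨m1, b1⟩ := h (y := ε) (by simpa [abs_of_pos h0] using h1) h0 a
  obtain ⟨m2, b2⟩ := h (y := ε') (by simpa [abs_of_pos h0'] using h1') h0' a
  calc eLpNorm (F a ε - F a ε') (ENNReal.ofReal p) (volume.restrict S)
      = eLpNorm ((F a ε - L a) - (F a ε' - L a)) (ENNReal.ofReal p) (volume.restrict S) := by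
        congr 1; abel
    _ ≤ _ := eLpNorm_sub_le (m1.sub (hL a)) (m2.sub (hL a)) h1p
    _ ≤ c / 2 + c / 2 := add_le_add b1 b2
    _ = c := ENNReal.add_halves c

lemma eLpNorm_shell {x₀ : En n} {R δ : ℝ} (hR : 0 < R) (hδ : 0 < δ) {q : ℝ≥0∞} {f : En n → ℝ}
    (hf : tsupport f ⊆ {x | |rho x₀ R x| < δ}) :
    eLpNorm f q volume = eLpNorm f q (volume.restrict (shell x₀ R δ)) := by
  rw [← eLpNorm_restrict_eq_of_support_subset ((subset_tsupport f).trans hf)]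
  congr 1
  refine Measure.restrict_congr_set ?_
  have hs : volume (sphere x₀ R) = 0 := Measure.addHaar_sphere_of_ne_zero _ _ hR.ne'
  have : ∀ᵐ x : En n, x ∉ sphere x₀ R := measure_eq_zero_iff_ae_notMem.1 hs
  filter_upwards [this] with x hx
  refine propext ⟨fun h => ⟨?_, h⟩, fun h => h.2⟩
  refine abs_pos.2 fun h0 => hx ?_
  unfold rho at h0
  rw [mem_sphere, dist_eq_norm]
  have h3 : (R - ‖x - x₀‖) * (R + ‖x - x₀‖) = 0 := by rw [← h0]; ring
  rcases mul_eq_zero.1 h3 with h | h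
  · linarith
  · have := norm_nonneg (x - x₀); linarith

lemma exists_KOK {r : ℝ} (hr : 0 < r) : ∃ k : En n → ℝ, KOK r k ∧ ∫ y, k y = 1 := by
  let b : ContDiffBump (0 : En n) := ⟨r / 2, r, by positivity, by linarith⟩
  refine ⟨b.normed volume, ⟨b.contDiff_normed, fun y hy => ?_⟩, b.integral_normed⟩
  have : y ∉ Function.support (b.normed volume) := by
    rw [b.support_normed_eq]
    simp only [mem_ball, dist_zero_right, not_lt]
    exact hy.le
  simpa using this

lemma memLp_smooth {f : En n → ℝ} (hf : Continuous f) (hc : HasCompactSupport f) (q : ℝ≥0∞) :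
    MemLp f q volume := hf.memLp_of_hasCompactSupport hc

lemma trace_lift {x₀ : En n} {R R' p : ℝ} (hR : 0 < R) (hRR : R < R') (hp : 1 < p)
    {v : En n → ℝ} {g : Fin n → En n → ℝ}
    (hv : MemLp v (ENNReal.ofReal p) (volume.restrict (ball x₀ R)))
    (hg : ∀ m, MemLp (g m) (ENNReal.ofReal p) (volume.restrict (ball x₀ R)))
    (hvg : ∀ m, HasWeakPartial (ball x₀ R) v (g m) m) :
    ∃ h : ℕ → En n → ℝ, (∀ j, ContDiff ℝ (⊤ : ℕ∞) (h j)) ∧ (∀ j, tsupport (h j) ⊆ ball x₀ R') ∧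
      (∀ j x, rho x₀ R x = 0 → h j x = 0) ∧
      (∀ l, ∑' j, 2 ^ j * eLpNorm (pd l (h j)) (ENNReal.ofReal p) volume ≠ ⊤) ∧
      (∀ i l, ∑' j, 2 ^ j * eLpNorm (pd i (pd l (h j))) (ENNReal.ofReal p) volume ≠ ⊤) ∧
      ∀ i l (τ : En n → ℝ), ContDiff ℝ (⊤ : ℕ∞) τ →
        Tendsto (fun m => ∑ j ∈ Finset.range m, bt x₀ R i (pd l (h j)) (pd i (pd l (h j))) τ) atTop
          (nhds (bt x₀ R i v (g i) (fun x => pd l (rho x₀ R) x * τ x))) := by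
  obtain ⟨k, hk, hk1⟩ := exists_KOK (n := n) (by positivity : 0 < R / 4)
  obtain ⟨δ, hδ0, hδ, hδ'⟩ : ∃ δ : ℝ, 0 < δ ∧ δ ≤ R ^ 2 / 16 ∧ R ^ 2 + δ ≤ R' ^ 2 := by
    refine ⟨min (R ^ 2 / 16) (R' ^ 2 - R ^ 2), lt_min (by positivity) (by nlinarith),
      min_le_left _ _, ?_⟩
    linarith [min_le_right (R ^ 2 / 16) (R' ^ 2 - R ^ 2)]
  set H := he x₀ R δ k v with hH
  have Hs : ∀ ε, 0 < ε → ContDiff ℝ (⊤ : ℕ∞) (H ε) := fun ε h0 =>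
    (contDiff_bb x₀ R δ).mul (contDiff_s hR hδ0 hδ hp hk hv hg hvg h0)
  have Ht : ∀ ε, tsupport (H ε) ⊆ tsupport (chi x₀ R δ) := by
    intro ε
    refine closure_mono fun x hx hc => hx ?_
    simp only [hH, he, hc]; ring
  have hchi := tsupport_chi (x₀ := x₀) (R := R) hδ0
  have hsub : {x | |rho x₀ R x| < δ} ⊆ ball x₀ R' := by
    intro x hx
    have h1 : |rho x₀ R x| < δ := hx
    have h2 := (abs_lt.1 h1).1
    unfold rho at h2
    rw [mem_ball, dist_eq_norm]
    exact lt_of_pow_lt_pow_left₀ 2 (by linarith) (by linarith)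
  have hcs : ∀ f : En n → ℝ, tsupport f ⊆ tsupport (chi x₀ R δ) → HasCompactSupport f := by
    intro f hf
    exact (isCompact_closedBall x₀ R').of_isClosed_subset (isClosed_tsupport f)
      (hf.trans (hchi.trans (hsub.trans ball_subset_closedBall)))
  -- the finite family
  let F : (Fin n ⊕ Fin n × Fin n) → ℝ → En n → ℝ := fun a ε =>
    Sum.elim (fun l => pd l (H ε)) (fun q => pd q.1 (pd q.2 (H ε))) a
  have hF : ∀ a, GF (shell x₀ R δ) p (F a) := by
    rintro (l | ⟨i, l⟩)
    · exact GF.pdhe hR hδ0 hδ hp hk hv hg hvg l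
    · exact GF.pdpdhe hR hδ0 hδ hp hk hv hg hvg i l
  have hFt : ∀ a ε, tsupport (F a ε) ⊆ tsupport (chi x₀ R δ) := by
    rintro (l | ⟨i, l⟩) ε
    · exact (tsupport_pd l _).trans (Ht ε)
    · exact ((tsupport_pd i _).trans (tsupport_pd l _)).trans (Ht ε)
  have hFc : ∀ a ε, 0 < ε → Continuous (F a ε) := by
    rintro (l | ⟨i, l⟩) ε h0
    · exact (contDiff_pd (Hs ε h0) l).continuous
    · exact (contDiff_pd (contDiff_pd (Hs ε h0) l) i).continuous
  have hcpos : ∀ j : ℕ, 0 < ((2 : ℝ≥0∞) ^ (j + 1))⁻¹ * 2⁻¹ ^ j := by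
    intro j
    refine ENNReal.mul_pos ?_ ?_
    · exact ENNReal.inv_ne_zero.2 (ENNReal.pow_ne_top (by simp))
    · exact pow_ne_zero _ (by simp)
  choose e he0 hbd using fun j => fast_cauchy hp F hF (hcpos j)
  obtain ⟨φ, hφ, hφe⟩ := extraction_forall_of_eventually
    (P := fun j m => ∀ m' ≥ m, (1 : ℝ) / (m' + 1) < e j) (fun j =>
      eventually_forall_ge_atTop.2 (tendsto_one_div_add_atTop_nhds_zero_nat.eventually
        (Iio_mem_nhds (he0 j))))
  let s : ℕ → ℝ := fun j => 1 / ((φ j : ℝ) + 1)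
  have hs0 : ∀ j, 0 < s j := fun j => by positivity
  have hst : Tendsto s atTop (nhdsWithin 0 (Set.Ioi 0)) :=
    tendsto_nhdsWithin_iff.2 ⟨tendsto_one_div_add_atTop_nhds_zero_nat.comp hφ.tendsto_atTop,
      Eventually.of_forall hs0⟩
  have hdiff : ∀ a j, eLpNorm (F a (s (j + 1)) - F a (s j)) (ENNReal.ofReal p) volume ≤
      ((2 : ℝ≥0∞) ^ (j + 1))⁻¹ * 2⁻¹ ^ j := by
    intro a j
    rw [eLpNorm_shell hR hδ0]
    · exact hbd j _ _ (hs0 _) (hφe j _ (hφ (Nat.lt_succ_self j)).le) (hs0 _) (hφe j _ le_rfl) a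
    · exact ((tsupport_sub _ _).trans (Set.union_subset (hFt _ _) (hFt _ _))).trans hchi
  let h : ℕ → En n → ℝ := fun j => Nat.rec (H (s 0)) (fun j _ x => H (s (j + 1)) x - H (s j) x) j
  have h_zero : h 0 = H (s 0) := rfl
  have h_succ : ∀ j, h (j + 1) = fun x => H (s (j + 1)) x - H (s j) x := fun j => rfl
  have hsm : ∀ j, ContDiff ℝ (⊤ : ℕ∞) (h j) := by
    rintro (_ | j)
    · exact Hs _ (hs0 0)
    · exact (Hs _ (hs0 _)).sub (Hs _ (hs0 _))
  have pds : ∀ l j, pd l (h (j + 1)) = fun x => pd l (H (s (j + 1))) x - pd l (H (s j)) x := by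
    intro l j
    funext x
    rw [h_succ]
    exact pd_sub (Hs _ (hs0 _)) (Hs _ (hs0 _)) x
  have pdpds : ∀ i l j, pd i (pd l (h (j + 1))) =
      fun x => pd i (pd l (H (s (j + 1)))) x - pd i (pd l (H (s j))) x := by
    intro i l j
    funext x
    rw [pds]
    exact pd_sub (contDiff_pd (Hs _ (hs0 _)) l) (contDiff_pd (Hs _ (hs0 _)) l) x
  have hsum : ∀ (a) (u : ℕ → En n → ℝ), u 0 = F a (s 0) →
      (∀ j, u (j + 1) = F a (s (j + 1)) - F a (s j)) →
      ∑' j, 2 ^ j * eLpNorm (u j) (ENNReal.ofReal p) volume ≠ ⊤ := by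
    intro a u hu0 hu
    rw [tsum_eq_zero_add' ENNReal.summable]
    refine ENNReal.add_ne_top.2 ⟨?_, ?_⟩
    · rw [pow_zero, one_mul, hu0]
      exact (memLp_smooth (hFc a _ (hs0 0)) (hcs _ (hFt a _)) _).2.ne
    · have hle : ∑' j, (2 : ℝ≥0∞) ^ (j + 1) * eLpNorm (u (j + 1)) (ENNReal.ofReal p) volume ≤
          ∑' j : ℕ, (2⁻¹ : ℝ≥0∞) ^ j := by
        refine ENNReal.tsum_le_tsum fun j => ?_
        rw [hu]
        refine (mul_le_mul_right (hdiff a j) _).trans ?_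
        rw [← mul_assoc, ENNReal.mul_inv_cancel (by simp) (ENNReal.pow_ne_top (by simp)), one_mul]
      refine ne_top_of_le_ne_top ?_ hle
      rw [ENNReal.tsum_geometric, ENNReal.one_sub_inv_two]
      simp
  refine ⟨h, hsm, ?_, ?_, ?_, ?_, ?_⟩
  · rintro (_ | j)
    · exact (Ht _).trans (hchi.trans hsub)
    · rw [h_succ]
      exact (((tsupport_sub _ _).trans (Set.union_subset (Ht _) (Ht _))).trans hchi).trans hsub
  · have : ∀ ε x, rho x₀ R x = 0 → H ε x = 0 := by
      intro ε x hx
      simp [hH, he, hx]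
    rintro (_ | j) x hx
    · exact this _ _ hx
    · rw [h_succ]; simp only [this _ _ hx, sub_zero]
  · intro l
    exact hsum (Sum.inl l) _ rfl (fun j => pds l j)
  · intro i l
    exact hsum (Sum.inr (i, l)) _ rfl (fun j => pdpds i l j)
  · intro i l τ hτ
    have t := (bt_he_tendsto (x₀ := x₀) hR hδ0 hδ hp hk hk1 hv hg hvg i l hτ).comp hst
    rw [← tendsto_add_atTop_iff_nat 1]
    refine t.congr fun m => ?_
    induction m with
    | zero => simp [h_zero, hH]
    | succ m ih =>
      rw [Finset.sum_range_succ, ← ih, pdpds, pds, bt_sub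
        (integrableOn_cont (contDiff_pd (Hs _ (hs0 _)) l).continuous)
        (integrableOn_cont (contDiff_pd (contDiff_pd (Hs _ (hs0 _)) l) i).continuous)
        (integrableOn_cont (contDiff_pd (Hs _ (hs0 _)) l).continuous)
        (integrableOn_cont (contDiff_pd (contDiff_pd (Hs _ (hs0 _)) l) i).continuous) hτ]
      simp only [Function.comp, hH]
      ring

lemma sqrt_memLp_iff {ι : Type*} [Fintype ι] {μ : Measure (En n)} {p : ℝ} (hp : 1 < p)
    {w : En n → ι → ℝ} (hw : ∀ q, AEStronglyMeasurable (fun x => w x q) μ) :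
    Integrable (fun x => Real.sqrt (∑ q, w x q ^ 2) ^ p) μ ↔
      ∀ q, MemLp (fun x => w x q) (ENNReal.ofReal p) μ := by
  have hp0 : 0 < p := by linarith
  have hm : AEStronglyMeasurable (fun x => Real.sqrt (∑ q, w x q ^ 2)) μ := by
    refine Real.continuous_sqrt.comp_aestronglyMeasurable ?_
    exact Finset.aestronglyMeasurable_fun_sum _ fun q _ => (hw q).pow 2
  have e := integrable_norm_rpow_iff (p := ENNReal.ofReal p) hm (by simpa using hp0)
    ENNReal.ofReal_ne_top
  rw [ENNReal.toReal_ofReal hp0.le] at e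
  simp only [Real.norm_of_nonneg (Real.sqrt_nonneg _)] at e
  rw [e]
  constructor
  · intro h q
    refine h.mono (hw q) (Eventually.of_forall fun x => ?_)
    rw [Real.norm_of_nonneg (Real.sqrt_nonneg _), Real.norm_eq_abs]
    refine Real.abs_le_sqrt ?_
    exact Finset.single_le_sum (f := fun q => w x q ^ 2) (fun q _ => sq_nonneg _)
      (Finset.mem_univ q)
  · intro h
    have hs : MemLp (fun x => ∑ q, ‖w x q‖) (ENNReal.ofReal p) μ :=
      memLp_finsetSum _ fun q _ => (h q).norm
    refine hs.mono hm (Eventually.of_forall fun x => ?_)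
    rw [Real.norm_of_nonneg (Real.sqrt_nonneg _),
      Real.norm_of_nonneg (Finset.sum_nonneg fun q _ => norm_nonneg _)]
    refine Real.sqrt_le_iff.2 ⟨Finset.sum_nonneg fun q _ => norm_nonneg _, ?_⟩
    have := Finset.sum_sq_le_sq_sum_of_nonneg (s := Finset.univ) (f := fun q => ‖w x q‖)
      (fun q _ => norm_nonneg _)
    simpa only [Real.norm_eq_abs, sq_abs] using this

lemma memW1p_iff {B : Set (En n)} {p : ℝ} (hp : 1 < p) {u : En n → Form n N k}
    {G : En n → Fin n → Form n N k} : MemW1p B p u G ↔ HasWeakGrad B u G ∧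
      (∀ q, MemLp (fun x => u x q) (ENNReal.ofReal p) (volume.restrict B)) ∧
      (∀ i q, MemLp (fun x => G x i q) (ENNReal.ofReal p) (volume.restrict B)) := by
  have hg : ∀ H : Fin n → Form n N k, gnorm H =
      Real.sqrt (∑ q : Fin n × (FormIdx n k × Fin N), (fun q => H q.1 q.2) q ^ 2) := by
    intro H; unfold gnorm; rw [Fintype.sum_prod_type]
  constructor
  · rintro ⟨h1, h2, h3, h4, h5⟩
    refine ⟨h1, (sqrt_memLp_iff (w := u) hp h2).1 h4, ?_⟩
    have h5' : IntegrableOn (fun x => Real.sqrt (∑ q : Fin n × (FormIdx n k × Fin N),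
      (fun x (q : Fin n × (FormIdx n k × Fin N)) => G x q.1 q.2) x q ^ 2) ^ p) B := by
      simpa only [hg] using h5
    have h6 := (sqrt_memLp_iff (w := fun x (q : Fin n × (FormIdx n k × Fin N)) => G x q.1 q.2) hp
      (fun q => h3 q.1 q.2)).1 h5'
    exact fun i q => h6 (i, q)
  · rintro ⟨h1, h2, h3⟩
    refine ⟨h1, fun q => (h2 q).1, fun i q => (h3 i q).1,
      (sqrt_memLp_iff (w := u) hp fun q => (h2 q).1).2 h2, ?_⟩
    have h5 := (sqrt_memLp_iff (w := fun x (q : Fin n × (FormIdx n k × Fin N)) => G x q.1 q.2) hp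
      fun q => (h3 q.1 q.2).1).2 fun q => h3 q.1 q.2
    unfold IntegrableOn
    simpa only [hg] using h5

lemma memW1p0_iff {x₀ : En n} {R p : ℝ} (hp : 1 < p) {u : En n → Form n N k}
    {G : En n → Fin n → Form n N k} : MemW1p0 n N k (ball x₀ R) p u G ↔
      (∀ q, MemLp (fun x => u x q) (ENNReal.ofReal p) (volume.restrict (ball x₀ R))) ∧
      (∀ i q, MemLp (fun x => G x i q) (ENNReal.ofReal p) (volume.restrict (ball x₀ R))) ∧
      ∀ i q τ, IsTestFun Set.univ τ → bt x₀ R i (fun x => u x q) (fun x => G x i q) τ = 0 := by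
  have e1 : ∀ (c : En n → ℝ) q, ∫ x in Set.univ, (ball x₀ R).indicator u x q * c x =
      ∫ x in ball x₀ R, u x q * c x := by
    intro c q
    rw [Measure.restrict_univ, ← integral_indicator measurableSet_ball]
    congr 1; funext x
    by_cases hx : x ∈ ball x₀ R <;> simp [Set.indicator, hx]
  have e2 : ∀ (c : En n → ℝ) i q, ∫ x in Set.univ, (ball x₀ R).indicator G x i q * c x =
      ∫ x in ball x₀ R, G x i q * c x := by
    intro c i q
    rw [Measure.restrict_univ, ← integral_indicator measurableSet_ball]
    congr 1; funext x
    by_cases hx : x ∈ ball x₀ R <;> simp [Set.indicator, hx]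
  have key : HasWeakGrad Set.univ ((ball x₀ R).indicator u) ((ball x₀ R).indicator G) ↔
      ∀ i q τ, IsTestFun Set.univ τ → bt x₀ R i (fun x => u x q) (fun x => G x i q) τ = 0 := by
    refine forall_congr' fun i => forall_congr' fun q => forall_congr' fun τ =>
      imp_congr_right fun _ => ?_
    rw [e1, e2]
    exact (add_eq_zero_iff_eq_neg).symm
  unfold MemW1p0
  rw [memW1p_iff hp, key]
  constructor
  · rintro ⟨⟨_, h2, h3⟩, h4⟩
    exact ⟨h2, h3, h4⟩
  · rintro ⟨h2, h3, h4⟩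
    refine ⟨⟨fun i q τ hτ => ?_, h2, h3⟩, h4⟩
    exact eq_neg_of_add_eq_zero_left (h4 i q τ ⟨hτ.1, hτ.2.1, Set.subset_univ _⟩)

lemma bt_add {x₀ : En n} {R : ℝ} {i : Fin n} {w g w' g' τ : En n → ℝ}
    (hw : IntegrableOn w (ball x₀ R)) (hg : IntegrableOn g (ball x₀ R))
    (hw' : IntegrableOn w' (ball x₀ R)) (hg' : IntegrableOn g' (ball x₀ R))
    (hτ : ContDiff ℝ (⊤ : ℕ∞) τ) :
    bt x₀ R i (fun x => w x + w' x) (fun x => g x + g' x) τ =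
      bt x₀ R i w g τ + bt x₀ R i w' g' τ := by
  have h1 := (contDiff_pd hτ i).continuous
  have h2 := hτ.continuous
  unfold bt
  simp only [add_mul]
  rw [integral_add (int_mul_cont hw h1) (int_mul_cont hw' h1),
    integral_add (int_mul_cont hg h2) (int_mul_cont hg' h2)]
  ring

lemma bt_cs {x₀ : En n} {R : ℝ} {i : Fin n} {w τ : En n → ℝ} (hw : IsTestFun (ball x₀ R) w)
    (hτ : ContDiff ℝ (⊤ : ℕ∞) τ) : bt x₀ R i w (pd i w) τ = 0 := by
  have := hasWeakPartial_smooth (S := ball x₀ R) hτ i w hw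
  unfold bt
  simp only [mul_comm (w _), mul_comm (pd i w _)]
  change (∫ x in ball x₀ R, τ x * pd i w x) = _ at this
  rw [this]; ring

lemma extD_add (G G' : Fin n → Form n N k) (q) :
    extD (fun i q => G i q + G' i q) q = extD G q + extD G' q := by
  unfold extD
  rw [← Finset.sum_add_distrib]
  refine Finset.sum_congr rfl fun i _ => ?_
  split_ifs
  · ring
  · simp

lemma extD_smul (c : ℝ) (G : Fin n → Form n N k) (q) :
    extD (fun i q => c * G i q) q = c * extD G q := by
  unfold extD
  rw [Finset.mul_sum]
  refine Finset.sum_congr rfl fun i _ => ?_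
  split_ifs
  · ring
  · simp

lemma memLp_cont {x₀ : En n} {R : ℝ} {c : En n → ℝ} (hc : Continuous c) (p : ℝ) :
    MemLp c (ENNReal.ofReal p) (volume.restrict (ball x₀ R)) := by
  obtain ⟨C, _, hC⟩ := bdd_ball x₀ R hc
  have : IsFiniteMeasure ((volume : Measure (En n)).restrict (ball x₀ R)) :=
    ⟨by rw [Measure.restrict_apply_univ]; exact measure_ball_lt_top⟩
  exact MemLp.of_bound hc.aestronglyMeasurable C
    ((ae_restrict_mem measurableSet_ball).mono fun x hx => hC x hx)

/-- weak formulation on a ball -/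
def WSol (x₀ : En n) (R p : ℝ) (A : En n → Form n N (k + 1)) (f : En n → Form n N k) : Prop :=
  (∀ q, IntegrableOn (fun x => f x q) (ball x₀ R)) ∧
  ∀ ψ Gψ, MemW1p0 n N k (ball x₀ R) p ψ Gψ →
    ∫ x in ball x₀ R, finner (A x) (extD (Gψ x)) = ∫ x in ball x₀ R, finner (f x) (ψ x)

open Classical in
lemma closed_int {x₀ : En n} {R p : ℝ} (hp : 1 < p) {A : En n → Form n N (k + 1)}
    {f : En n → Form n N k} (hA : WSol x₀ R p A f) {ζ : En n → Form n N k}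
    {Gζ : En n → Fin n → Form n N k} (hζ : MemW1p0 n N k (ball x₀ R) p ζ Gζ)
    (hd : ∀ᵐ x ∂volume.restrict (ball x₀ R), extD (Gζ x) = 0) :
    IntegrableOn (fun x => finner (f x) (ζ x)) (ball x₀ R) ∧
      ∫ x in ball x₀ R, finner (f x) (ζ x) = 0 := by
  obtain ⟨hf, hw⟩ := hA
  refine ⟨?_, ?_⟩
  swap
  · rw [← hw _ _ hζ]
    refine integral_eq_zero_of_ae ?_
    filter_upwards [hd] with x hx
    simp [hx, finner]
  by_contra hni
  have hz := (memW1p0_iff hp).1 hζ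
  have key : ∀ q₀ (θ : En n → ℝ), IsTestFun (ball x₀ R) θ →
      ∫ x in ball x₀ R, f x q₀ * θ x = 0 := by
    intro q₀ θ hθ
    let τ : En n → Form n N k := fun x q => if q = q₀ then θ x else 0
    let Gτ : En n → Fin n → Form n N k := fun x i q => if q = q₀ then pd i θ x else 0
    have hτ : MemW1p0 n N k (ball x₀ R) p τ Gτ := by
      rw [memW1p0_iff hp]
      refine ⟨fun q => ?_, fun i q => ?_, fun i q σ hσ => ?_⟩
      · by_cases h : q = q₀
        · simp only [τ, h, if_true]; exact memLp_cont hθ.1.continuous p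
        · simp only [τ, h, if_false]; exact memLp_cont continuous_const p
      · by_cases h : q = q₀
        · simp only [Gτ, h, if_true]; exact memLp_cont (contDiff_pd hθ.1 i).continuous p
        · simp only [Gτ, h, if_false]; exact memLp_cont continuous_const p
      · by_cases h : q = q₀
        · simp only [τ, Gτ, h, if_true]; exact bt_cs hθ hσ.1
        · simp [τ, Gτ, h, bt]
    have ht := (memW1p0_iff hp).1 hτ
    have hsum : MemW1p0 n N k (ball x₀ R) p (fun x q => ζ x q + τ x q)
        (fun x i q => Gζ x i q + Gτ x i q) := by
      rw [memW1p0_iff hp]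
      refine ⟨fun q => (hz.1 q).add (ht.1 q), fun i q => (hz.2.1 i q).add (ht.2.1 i q),
        fun i q σ hσ => ?_⟩
      rw [bt_add (integrable_of_memLp hp (hz.1 q)) (integrable_of_memLp hp (hz.2.1 i q))
        (integrable_of_memLp hp (ht.1 q)) (integrable_of_memLp hp (ht.2.1 i q)) hσ.1,
        hz.2.2 i q σ hσ, ht.2.2 i q σ hσ, add_zero]
    have ef : ∀ x, finner (f x) (τ x) = f x q₀ * θ x := by
      intro x; simp [finner, τ]
    have hint : IntegrableOn (fun x => finner (f x) (τ x)) (ball x₀ R) := by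
      simp only [ef]; exact int_mul_cont (hf q₀) hθ.1.continuous
    have h1 := hw _ _ hτ
    have h2 := hw _ _ hsum
    have h3 : ∫ x in ball x₀ R, finner (f x) (fun q => ζ x q + τ x q) = 0 := by
      refine integral_undef fun hi => hni ?_
      refine (hi.sub hint).congr (Eventually.of_forall fun x => ?_)
      simp [finner, mul_add, Finset.sum_add_distrib]
    have h4 : ∫ x in ball x₀ R, finner (A x) (extD (fun i q => Gζ x i q + Gτ x i q)) =
        ∫ x in ball x₀ R, finner (A x) (extD (Gτ x)) := by
      refine integral_congr_ae ?_
      filter_upwards [hd] with x hx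
      have : extD (fun i q => Gζ x i q + Gτ x i q) = extD (Gτ x) := by
        funext q; rw [extD_add, hx]; simp
      rw [this]
    rw [h4, h1, h3] at h2
    simpa only [ef] using h2
  have hf0 : ∀ q, ∀ᵐ x ∂volume.restrict (ball x₀ R), f x q = 0 := by
    intro q
    rw [ae_restrict_iff' measurableSet_ball]
    refine IsOpen.ae_eq_zero_of_integral_contDiff_smul_eq_zero isOpen_ball
      (hf q).locallyIntegrableOn fun θ h1 h2 h3 => ?_
    have := key q θ ⟨h1, h2, h3⟩
    rw [setIntegral_eq_integral_of_forall_compl_eq_zero] at this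
    · simpa only [smul_eq_mul, mul_comm] using this
    · intro x hx
      rw [image_eq_zero_of_notMem_tsupport fun h => hx (h3 h), mul_zero]
  refine hni ((integrable_zero _ _ _).congr ?_)
  filter_upwards [ae_all_iff.2 hf0] with x hx
  simp [finner, hx]

open BoundedContinuousFunction in
lemma cg_bound {μ : Measure (En n)} (F : ℕ → En n → ℝ)
    (hsum : ∀ᵐ x ∂μ, Summable fun j => ‖F j x‖)
    (hint : ∀ c : ℕ →ᵇ ℝ, Integrable (fun x => ∑' j, c j * F j x) μ) :
    ∃ C : ℝ, ∀ j, ∫ x, ‖F j x‖ ∂μ ≤ C := by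
  have hs : ∀ (c : ℕ →ᵇ ℝ) x, (Summable fun j => ‖F j x‖) → Summable fun j => c j * F j x := by
    intro c x hx
    refine Summable.of_norm_bounded (hx.mul_left ‖c‖) fun j => ?_
    rw [norm_mul]
    gcongr
    exact c.norm_coe_le_norm j
  let T : (ℕ →ᵇ ℝ) →ₗ[ℝ] Lp ℝ 1 μ :=
    { toFun := fun c => (hint c).toL1 _
      map_add' := fun c d => by
        rw [← Integrable.toL1_add, Integrable.toL1_eq_toL1_iff]
        filter_upwards [hsum] with x hx
        simp only [Pi.add_apply, coe_add, add_mul]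
        exact (hs c x hx).tsum_add (hs d x hx)
      map_smul' := fun a c => by
        rw [RingHom.id_apply, ← Integrable.toL1_smul, Integrable.toL1_eq_toL1_iff]
        filter_upwards [hsum] with x hx
        simp only [coe_smul, smul_eq_mul, mul_assoc]
        exact tsum_mul_left }
  have hTdef : ∀ c, T c = (hint c).toL1 _ := fun _ => rfl
  have hT : Continuous T := by
    refine T.continuous_of_seq_closed_graph fun u c y hu hy => ?_
    have h1 : TendstoInMeasure μ (fun m => ((T (u m) : Lp ℝ 1 μ) : En n → ℝ)) atTop y :=
      tendstoInMeasure_of_tendsto_Lp hy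
    obtain ⟨ns, hns, hae⟩ := h1.exists_seq_tendsto_ae
    have h2 : ∀ᵐ x ∂μ, ∀ m, (T (u m) : Lp ℝ 1 μ) x = ∑' j, u m j * F j x :=
      ae_all_iff.2 fun m => (hint (u m)).coeFn_toL1
    have h3 := (hint c).coeFn_toL1
    refine Lp.ext ?_
    filter_upwards [hae, h2, h3, hsum] with x hx1 hx2 hx3 hx4
    rw [hTdef, hx3]
    refine tendsto_nhds_unique hx1 ?_
    simp only [hx2]
    refine Tendsto.comp (g := fun m => ∑' j, u m j * F j x) ?_ hns.tendsto_atTop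
    refine tendsto_tsum_of_dominated_convergence (hx4.mul_left (‖c‖ + 1)) (fun j => ?_) ?_
    · have : Tendsto (fun m => u m j) atTop (nhds (c j)) :=
        ((continuous_eval_const (F := ℕ →ᵇ ℝ) j).tendsto c).comp hu
      exact this.mul_const _
    · have : ∀ᶠ m in atTop, ‖u m‖ < ‖c‖ + 1 :=
        (continuous_norm.tendsto c |>.comp hu).eventually (Iio_mem_nhds (by linarith))
      filter_upwards [this] with m hm j
      rw [norm_mul]
      gcongr
      exact ((u m).norm_coe_le_norm j).trans hm.le
  let T' : (ℕ →ᵇ ℝ) →L[ℝ] Lp ℝ 1 μ := ⟨T, hT⟩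
  refine ⟨‖T'‖, fun j => ?_⟩
  let e : ℕ →ᵇ ℝ := ofNormedAddCommGroupDiscrete (fun i => if i = j then 1 else 0) 1
    (fun i => by split_ifs <;> simp)
  have he : ‖e‖ ≤ 1 := (norm_le zero_le_one).2 fun i => by
    change ‖(if i = j then (1 : ℝ) else 0)‖ ≤ 1
    split_ifs <;> simp
  have h4 : ∀ x, ∑' i, e i * F i x = F j x := by
    intro x
    rw [tsum_eq_single j]
    · change (if j = j then (1 : ℝ) else 0) * F j x = F j x
      simp
    · intro i hi
      change (if i = j then (1 : ℝ) else 0) * F i x = 0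
      simp [hi]
  have h5 : ‖T' e‖ = ∫ x, ‖F j x‖ ∂μ := by
    change ‖(hint e).toL1 _‖ = _
    rw [L1.norm_of_fun_eq_integral_norm]
    simp only [h4]
  rw [← h5]
  calc _ ≤ ‖T'‖ * ‖e‖ := T'.le_opNorm e
    _ ≤ ‖T'‖ * 1 := by gcongr
    _ = _ := mul_one _

lemma ser_l1 {x₀ : En n} {r p : ℝ} (hp : 1 < p) {u : ℕ → En n → ℝ}
    (hu : ∀ j, AEStronglyMeasurable (u j) (volume.restrict (ball x₀ r)))
    (hs : ∑' j, eLpNorm (u j) (ENNReal.ofReal p) (volume.restrict (ball x₀ r)) ≠ ⊤)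
    {c : En n → ℝ} (hc : Continuous c) :
    ∑' j, ∫⁻ x in ball x₀ r, ‖u j x * c x‖ₑ ≠ ⊤ := by
  obtain ⟨K, hK, hK'⟩ := l1_le x₀ r hp hc
  refine ne_top_of_le_ne_top (ENNReal.mul_ne_top hK hs) ?_
  rw [← ENNReal.tsum_mul_left]
  exact ENNReal.tsum_le_tsum fun j => hK' (u j) (hu j)

lemma ser_ae {x₀ : En n} {r p : ℝ} (hp : 1 < p) {u : ℕ → En n → ℝ}
    (hu : ∀ j, AEStronglyMeasurable (u j) (volume.restrict (ball x₀ r)))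
    (hs : ∑' j, eLpNorm (u j) (ENNReal.ofReal p) (volume.restrict (ball x₀ r)) ≠ ⊤) :
    ∀ᵐ x ∂volume.restrict (ball x₀ r), Summable fun j => ‖u j x‖ := by
  have h1 := ser_l1 hp hu hs (continuous_const (y := (1 : ℝ)))
  simp only [mul_one] at h1
  rw [← lintegral_tsum fun j => (hu j).enorm] at h1
  filter_upwards [ae_lt_top' (AEMeasurable.ennreal_tsum fun j => (hu j).enorm) h1] with x hx
  have := ENNReal.tsum_coe_ne_top_iff_summable.1 (by simpa only [enorm_eq_nnnorm] using hx.ne)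
  exact NNReal.summable_coe.2 this

lemma ser_memLp {x₀ : En n} {r p : ℝ} (hp : 1 < p) {u : ℕ → En n → ℝ}
    (hu : ∀ j, AEStronglyMeasurable (u j) (volume.restrict (ball x₀ r)))
    (hs : ∑' j, eLpNorm (u j) (ENNReal.ofReal p) (volume.restrict (ball x₀ r)) ≠ ⊤) :
    MemLp (fun x => ∑' j, u j x) (ENNReal.ofReal p) (volume.restrict (ball x₀ r)) := by
  have hm : ∀ m : ℕ, AEStronglyMeasurable (∑ j ∈ Finset.range m, u j)
      (volume.restrict (ball x₀ r)) := fun m =>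
    Finset.aestronglyMeasurable_sum _ fun j _ => hu j
  have hl : ∀ᵐ x ∂volume.restrict (ball x₀ r),
      Tendsto (fun m => (∑ j ∈ Finset.range m, u j) x) atTop (nhds (∑' j, u j x)) := by
    filter_upwards [ser_ae hp hu hs] with x hx
    simp only [Finset.sum_apply]
    exact hx.of_norm.hasSum.tendsto_sum_nat
  refine ⟨aestronglyMeasurable_of_tendsto_ae _ hm hl, ?_⟩
  refine (Lp.eLpNorm_lim_le_liminf_eLpNorm hm _ hl).trans_lt (lt_of_le_of_lt ?_ hs.lt_top)
  refine liminf_le_of_frequently_le' (Frequently.of_forall fun m => ?_)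
  exact (eLpNorm_sum_le (fun j _ => hu j) (one_le_ofReal hp)).trans (ENNReal.sum_le_tsum _)

lemma ser_hasSum {x₀ : En n} {r p : ℝ} (hp : 1 < p) {u : ℕ → En n → ℝ}
    (hu : ∀ j, IntegrableOn (u j) (ball x₀ r))
    (hs : ∑' j, eLpNorm (u j) (ENNReal.ofReal p) (volume.restrict (ball x₀ r)) ≠ ⊤)
    {c : En n → ℝ} (hc : Continuous c) :
    HasSum (fun j => ∫ x in ball x₀ r, u j x * c x) (∫ x in ball x₀ r, (∑' j, u j x) * c x) := by
  have h1 := ser_l1 hp (fun j => (hu j).1) hs hc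
  have := hasSum_integral_of_summable_integral_norm (μ := volume.restrict (ball x₀ r))
    (F := fun j x => u j x * c x) (fun j => int_mul_cont (hu j) hc) ?_
  · simpa only [tsum_mul_right] using this
  · simp only [integral_norm_eq_lintegral_enorm (int_mul_cont (hu _) hc).1]
    exact ENNReal.summable_toReal h1

lemma ser_bt {x₀ : En n} {r p : ℝ} (hp : 1 < p) {u v : ℕ → En n → ℝ} {i : Fin n}
    (hu : ∀ j, IntegrableOn (u j) (ball x₀ r))
    (hs : ∑' j, eLpNorm (u j) (ENNReal.ofReal p) (volume.restrict (ball x₀ r)) ≠ ⊤)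
    (hv : ∀ j, IntegrableOn (v j) (ball x₀ r))
    (hs' : ∑' j, eLpNorm (v j) (ENNReal.ofReal p) (volume.restrict (ball x₀ r)) ≠ ⊤)
    {τ : En n → ℝ} (hτ : ContDiff ℝ (⊤ : ℕ∞) τ) :
    HasSum (fun j => bt x₀ r i (u j) (v j) τ)
      (bt x₀ r i (fun x => ∑' j, u j x) (fun x => ∑' j, v j x) τ) :=
  (ser_hasSum hp hu hs (contDiff_pd hτ i).continuous).add (ser_hasSum hp hv hs' hτ.continuous)

lemma extD_hasSum {G : ℕ → Fin n → Form n N k} {S : Fin n → Form n N k}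
    (h : ∀ i q, HasSum (fun j => G j i q) (S i q)) (q) :
    HasSum (fun j => extD (G j) q) (extD S q) := by
  unfold extD
  refine hasSum_sum fun i _ => ?_
  split_ifs
  · exact (h i _).mul_left _
  · exact hasSum_zero

open BoundedContinuousFunction in
lemma sc_sum {x₀ : En n} {r p : ℝ} {w : ℕ → En n → ℝ}
    (hs : ∑' j, 2 ^ j * eLpNorm (w j) (ENNReal.ofReal p) volume ≠ ⊤) (c : ℕ →ᵇ ℝ) :
    ∑' j, eLpNorm (fun x => c j * (2 ^ j * w j x)) (ENNReal.ofReal p)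
      (volume.restrict (ball x₀ r)) ≠ ⊤ := by
  refine ne_top_of_le_ne_top (ENNReal.mul_ne_top (enorm_ne_top (x := c)) hs) ?_
  rw [← ENNReal.tsum_mul_left]
  refine ENNReal.tsum_le_tsum fun j => ?_
  have e : (fun x => c j * (2 ^ j * w j x)) = (c j * 2 ^ j) • w j := by
    funext x; simp [mul_assoc]
  rw [e, eLpNorm_const_smul, enorm_mul, mul_assoc]
  have h1 : ‖c j‖ₑ ≤ ‖c‖ₑ := by
    rw [enorm_le_iff_norm_le]; exact c.norm_coe_le_norm j
  have h2 : ‖(2 : ℝ) ^ j‖ₑ = 2 ^ j := by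
    rw [enorm_pow]
    congr 1
    rw [Real.enorm_eq_ofReal (by norm_num)]
    simp
  rw [h2]
  gcongr
  exact Measure.restrict_le_self

lemma isTestFun_smul {S : Set (En n)} {w : En n → ℝ} (hw : IsTestFun S w) (c : ℝ) :
    IsTestFun S (fun x => c * w x) :=
  ⟨contDiff_const.mul hw.1, hw.2.1.mul_left, (tsupport_mul_subset_right).trans hw.2.2⟩

lemma pd_smul {w : En n → ℝ} (hw : ContDiff ℝ (⊤ : ℕ∞) w) (c : ℝ) (i : Fin n) (x : En n) :
    pd i (fun x => c * w x) x = c * pd i w x := by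
  have := pd_mul (j := i) (f := fun _ => c) (g := w) contDiff_const hw x
  have h2 := pd_const (n := n) i c x
  simp_all

open BoundedContinuousFunction in
lemma ser_closed {x₀ : En n} {r p : ℝ} (hp : 1 < p) {A : En n → Form n N (k + 1)}
    {f : En n → Form n N k} (hA : WSol x₀ r p A f) {Z : ℕ → En n → Form n N k}
    (hZ : ∀ j q, IsTestFun (ball x₀ r) (fun x => Z j x q))
    (hcl : ∀ j x, extD (fun i q => pd i (fun y => Z j y q) x) = 0)
    (hs : ∀ q, ∑' j, 2 ^ j * eLpNorm (fun x => Z j x q) (ENNReal.ofReal p) volume ≠ ⊤)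
    (hs' : ∀ i q, ∑' j, 2 ^ j * eLpNorm (pd i (fun x => Z j x q)) (ENNReal.ofReal p) volume ≠ ⊤)
    (c : ℕ →ᵇ ℝ) :
    IntegrableOn (fun x => finner (f x) (fun q => ∑' j, c j * (2 ^ j * Z j x q))) (ball x₀ r) := by
  have hc1 : ∀ j q, ContDiff ℝ (⊤ : ℕ∞) (fun x => c j * (2 ^ j * Z j x q)) := fun j q =>
    contDiff_const.mul (contDiff_const.mul (hZ j q).1)
  have hc2 : ∀ j i q, ContDiff ℝ (⊤ : ℕ∞)
      (fun x => c j * (2 ^ j * pd i (fun y => Z j y q) x)) := fun j i q =>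
    contDiff_const.mul (contDiff_const.mul (contDiff_pd (hZ j q).1 i))
  have hS1 := fun q => sc_sum (x₀ := x₀) (r := r) (hs q) c
  have hS2 := fun i q => sc_sum (x₀ := x₀) (r := r) (hs' i q) c
  have hζ : MemW1p0 n N k (ball x₀ r) p (fun x q => ∑' j, c j * (2 ^ j * Z j x q))
      (fun x i q => ∑' j, c j * (2 ^ j * pd i (fun y => Z j y q) x)) := by
    rw [memW1p0_iff hp]
    refine ⟨fun q => ser_memLp hp (fun j => (hc1 j q).continuous.aestronglyMeasurable) (hS1 q),
      fun i q => ser_memLp hp (fun j => (hc2 j i q).continuous.aestronglyMeasurable) (hS2 i q),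
      fun i q τ hτ => ?_⟩
    have h := ser_bt hp (i := i) (fun j => integrableOn_cont (hc1 j q).continuous) (hS1 q)
      (fun j => integrableOn_cont (hc2 j i q).continuous) (hS2 i q) hτ.1
    refine h.unique ?_
    have e : ∀ j, bt x₀ r i (fun x => c j * (2 ^ j * Z j x q))
        (fun x => c j * (2 ^ j * pd i (fun y => Z j y q) x)) τ = 0 := by
      intro j
      have := bt_cs (i := i) (isTestFun_smul (isTestFun_smul (hZ j q) (2 ^ j)) (c j)) hτ.1
      convert this using 2
      funext x
      rw [pd_smul (contDiff_const.mul (hZ j q).1), pd_smul (hZ j q).1]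
    simp only [e]
    exact hasSum_zero
  refine (closed_int hp hA hζ ?_).1
  have h1 : ∀ᵐ x ∂volume.restrict (ball x₀ r), ∀ i q,
      Summable fun j => c j * (2 ^ j * pd i (fun y => Z j y q) x) := by
    refine ae_all_iff.2 fun i => ae_all_iff.2 fun q => ?_
    filter_upwards [ser_ae hp (fun j => (hc2 j i q).continuous.aestronglyMeasurable) (hS2 i q)]
      with x hx
    exact hx.of_norm
  filter_upwards [h1] with x hx
  funext q
  have := extD_hasSum (fun i q => (hx i q).hasSum) q
  refine this.unique ?_
  have e : ∀ j, extD (fun i q => c j * (2 ^ j * pd i (fun y => Z j y q) x)) q = 0 := by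
    intro j
    rw [extD_smul, extD_smul, hcl]
    simp
  simp only [e]
  exact hasSum_zero

lemma finner_hasSum (v : Form n N k) {w : ℕ → Form n N k} {s : Form n N k}
    (h : ∀ q, HasSum (fun j => w j q) (s q)) : HasSum (fun j => finner v (w j)) (finner v s) := by
  unfold finner
  exact hasSum_sum fun q _ => (h q).mul_left _

lemma finner_smul (c : ℝ) (v w : Form n N k) :
    finner v (fun q => c * w q) = c * finner v w := by
  unfold finner
  rw [Finset.mul_sum]
  exact Finset.sum_congr rfl fun q _ => by ring

open BoundedContinuousFunction in
lemma ser_zero {x₀ : En n} {R r p : ℝ} (hRr : R ≤ r) (hp : 1 < p) {A : En n → Form n N (k + 1)}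
    {f : En n → Form n N k} (hA : WSol x₀ r p A f) {Z : ℕ → En n → Form n N k}
    (hZ : ∀ j q, IsTestFun (ball x₀ r) (fun x => Z j x q))
    (hcl : ∀ j x, extD (fun i q => pd i (fun y => Z j y q) x) = 0)
    (hs : ∀ q, ∑' j, 2 ^ j * eLpNorm (fun x => Z j x q) (ENNReal.ofReal p) volume ≠ ⊤)
    (hs' : ∀ i q, ∑' j, 2 ^ j * eLpNorm (pd i (fun x => Z j x q)) (ENNReal.ofReal p) volume ≠ ⊤)
    (h0 : ∀ j, ∫ x in ball x₀ R, finner (f x) (Z j x) = 0) :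
    IntegrableOn (fun x => finner (f x) (fun q => ∑' j, Z j x q)) (ball x₀ R) ∧
      ∫ x in ball x₀ R, finner (f x) (fun q => ∑' j, Z j x q) = 0 := by
  have hsub : ball x₀ R ⊆ ball x₀ r := ball_subset_ball hRr
  have hI := ser_closed hp hA hZ hcl hs hs'
  let one : ℕ →ᵇ ℝ := BoundedContinuousFunction.const ℕ (1 : ℝ)
  have hone : ∀ j, one j = 1 := fun _ => rfl
  have hsm : ∀ᵐ x ∂volume.restrict (ball x₀ r), ∀ q, Summable fun j => ‖2 ^ j * Z j x q‖ := by
    refine ae_all_iff.2 fun q => ?_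
    have h := sc_sum (x₀ := x₀) (r := r) (hs q) one
    simp only [hone, one_mul] at h
    exact ser_ae hp (fun j =>
      (contDiff_const.mul (hZ j q).1).continuous.aestronglyMeasurable) h
  let F : ℕ → En n → ℝ := fun j x => finner (f x) (fun q => 2 ^ j * Z j x q)
  have hFs : ∀ᵐ x ∂volume.restrict (ball x₀ r), Summable fun j => ‖F j x‖ := by
    filter_upwards [hsm] with x hx
    refine Summable.of_nonneg_of_le (fun _ => norm_nonneg _) (fun j => ?_)
      (summable_sum (s := Finset.univ) fun q _ => (hx q).mul_left ‖f x q‖)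
    simp only [F, finner]
    refine (norm_sum_le _ _).trans (le_of_eq ?_)
    simp [norm_mul]
  have hcsum : ∀ (c : ℕ →ᵇ ℝ) x, (∀ q, Summable fun j => ‖2 ^ j * Z j x q‖) →
      HasSum (fun j => c j * F j x) (finner (f x) (fun q => ∑' j, c j * (2 ^ j * Z j x q))) := by
    intro c x hx
    have h1 : ∀ q, Summable fun j => c j * (2 ^ j * Z j x q) := by
      intro q
      refine Summable.of_norm_bounded ((hx q).mul_left ‖c‖) fun j => ?_
      rw [norm_mul]
      gcongr
      exact c.norm_coe_le_norm j
    have := finner_hasSum (f x) fun q => (h1 q).hasSum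
    simpa only [finner_smul, F] using this
  obtain ⟨C, hC⟩ := cg_bound F hFs fun c => by
    refine (hI c).congr ?_
    filter_upwards [hsm] with x hx
    exact (hcsum c x hx).tsum_eq.symm
  let half : ℕ →ᵇ ℝ := ofNormedAddCommGroupDiscrete (fun j => (1 / 2 : ℝ) ^ j) 1 (fun j => by
    rw [norm_pow]; exact pow_le_one₀ (norm_nonneg _) (by norm_num [abs_le]))
  have hh : ∀ j, half j = (1 / 2) ^ j := fun _ => rfl
  have hZe : ∀ j (t : ℝ), half j * (2 ^ j * t) = t := by
    intro j t
    rw [hh, ← mul_assoc, ← mul_pow]; norm_num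
  have hint : IntegrableOn (fun x => finner (f x) (fun q => ∑' j, Z j x q)) (ball x₀ R) := by
    have := (hI half).mono_set hsub
    simpa only [hZe] using this
  refine ⟨hint, ?_⟩
  have hFZ : ∀ j x, finner (f x) (Z j x) = half j * F j x := by
    intro j x
    simp only [F, ← finner_smul, hZe]
  have hfz : ∀ j, IntegrableOn (fun x => finner (f x) (Z j x)) (ball x₀ r) := by
    intro j
    refine integrable_finsetSum _ fun q _ => ?_
    exact int_mul_cont (hA.1 q) (hZ j q).1.continuous
  have hsumm : Summable fun j => ∫ x in ball x₀ R, ‖finner (f x) (Z j x)‖ := by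
    refine Summable.of_nonneg_of_le (fun _ => integral_nonneg fun _ => norm_nonneg _) (fun j => ?_)
      ((summable_geometric_of_lt_one (r := (1 / 2 : ℝ)) (by norm_num) (by norm_num)).mul_right C)
    calc ∫ x in ball x₀ R, ‖finner (f x) (Z j x)‖ ≤ ∫ x in ball x₀ r, ‖finner (f x) (Z j x)‖ :=
        setIntegral_mono_set (hfz j).norm (Eventually.of_forall fun _ => norm_nonneg _)
          hsub.eventuallyLE
      _ = (1 / 2) ^ j * ∫ x in ball x₀ r, ‖F j x‖ := by
        rw [← integral_const_mul]
        refine integral_congr_ae (Eventually.of_forall fun x => ?_)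
        simp only [hFZ, norm_mul, hh, norm_pow]
        norm_num
      _ ≤ _ := by gcongr; exact hC j
  have key := hasSum_integral_of_summable_integral_norm (μ := volume.restrict (ball x₀ R))
    (F := fun j x => finner (f x) (Z j x)) (fun j => (hfz j).mono_set hsub) hsumm
  simp only [h0] at key
  rw [← key.unique hasSum_zero]
  refine integral_congr_ae ?_
  filter_upwards [ae_restrict_of_ae_restrict_of_subset hsub hsm] with x hx
  have := (hcsum half x hx).tsum_eq
  simp only [hZe, ← hFZ] at this
  exact this.symm

open Classical in
/-- coefficients of the exterior derivative -/
def eD (q : FormIdx n (k + 1) × Fin N) (i : Fin n) (q' : FormIdx n k × Fin N) : ℝ :=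
  if h : i ∈ q.1.1 then
    if q' = (⟨q.1.1.erase i, by simp [Finset.card_erase_of_mem h, q.1.2]⟩, q.2) then
      (-1 : ℝ) ^ (q.1.1.filter (fun j => j < i)).card else 0
  else 0

open Classical in
/-- coefficients of the codifferential -/
def cD (q : FormIdx n k × Fin N) (i : Fin n) (q' : FormIdx n (k + 1) × Fin N) : ℝ :=
  if h : i ∈ q.1.1 then 0 else
    if q' = (⟨insert i q.1.1, by simp [Finset.card_insert_of_notMem h, q.1.2]⟩, q.2) then
      -(-1 : ℝ) ^ (q.1.1.filter (fun j => j < i)).card else 0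

lemma extD_lin (G : Fin n → Form n N k) (q) : extD G q = ∑ i, ∑ q', eD q i q' * G i q' := by
  unfold extD eD
  refine Finset.sum_congr rfl fun i _ => ?_
  split_ifs with h
  · simp
  · simp

lemma codiff_lin (G : Fin n → Form n N (k + 1)) (q) :
    codiff G q = ∑ i, ∑ q', cD q i q' * G i q' := by
  unfold codiff cD
  rw [← Finset.sum_neg_distrib]
  refine Finset.sum_congr rfl fun i _ => ?_
  split_ifs with h
  · simp
  · simp

lemma pd_comm {w : En n → ℝ} (hw : ContDiff ℝ (⊤ : ℕ∞) w) (i l : Fin n) (x : En n) :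
    pd i (pd l w) x = pd l (pd i w) x := by
  have hd : Differentiable ℝ (fderiv ℝ w) :=
    (hw.fderiv_right (m := (⊤ : ℕ∞)) (by simp)).differentiable (by simp)
  have e : ∀ a b : Fin n, pd a (pd b w) x =
      fderiv ℝ (fderiv ℝ w) x (basisVec a) (basisVec b) := by
    intro a b
    unfold pd
    rw [fderiv_clm_apply (hd x) (differentiableAt_const _)]
    simp
  rw [e, e]
  exact (hw.contDiffAt.isSymmSndFDerivAt (by simp; exact WithTop.coe_le_coe.2 (le_top : (2 : ℕ∞) ≤ ⊤))) _ _

/-- exterior derivative of a smooth form -/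
def dF (η : En n → Form n N k) (x : En n) : Form n N (k + 1) :=
  extD fun l q => pd l (fun y => η y q) x

lemma contDiff_dF {η : En n → Form n N k} (hη : ∀ q, ContDiff ℝ (⊤ : ℕ∞) fun x => η x q) (q) :
    ContDiff ℝ (⊤ : ℕ∞) fun x => dF η x q := by
  simp only [dF, extD_lin]
  exact ContDiff.sum fun i _ => ContDiff.sum fun q' _ =>
    contDiff_const.mul (contDiff_pd (hη q') i)

lemma pd_dF {η : En n → Form n N k} (hη : ∀ q, ContDiff ℝ (⊤ : ℕ∞) fun x => η x q) (i : Fin n)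
    (q) (x : En n) : pd i (fun y => dF η y q) x =
      extD (fun l q' => pd i (pd l (fun y => η y q')) x) q := by
  have h1 : ∀ l q', ContDiff ℝ (⊤ : ℕ∞) fun x => eD q l q' * pd l (fun y => η y q') x :=
    fun l q' => contDiff_const.mul (contDiff_pd (hη q') l)
  simp only [dF, extD_lin]
  rw [pd_sum _ fun l => ContDiff.sum fun q' _ => h1 l q']
  refine Finset.sum_congr rfl fun l _ => ?_
  rw [pd_sum _ fun q' => h1 l q']
  refine Finset.sum_congr rfl fun q' _ => ?_
  exact pd_smul (contDiff_pd (hη q') l) _ _ _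

lemma closed_dF {η : En n → Form n N k} (hη : ∀ q, ContDiff ℝ (⊤ : ℕ∞) fun x => η x q)
    (x : En n) : extD (fun i q => pd i (fun y => dF η y q) x) = 0 := by
  simp only [pd_dF hη]
  exact extD_extD (fun i l q' => pd i (pd l (fun y => η y q')) x) fun i l => by
    funext q'; exact pd_comm (hη q') i l x

lemma tsupport_dF {η : En n → Form n N k} {K : Set (En n)} (hK : IsClosed K)
    (hη : ∀ q, tsupport (fun x => η x q) ⊆ K) (q) : tsupport (fun x => dF η x q) ⊆ K := by
  refine closure_minimal (fun x hx => ?_) hK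
  by_contra hc
  refine hx ?_
  simp only [dF, extD_lin]
  refine Finset.sum_eq_zero fun i _ => Finset.sum_eq_zero fun q' _ => ?_
  rw [image_eq_zero_of_notMem_tsupport fun h => hc (hη q' (tsupport_pd _ _ h)), mul_zero]

lemma isTestFun_dF {η : En n → Form n N k} {S : Set (En n)}
    (hη : ∀ q, IsTestFun S (fun x => η x q)) (q) : IsTestFun S (fun x => dF η x q) := by
  have hK : IsCompact (⋃ q, tsupport (fun x => η x q)) := isCompact_iUnion fun q => (hη q).2.1
  have h := tsupport_dF hK.isClosed (fun q => Set.subset_iUnion (fun q => tsupport fun x => η x q) q) q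
  exact ⟨contDiff_dF (fun q => (hη q).1) q, hK.of_isClosed_subset (isClosed_tsupport _) h,
    h.trans (Set.iUnion_subset fun q => (hη q).2.2)⟩

lemma exact_zero_test {x₀ : En n} {R p : ℝ} (hp : 1 < p) {A : En n → Form n N (k + 1 + 1)}
    {f : En n → Form n N (k + 1)} (hA : WSol x₀ R p A f) {η : En n → Form n N k}
    (hη : ∀ q, IsTestFun (ball x₀ R) (fun x => η x q)) :
    ∫ x in ball x₀ R, finner (f x) (dF η x) = 0 := by
  refine (closed_int hp hA (ζ := dF η) (Gζ := fun x i q => pd i (fun y => dF η y q) x) ?_ ?_).2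
  · rw [memW1p0_iff hp]
    refine ⟨fun q => memLp_cont (isTestFun_dF hη q).1.continuous p,
      fun i q => memLp_cont (contDiff_pd (isTestFun_dF hη q).1 i).continuous p,
      fun i q τ hτ => bt_cs (isTestFun_dF hη q) hτ.1⟩
  · exact Eventually.of_forall fun x => closed_dF (fun q => (hη q).1) x

lemma exact_zero {x₀ : En n} {R p : ℝ} (hR : 0 < R) (hp : 1 < p)
    {A : En n → Form n N (k + 1 + 1)}
    {f : En n → Form n N (k + 1)} (hA : WSol x₀ R p A f) {η : En n → Form n N k}
    (hη : ∀ q, ContDiff ℝ (⊤ : ℕ∞) (fun x => η x q))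
    (h0 : ∀ q x, rho x₀ R x = 0 → η x q = 0) :
    ∫ x in ball x₀ R, finner (f x) (dF η x) = 0 := by
  rcases isEmpty_or_nonempty (Fin n) with hn | ⟨⟨i₀⟩⟩
  · have : ∀ x, finner (f x) (dF η x) = 0 := by
      intro x
      refine Finset.sum_eq_zero fun q _ => ?_
      simp [dF, extD]
    simp [this]
  obtain ⟨M, hM0, hM⟩ := cut_bound x₀ hR
  choose C hC0 hC using fun q => le_rho hR i₀ (hη q) (h0 q)
  choose D hD0 hD using fun i q => bdd_ball x₀ R (contDiff_pd (hη q) i).continuous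
  have hcut : ∀ ε q, ContDiff ℝ (⊤ : ℕ∞) fun x => cut x₀ R ε x * η x q := fun ε q =>
    (contDiff_cut x₀ R ε).mul (hη q)
  have hlim : ∀ q, Tendsto (fun ε => ∫ x in ball x₀ R,
      f x q * dF (fun x q => cut x₀ R ε x * η x q) x q) (nhdsWithin 0 (Set.Ioi 0))
      (nhds (∫ x in ball x₀ R, f x q * dF η x q)) := by
    intro q
    refine cut_dct (hA.1 q) (fun ε x => dF (fun x q => cut x₀ R ε x * η x q) x q)
      (fun x => dF η x q) (fun ε _ => (contDiff_dF (hcut ε) q).continuous)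
      (∑ i, ∑ q', |eD q i q'| * (M * C q' + D i q')) (fun ε hε x hx => ?_) (fun x hx => ?_)
    · rw [abs_mul, mul_comm]
      gcongr
      simp only [dF, extD_lin]
      refine (Finset.abs_sum_le_sum_abs _ _).trans (Finset.sum_le_sum fun i _ => ?_)
      refine (Finset.abs_sum_le_sum_abs _ _).trans (Finset.sum_le_sum fun q' _ => ?_)
      rw [abs_mul, pd_mul (contDiff_cut x₀ R ε) (hη q')]
      gcongr
      refine (abs_add_le _ _).trans (add_le_add ?_ ?_)
      · rw [abs_mul]
        calc _ ≤ |pd i (cut x₀ R ε) x| * (C q' * rho x₀ R x) := by gcongr; exact hC q' x hx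
          _ = |pd i (cut x₀ R ε) x| * rho x₀ R x * C q' := by ring
          _ ≤ M * C q' := by
            gcongr
            · exact hC0 q'
            · exact hM ε hε i x hx
      · rw [abs_mul]
        calc _ ≤ 1 * D i q' := by
              gcongr
              · exact abs_cut_le _ _ _ _
              · exact hD i q' x hx
          _ = _ := one_mul _
    · filter_upwards [cut_ev hR hx] with ε hε
      simp only [dF, extD_lin]
      refine Finset.sum_congr rfl fun i _ => Finset.sum_congr rfl fun q' _ => ?_
      rw [pd_mul (contDiff_cut x₀ R ε) (hη q'), hε.1, hε.2]
      ring
  have e : ∀ (η : En n → Form n N k), (∀ q, ContDiff ℝ (⊤ : ℕ∞) (fun x => η x q)) →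
      ∫ x in ball x₀ R, finner (f x) (dF η x) = ∑ q, ∫ x in ball x₀ R, f x q * dF η x q := by
    intro η hη
    unfold finner
    exact integral_finsetSum _ fun q _ => int_mul_cont (hA.1 q) (contDiff_dF hη q).continuous
  rw [e η hη]
  refine tendsto_nhds_unique (tendsto_finsetSum _ fun q _ => hlim q) ?_
  refine tendsto_const_nhds.congr' ?_
  filter_upwards [ev_pos] with ε hε
  rw [← e _ (hcut ε)]
  exact (exact_zero_test hp hA fun q => isTestFun_cut hR hε (hη q)).symm

lemma bt_lin2 {ι κ : Type*} [Fintype ι] [Fintype κ] {x₀ : En n} {R : ℝ} {i : Fin n}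
    (c : ι → κ → ℝ) {w g : ι → κ → En n → ℝ} {τ : En n → ℝ}
    (hw : ∀ a b, IntegrableOn (w a b) (ball x₀ R)) (hg : ∀ a b, IntegrableOn (g a b) (ball x₀ R))
    (hτ : ContDiff ℝ (⊤ : ℕ∞) τ) :
    bt x₀ R i (fun x => ∑ a, ∑ b, c a b * w a b x) (fun x => ∑ a, ∑ b, c a b * g a b x) τ =
      ∑ a, ∑ b, c a b * bt x₀ R i (w a b) (g a b) τ := by
  have key : ∀ (w : ι → κ → En n → ℝ) (σ : En n → ℝ), Continuous σ →
      (∀ a b, IntegrableOn (w a b) (ball x₀ R)) →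
      ∫ x in ball x₀ R, (∑ a, ∑ b, c a b * w a b x) * σ x =
        ∑ a, ∑ b, c a b * ∫ x in ball x₀ R, w a b x * σ x := by
    intro w σ hσ hw
    simp only [Finset.sum_mul, mul_assoc]
    rw [integral_finsetSum]
    · refine Finset.sum_congr rfl fun a _ => ?_
      rw [integral_finsetSum]
      · exact Finset.sum_congr rfl fun b _ => integral_const_mul _ _
      · exact fun b _ => (int_mul_cont (hw a b) hσ).const_mul _
    · exact fun a _ => integrable_finsetSum _ fun b _ => (int_mul_cont (hw a b) hσ).const_mul _
  unfold bt
  rw [key w _ (contDiff_pd hτ i).continuous hw, key g _ hτ.continuous hg]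
  simp only [mul_add, Finset.sum_add_distrib]

lemma bt_tau_smul {x₀ : En n} {R : ℝ} {i : Fin n} {w g τ : En n → ℝ}
    (hτ : ContDiff ℝ (⊤ : ℕ∞) τ) (c : ℝ) :
    bt x₀ R i w g (fun x => c * τ x) = c * bt x₀ R i w g τ := by
  unfold bt
  simp only [pd_smul hτ, mul_add, ← integral_const_mul]
  congr 1 <;> congr 1 <;> funext x <;> ring

lemma bt_tau_add {x₀ : En n} {R : ℝ} {i : Fin n} {w g τ σ : En n → ℝ}
    (hw : IntegrableOn w (ball x₀ R)) (hg : IntegrableOn g (ball x₀ R))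
    (hτ : ContDiff ℝ (⊤ : ℕ∞) τ) (hσ : ContDiff ℝ (⊤ : ℕ∞) σ) :
    bt x₀ R i w g (fun x => τ x + σ x) = bt x₀ R i w g τ + bt x₀ R i w g σ := by
  unfold bt
  simp only [pd_add hτ hσ, mul_add]
  rw [integral_add (int_mul_cont hw (contDiff_pd hτ i).continuous)
    (int_mul_cont hw (contDiff_pd hσ i).continuous),
    integral_add (int_mul_cont hg hτ.continuous) (int_mul_cont hg hσ.continuous)]
  ring

lemma bt_tau_sum {ι : Type*} {x₀ : En n} {R : ℝ} {i : Fin n} {w g : En n → ℝ}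
    {τ : ι → En n → ℝ} (s : Finset ι)
    (hw : IntegrableOn w (ball x₀ R)) (hg : IntegrableOn g (ball x₀ R))
    (hτ : ∀ a, ContDiff ℝ (⊤ : ℕ∞) (τ a)) :
    bt x₀ R i w g (fun x => ∑ a ∈ s, τ a x) = ∑ a ∈ s, bt x₀ R i w g (τ a) := by
  classical
  induction s using Finset.induction_on with
  | empty => simp [bt, pd_const]
  | insert a s ha ih =>
    simp only [Finset.sum_insert ha]
    rw [bt_tau_add hw hg (hτ a) (ContDiff.sum fun b _ => hτ b), ih]

lemma bt_sq {x₀ : En n} {R : ℝ} {i : Fin n} {w g τ : En n → ℝ} (hR : 0 < R)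
    (hw : IntegrableOn w (ball x₀ R)) (hg : IntegrableOn g (ball x₀ R))
    (h : HasWeakPartial (ball x₀ R) w g i) (hτ : ContDiff ℝ (⊤ : ℕ∞) τ) :
    ∑ l, bt x₀ R i w g (fun x => (x - x₀) l * ((x - x₀) l * τ x)) = R ^ 2 * bt x₀ R i w g τ := by
  have h0 := bt_rho hR hw hg h hτ
  have hX := fun l : Fin n => (contDiff_X x₀ l).mul ((contDiff_X x₀ l).mul hτ)
  rw [← bt_tau_sum _ hw hg hX, ← bt_tau_smul hτ]
  have e : (fun x => R ^ 2 * τ x) = fun x => rho x₀ R x * τ x +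
      ∑ l, (x - x₀) l * ((x - x₀) l * τ x) := by
    funext x
    have : ∑ l, (x - x₀) l * ((x - x₀) l * τ x) = ‖x - x₀‖ ^ 2 * τ x := by
      rw [EuclideanSpace.norm_sq_eq, Finset.sum_mul]
      refine Finset.sum_congr rfl fun l _ => ?_
      rw [Real.norm_eq_abs, sq_abs]; ring
    rw [this]; unfold rho; ring
  rw [e, bt_tau_add hw hg ((contDiff_rho x₀ R).mul hτ) (ContDiff.sum fun l _ => hX l), h0, zero_add]

lemma cD_eq (q : FormIdx n k × Fin N) (i : Fin n) (Q : FormIdx n (k + 1) × Fin N) :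
    cD q i Q = - eD Q i q := by
  obtain ⟨⟨S, hS⟩, c⟩ := q
  obtain ⟨⟨T, hT⟩, d⟩ := Q
  unfold cD eD
  simp only [Prod.mk.injEq, Subtype.mk.injEq]
  by_cases h1 : i ∈ S
  · have : ∀ h : i ∈ T, ¬ (S = T.erase i ∧ c = d) := by
      rintro _ ⟨rfl, _⟩
      simp at h1
    simp [h1]
    exact fun h h' h'' => this h ⟨h', h''⟩
  · by_cases h2 : T = insert i S ∧ d = c
    · obtain ⟨rfl, rfl⟩ := h2
      have : (Finset.filter (fun j => j < i) (insert i S)) = Finset.filter (fun j => j < i) S := by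
        rw [Finset.filter_insert]; simp
      simp [h1, Finset.erase_insert h1, this]
    · have : ∀ h : i ∈ T, ¬ (S = T.erase i ∧ c = d) := by
        rintro h ⟨rfl, rfl⟩
        exact h2 ⟨(Finset.insert_erase h).symm, rfl⟩
      simp [h1, h2]
      exact fun h h' h'' => this h ⟨h', h''⟩

open Classical in
lemma tang {x₀ : En n} {R : ℝ} {φ : En n → Form n N k} {Gφ : En n → Fin n → Form n N k}
    (hφ : ∀ q, IntegrableOn (fun x => φ x q) (ball x₀ R))
    (hG : ∀ i q, IntegrableOn (fun x => Gφ x i q) (ball x₀ R))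
    (hT : TangentialZero (ball x₀ R) φ Gφ) {σ : En n → ℝ} (hσ : ContDiff ℝ (⊤ : ℕ∞) σ) :
    extD (fun i q => bt x₀ R i (fun x => φ x q) (fun x => Gφ x i q) σ) = 0 := by
  funext Q
  have h := hT (fun x q => if q = Q then σ x else 0) (fun q => by
    by_cases hq : q = Q
    · simp only [hq, if_true]; exact hσ
    · simp only [hq, if_false]; exact contDiff_const)
  have e1 : ∀ x, finner (extD (Gφ x)) (fun q => if q = Q then σ x else 0) =
      ∑ i, ∑ q, eD Q i q * (Gφ x i q * σ x) := by
    intro x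
    simp only [finner, mul_ite, mul_zero, Finset.sum_ite_eq', Finset.mem_univ, if_true]
    rw [extD_lin, Finset.sum_mul]
    refine Finset.sum_congr rfl fun i _ => ?_
    rw [Finset.sum_mul]
    exact Finset.sum_congr rfl fun i _ => by ring
  have e2 : ∀ x, finner (φ x) (codiff (smoothGrad (fun x q => if q = Q then σ x else 0) x)) =
      - ∑ i, ∑ q, eD Q i q * (φ x q * pd i σ x) := by
    intro x
    have e3 : ∀ i q, smoothGrad (fun x q => if q = Q then σ x else 0) x i q =
        if q = Q then pd i σ x else 0 := by
      intro i q
      unfold smoothGrad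
      by_cases hq : q = Q
      · simp only [hq, if_true]; rfl
      · simp [hq]
    simp only [finner, codiff_lin, e3, mul_ite, mul_zero, Finset.sum_ite_eq', Finset.mem_univ,
      if_true, cD_eq]
    rw [Finset.sum_comm, ← Finset.sum_neg_distrib]
    refine Finset.sum_congr rfl fun q _ => ?_
    rw [Finset.mul_sum, ← Finset.sum_neg_distrib]
    exact Finset.sum_congr rfl fun i _ => by ring
  simp only [e1, e2] at h
  rw [integral_neg] at h
  rw [integral_finsetSum _ fun i _ => integrable_finsetSum _ fun q _ =>
      (int_mul_cont (hG i q) hσ.continuous).const_mul _,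
    integral_finsetSum _ fun i _ => integrable_finsetSum _ fun q _ =>
      (int_mul_cont (hφ q) (contDiff_pd hσ i).continuous).const_mul _] at h
  rw [extD_lin]
  simp only [Pi.zero_apply]
  unfold bt
  simp only [mul_add, Finset.sum_add_distrib]
  have e4 : ∀ i, ∫ x in ball x₀ R, ∑ q, eD Q i q * (Gφ x i q * σ x) =
      ∑ q, eD Q i q * ∫ x in ball x₀ R, Gφ x i q * σ x := by
    intro i
    rw [integral_finsetSum _ fun q _ => (int_mul_cont (hG i q) hσ.continuous).const_mul _]
    exact Finset.sum_congr rfl fun q _ => integral_const_mul _ _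
  have e5 : ∀ i, ∫ x in ball x₀ R, ∑ q, eD Q i q * (φ x q * pd i σ x) =
      ∑ q, eD Q i q * ∫ x in ball x₀ R, φ x q * pd i σ x := by
    intro i
    rw [integral_finsetSum _ fun q _ =>
      (int_mul_cont (hφ q) (contDiff_pd hσ i).continuous).const_mul _]
    exact Finset.sum_congr rfl fun q _ => integral_const_mul _ _
  simp only [e4, e5] at h
  linarith

lemma bdry {x₀ : En n} {R : ℝ} (hR : 0 < R) {φ : En n → Form n N (k + 1)}
    {Gφ : En n → Fin n → Form n N (k + 1)}
    (hφ : ∀ q, IntegrableOn (fun x => φ x q) (ball x₀ R))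
    (hG : ∀ i q, IntegrableOn (fun x => Gφ x i q) (ball x₀ R))
    (hw : HasWeakGrad (ball x₀ R) φ Gφ)
    (hT : TangentialZero (ball x₀ R) φ Gφ) {τ : En n → ℝ} (hτ : ContDiff ℝ (⊤ : ℕ∞) τ)
    (i : Fin n) (q) :
    extD (fun l => codiff fun m S => bt x₀ R i (fun x => φ x S) (fun x => Gφ x i S)
      (fun x => (x - x₀) l * ((x - x₀) m * τ x))) q =
      - (R ^ 2 * bt x₀ R i (fun x => φ x q) (fun x => Gφ x i q) τ) := by
  have hc := cartan (fun l m S => bt x₀ R i (fun x => φ x S) (fun x => Gφ x i S)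
      (fun x => (x - x₀) l * ((x - x₀) m * τ x))) q
  have h1 : ∀ m, extD (fun l S => bt x₀ R i (fun x => φ x S) (fun x => Gφ x i S)
      (fun x => (x - x₀) l * ((x - x₀) m * τ x))) = 0 := by
    intro m
    have hσ := (contDiff_X x₀ m).mul hτ
    rw [← tang hφ hG hT ((contDiff_X x₀ i).mul hσ)]
    congr 1
    funext l S
    exact bt_rot hR (hφ S) (hG i S) (hG l S) (hw i S) (hw l S) hσ
  have h2 : codiff (fun m => extD (fun l S => bt x₀ R i (fun x => φ x S) (fun x => Gφ x i S)
      (fun x => (x - x₀) l * ((x - x₀) m * τ x)))) q = 0 := by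
    simp only [h1, codiff_lin]
    simp
  rw [h2, add_zero] at hc
  rw [hc, bt_sq hR (hφ q) (hG i q) (hw i q) hτ]

lemma memLp_mul_cont {x₀ : En n} {R p : ℝ} {w c : En n → ℝ}
    (hw : MemLp w (ENNReal.ofReal p) (volume.restrict (ball x₀ R))) (hc : Continuous c) :
    MemLp (fun x => c x * w x) (ENNReal.ofReal p) (volume.restrict (ball x₀ R)) := by
  obtain ⟨C, _, hC⟩ := bdd_ball x₀ R hc
  refine hw.of_le_mul (c := C) (hc.aestronglyMeasurable.mul hw.1) ?_
  filter_upwards [ae_restrict_mem measurableSet_ball] with z hz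
  rw [norm_mul]
  gcongr
  exact hC z hz

lemma lin_sum {ι κ : Type*} [Fintype ι] [Fintype κ] {p : ℝ} (hp : 1 < p) (c : ι → κ → ℝ)
    {w : ι → κ → ℕ → En n → ℝ} (hw : ∀ a b j, Continuous (w a b j))
    (hs : ∀ a b, ∑' j, 2 ^ j * eLpNorm (w a b j) (ENNReal.ofReal p) volume ≠ ⊤) :
    ∑' j, 2 ^ j * eLpNorm (fun x => ∑ a, ∑ b, c a b * w a b j x) (ENNReal.ofReal p) volume ≠ ⊤ := by
  have h1 : ∑ a, ∑ b, ‖c a b‖ₑ * ∑' j, 2 ^ j * eLpNorm (w a b j) (ENNReal.ofReal p) volume ≠ ⊤ :=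
    ENNReal.sum_ne_top.2 fun a _ => ENNReal.sum_ne_top.2 fun b _ =>
      ENNReal.mul_ne_top enorm_ne_top (hs a b)
  refine ne_top_of_le_ne_top h1 ?_
  simp only [← ENNReal.tsum_mul_left]
  have e1 : ∀ a, ∑ b, ∑' j, ‖c a b‖ₑ * (2 ^ j * eLpNorm (w a b j) (ENNReal.ofReal p) volume) =
      ∑' j, ∑ b, ‖c a b‖ₑ * (2 ^ j * eLpNorm (w a b j) (ENNReal.ofReal p) volume) := fun a =>
    (Summable.tsum_finsetSum fun b _ => ENNReal.summable).symm
  simp only [e1]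
  rw [← Summable.tsum_finsetSum fun b _ => ENNReal.summable]
  refine ENNReal.tsum_le_tsum fun j => ?_
  have hm : ∀ a b, AEStronglyMeasurable (fun x => c a b * w a b j x) volume := fun a b =>
    (continuous_const.mul (hw a b j)).aestronglyMeasurable
  have h2 : eLpNorm (fun x => ∑ a, ∑ b, c a b * w a b j x) (ENNReal.ofReal p) volume ≤
      ∑ a, ∑ b, ‖c a b‖ₑ * eLpNorm (w a b j) (ENNReal.ofReal p) volume := by
    have e : (fun x => ∑ a, ∑ b, c a b * w a b j x) = ∑ a, ∑ b, c a b • w a b j := by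
      funext x; simp
    rw [e]
    refine (eLpNorm_sum_le (fun a _ => ?_) (one_le_ofReal hp)).trans
      (Finset.sum_le_sum fun a _ => ?_)
    · exact Finset.aestronglyMeasurable_sum _ fun b _ => hm a b
    refine (eLpNorm_sum_le (fun b _ => hm a b) (one_le_ofReal hp)).trans
      (Finset.sum_le_sum fun b _ => ?_)
    exact (eLpNorm_const_smul (c a b) (w a b j) _ _).le
  calc _ ≤ 2 ^ j * ∑ a, ∑ b, ‖c a b‖ₑ * eLpNorm (w a b j) (ENNReal.ofReal p) volume := by gcongr
    _ = _ := by
      simp only [Finset.mul_sum]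
      refine Finset.sum_congr rfl fun a _ => Finset.sum_congr rfl fun b _ => ?_
      ring

lemma res_sum {x₀ : En n} {R p : ℝ} {w : ℕ → En n → ℝ}
    (hs : ∑' j, 2 ^ j * eLpNorm (w j) (ENNReal.ofReal p) volume ≠ ⊤) :
    ∑' j, eLpNorm (w j) (ENNReal.ofReal p) (volume.restrict (ball x₀ R)) ≠ ⊤ := by
  refine ne_top_of_le_ne_top hs (ENNReal.tsum_le_tsum fun j => ?_)
  calc _ ≤ eLpNorm (w j) (ENNReal.ofReal p) volume := eLpNorm_mono_measure _ Measure.restrict_le_self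
    _ = 1 * eLpNorm (w j) (ENNReal.ofReal p) volume := (one_mul _).symm
    _ ≤ _ := by gcongr; exact one_le_pow₀ (by norm_num)

/-- the corrector: a closed form with the same boundary values -/
lemma corrector {x₀ : En n} {R R' p : ℝ} (hR : 0 < R) (hRR : R < R') (hp : 1 < p)
    {φ : En n → Form n N (k + 1)} {Gφ : En n → Fin n → Form n N (k + 1)}
    (hφ : MemWdeltaT (ball x₀ R) p φ Gφ) :
    ∃ η : ℕ → En n → Form n N k, (∀ j q, IsTestFun (ball x₀ R') fun x => η j x q) ∧
      (∀ j q x, rho x₀ R x = 0 → η j x q = 0) ∧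
      (∀ q, ∑' j, 2 ^ j * eLpNorm (fun x => dF (η j) x q) (ENNReal.ofReal p) volume ≠ ⊤) ∧
      (∀ i q, ∑' j, 2 ^ j * eLpNorm (pd i (fun x => dF (η j) x q)) (ENNReal.ofReal p) volume ≠ ⊤) ∧
      ∀ i q (τ : En n → ℝ), ContDiff ℝ (⊤ : ℕ∞) τ →
        bt x₀ R i (fun x => ∑' j, dF (η j) x q) (fun x => ∑' j, pd i (fun x => dF (η j) x q) x) τ =
          bt x₀ R i (fun x => φ x q) (fun x => Gφ x i q) τ := by
  obtain ⟨hW, -, hT⟩ := hφ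
  obtain ⟨hw, hφ, hG⟩ := (memW1p_iff hp).1 hW
  have hφi := fun q => integrable_of_memLp hp (hφ q)
  have hGi := fun i q => integrable_of_memLp hp (hG i q)
  have hXm := fun (m : Fin n) => contDiff_X x₀ m
  let c : ℝ := 1 / (2 * R ^ 2)
  let v : FormIdx n k × Fin N → En n → ℝ := fun I x =>
    ∑ m, ∑ S, (c * cD I m S) * ((x - x₀) m * φ x S)
  let g : FormIdx n k × Fin N → Fin n → En n → ℝ := fun I i x =>
    ∑ m, ∑ S, (c * cD I m S) * (pd i (fun x => (x - x₀) m) x * φ x S + (x - x₀) m * Gφ x i S)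
  have hv1 : ∀ m S, MemLp (fun x => (x - x₀) m * φ x S) (ENNReal.ofReal p)
      (volume.restrict (ball x₀ R)) := fun m S => memLp_mul_cont (hφ S) (hXm m).continuous
  have hg1 : ∀ i m S, MemLp (fun x => pd i (fun x => (x - x₀) m) x * φ x S + (x - x₀) m * Gφ x i S)
      (ENNReal.ofReal p) (volume.restrict (ball x₀ R)) := fun i m S =>
    (memLp_mul_cont (hφ S) (contDiff_pd (hXm m) i).continuous).add
      (memLp_mul_cont (hG i S) (hXm m).continuous)
  have hv : ∀ I, MemLp (v I) (ENNReal.ofReal p) (volume.restrict (ball x₀ R)) := fun I =>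
    memLp_finsetSum _ fun m _ => memLp_finsetSum _ fun S _ => (hv1 m S).const_mul _
  have hg : ∀ I i, MemLp (g I i) (ENNReal.ofReal p) (volume.restrict (ball x₀ R)) := fun I i =>
    memLp_finsetSum _ fun m _ => memLp_finsetSum _ fun S _ => (hg1 i m S).const_mul _
  have hbt : ∀ I i (τ : En n → ℝ), ContDiff ℝ (⊤ : ℕ∞) τ → bt x₀ R i (v I) (g I i) τ =
      ∑ m, ∑ S, (c * cD I m S) * bt x₀ R i (fun x => φ x S) (fun x => Gφ x i S)
        (fun x => (x - x₀) m * τ x) := by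
    intro I i τ hτ
    have := bt_lin2 (i := i) (fun m S => c * cD I m S)
      (fun m S => integrable_of_memLp hp (hv1 m S))
      (fun m S => integrable_of_memLp hp (hg1 i m S)) hτ
    refine this.trans (Finset.sum_congr rfl fun m _ => Finset.sum_congr rfl fun S _ => ?_)
    rw [bt_prod (hφi S) (hGi i S) (hXm m) hτ]
  have hvg : ∀ I i, HasWeakPartial (ball x₀ R) (v I) (g I i) i := by
    intro I i τ hτ
    refine eq_neg_of_add_eq_zero_left ((hbt I i τ hτ.1).trans ?_)
    refine Finset.sum_eq_zero fun m _ => Finset.sum_eq_zero fun S _ => ?_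
    have : IsTestFun (ball x₀ R) (fun x => (x - x₀) m * τ x) :=
      ⟨(hXm m).mul hτ.1, hτ.2.1.mul_left, (tsupport_mul_subset_right).trans hτ.2.2⟩
    have h2 : bt x₀ R i (fun x => φ x S) (fun x => Gφ x i S) (fun x => (x - x₀) m * τ x) = 0 := by
      have h3 := hw i S _ this
      exact add_eq_zero_iff_eq_neg.2 h3
    rw [h2, mul_zero]
  choose h hsm hsupp h0 hs1 hs2 hlim using fun I =>
    trace_lift hR hRR hp (hv I) (hg I) (hvg I)
  let η : ℕ → En n → Form n N k := fun j x I => h I j x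
  have hη : ∀ j q, IsTestFun (ball x₀ R') fun x => η j x q := fun j q =>
    ⟨hsm q j, isCompact_of_isClosed_isBounded (isClosed_tsupport _)
      (isBounded_ball.subset (hsupp q j)), hsupp q j⟩
  have hηc : ∀ j q, ContDiff ℝ (⊤ : ℕ∞) fun x => η j x q := fun j q => (hη j q).1
  have hS1 : ∀ q, ∑' j, 2 ^ j * eLpNorm (fun x => dF (η j) x q) (ENNReal.ofReal p) volume ≠ ⊤ := by
    intro q
    simp only [dF, extD_lin]
    exact lin_sum hp (fun l I => eD q l I) (w := fun l I j => pd l (h I j))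
      (fun l I j => (contDiff_pd (hsm I j) l).continuous) fun l I => hs1 I l
  have hpd : ∀ i j q, pd i (fun x => dF (η j) x q) =
      fun x => ∑ l, ∑ I, eD q l I * pd i (pd l (h I j)) x := by
    intro i j q
    funext x
    rw [pd_dF (hηc j), extD_lin]
  have hS2 : ∀ i q, ∑' j, 2 ^ j * eLpNorm (pd i (fun x => dF (η j) x q))
      (ENNReal.ofReal p) volume ≠ ⊤ := by
    intro i q
    simp only [hpd]
    exact lin_sum hp (fun l I => eD q l I) (w := fun l I j => pd i (pd l (h I j)))
      (fun l I j => (contDiff_pd (contDiff_pd (hsm I j) l) i).continuous) fun l I => hs2 I i l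
  refine ⟨η, hη, fun j q x hx => h0 q j x hx, hS1, hS2, fun i q τ hτ => ?_⟩
  have hsum := ser_bt (x₀ := x₀) (r := R) hp (i := i)
    (fun j => integrableOn_cont (contDiff_dF (hηc j) q).continuous) (res_sum (hS1 q))
    (fun j => integrableOn_cont (contDiff_pd (contDiff_dF (hηc j) q) i).continuous)
    (res_sum (hS2 i q)) hτ
  refine tendsto_nhds_unique hsum.tendsto_sum_nat ?_
  have e1 : ∀ j, bt x₀ R i (fun x => dF (η j) x q) (pd i (fun x => dF (η j) x q)) τ =
      ∑ l, ∑ I, eD q l I * bt x₀ R i (pd l (h I j)) (pd i (pd l (h I j))) τ := by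
    intro j
    rw [hpd]
    simp only [dF, extD_lin]
    exact bt_lin2 (fun l I => eD q l I)
      (fun l I => integrableOn_cont (contDiff_pd (hsm I j) l).continuous)
      (fun l I => integrableOn_cont (contDiff_pd (contDiff_pd (hsm I j) l) i).continuous) hτ
  have e2 : ∀ M : ℕ, ∑ j ∈ Finset.range M,
      bt x₀ R i (fun x => dF (η j) x q) (pd i (fun x => dF (η j) x q)) τ =
      ∑ l, ∑ I, eD q l I * ∑ j ∈ Finset.range M,
        bt x₀ R i (pd l (h I j)) (pd i (pd l (h I j))) τ := by
    intro M
    simp only [e1]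
    rw [Finset.sum_comm]
    refine Finset.sum_congr rfl fun l _ => ?_
    rw [Finset.sum_comm]
    exact Finset.sum_congr rfl fun I _ => (Finset.mul_sum _ _ _).symm
  refine Tendsto.congr (fun M => (e2 M).symm) ?_
  have hl : Tendsto (fun M : ℕ => ∑ l, ∑ I, eD q l I * ∑ j ∈ Finset.range M,
      bt x₀ R i (pd l (h I j)) (pd i (pd l (h I j))) τ) atTop
      (nhds (∑ l, ∑ I, eD q l I * bt x₀ R i (v I) (g I i) (fun x => pd l (rho x₀ R) x * τ x))) :=
    tendsto_finsetSum _ fun l _ => tendsto_finsetSum _ fun I _ => (hlim I i l τ hτ).const_mul _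
  convert hl using 2
  have hb := bdry hR hφi hGi hw hT hτ i q
  have e3 : ∀ l I, bt x₀ R i (v I) (g I i) (fun x => pd l (rho x₀ R) x * τ x) =
      -(1 / R ^ 2) * codiff (fun m S => bt x₀ R i (fun x => φ x S) (fun x => Gφ x i S)
        (fun x => (x - x₀) l * ((x - x₀) m * τ x))) I := by
    intro l I
    rw [hbt I i _ ((contDiff_pd (contDiff_rho x₀ R) l).mul hτ), codiff_lin, Finset.mul_sum]
    refine Finset.sum_congr rfl fun m _ => ?_
    rw [Finset.mul_sum]
    refine Finset.sum_congr rfl fun S _ => ?_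
    have e4 : (fun x => (x - x₀) m * (pd l (rho x₀ R) x * τ x)) =
        fun x => (-2) * ((x - x₀) l * ((x - x₀) m * τ x)) := by
      funext x; rw [pd_rho]; ring
    rw [e4, bt_tau_smul ((hXm l).mul ((hXm m).mul hτ))]
    simp only [c]
    field_simp
  simp only [e3]
  have e5 : ∑ l, ∑ I, eD q l I * (-(1 / R ^ 2) * codiff (fun m S => bt x₀ R i (fun x => φ x S)
      (fun x => Gφ x i S) (fun x => (x - x₀) l * ((x - x₀) m * τ x))) I) =
      -(1 / R ^ 2) * extD (fun l => codiff (fun m S => bt x₀ R i (fun x => φ x S)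
      (fun x => Gφ x i S) (fun x => (x - x₀) l * ((x - x₀) m * τ x)))) q := by
    rw [extD_lin, Finset.mul_sum]
    refine Finset.sum_congr rfl fun l _ => ?_
    rw [Finset.mul_sum]
    exact Finset.sum_congr rfl fun S _ => by ring
  rw [e5, hb]
  field_simp

lemma main_succ {x₀ : En n} {R R' p : ℝ} (hR : 0 < R) (hRR : R < R') (hp : 1 < p)
    {A : En n → Form n N (k + 1 + 1)} {f : En n → Form n N (k + 1)}
    (hA : WSol x₀ R p A f) (hA' : WSol x₀ R' p A f)
    {φ : En n → Form n N (k + 1)} {Gφ : En n → Fin n → Form n N (k + 1)}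
    (hφ : MemWdeltaT (ball x₀ R) p φ Gφ) :
    ∫ x in ball x₀ R, finner (A x) (extD (Gφ x)) = ∫ x in ball x₀ R, finner (f x) (φ x) := by
  obtain ⟨η, hη, h0, hS1, hS2, hbt⟩ := corrector hR hRR hp hφ
  obtain ⟨hw, hφp, hGp⟩ := (memW1p_iff hp).1 hφ.1
  have hηc : ∀ j q, ContDiff ℝ (⊤ : ℕ∞) fun x => η j x q := fun j q => (hη j q).1
  obtain ⟨hi, hz⟩ := ser_zero hRR.le hp hA' (Z := fun j => dF (η j))
    (fun j q => isTestFun_dF (hη j) q) (fun j x => closed_dF (hηc j) x) hS1 hS2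
    (fun j => exact_zero hR hp hA (hηc j) (h0 j))
  have hm1 : ∀ j q, AEStronglyMeasurable (fun x => dF (η j) x q) (volume.restrict (ball x₀ R)) :=
    fun j q => (contDiff_dF (hηc j) q).continuous.aestronglyMeasurable
  have hm2 : ∀ j i q, AEStronglyMeasurable (pd i fun x => dF (η j) x q)
      (volume.restrict (ball x₀ R)) :=
    fun j i q => (contDiff_pd (contDiff_dF (hηc j) q) i).continuous.aestronglyMeasurable
  have hζ1 := fun q => ser_memLp (x₀ := x₀) (r := R) hp (fun j => hm1 j q) (res_sum (hS1 q))
  have hζ2 := fun i q => ser_memLp (x₀ := x₀) (r := R) hp (fun j => hm2 j i q) (res_sum (hS2 i q))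
  have hθ : MemW1p0 n N (k + 1) (ball x₀ R) p (fun x q => φ x q - ∑' j, dF (η j) x q)
      (fun x i q => Gφ x i q - ∑' j, pd i (fun x => dF (η j) x q) x) := by
    rw [memW1p0_iff hp]
    refine ⟨fun q => (hφp q).sub (hζ1 q), fun i q => (hGp i q).sub (hζ2 i q), fun i q τ hτ => ?_⟩
    rw [bt_sub (integrable_of_memLp hp (hφp q)) (integrable_of_memLp hp (hGp i q))
      (integrable_of_memLp hp (hζ1 q)) (integrable_of_memLp hp (hζ2 i q)) hτ.1,
      hbt i q τ hτ.1, sub_self]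
  have hmain := hA.2 _ _ hθ
  have hcl : ∀ᵐ x ∂volume.restrict (ball x₀ R),
      extD (fun i q => ∑' j, pd i (fun x => dF (η j) x q) x) = 0 := by
    have h1 : ∀ᵐ x ∂volume.restrict (ball x₀ R), ∀ i q,
        Summable fun j => pd i (fun x => dF (η j) x q) x := by
      refine ae_all_iff.2 fun i => ae_all_iff.2 fun q => ?_
      filter_upwards [ser_ae hp (fun j => hm2 j i q) (res_sum (hS2 i q))] with x hx
      exact hx.of_norm
    filter_upwards [h1] with x hx
    funext q
    refine (extD_hasSum (fun i q => (hx i q).hasSum) q).unique ?_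
    simp only [closed_dF (hηc _)]
    exact hasSum_zero
  have e1 : ∫ x in ball x₀ R, finner (A x) (extD (fun i q => Gφ x i q -
      ∑' j, pd i (fun x => dF (η j) x q) x)) = ∫ x in ball x₀ R, finner (A x) (extD (Gφ x)) := by
    refine integral_congr_ae ?_
    filter_upwards [hcl] with x hx
    have : extD (fun i q => Gφ x i q - ∑' j, pd i (fun x => dF (η j) x q) x) = extD (Gφ x) := by
      funext q
      have h2 := extD_add (fun i q => Gφ x i q - ∑' j, pd i (fun x => dF (η j) x q) x)
        (fun i q => ∑' j, pd i (fun x => dF (η j) x q) x) q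
      simp only [sub_add_cancel] at h2
      rw [hx, Pi.zero_apply, add_zero] at h2
      exact h2.symm
    rw [this]
  rw [e1] at hmain
  rw [hmain]
  have e2 : ∀ x, finner (f x) (fun q => φ x q - ∑' j, dF (η j) x q) =
      finner (f x) (φ x) - finner (f x) (fun q => ∑' j, dF (η j) x q) := by
    intro x
    simp only [finner, mul_sub, Finset.sum_sub_distrib]
  simp only [e2]
  by_cases hfi : IntegrableOn (fun x => finner (f x) (φ x)) (ball x₀ R)
  · rw [integral_sub hfi hi, hz, sub_zero]
  · rw [integral_undef hfi, integral_undef]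
    intro h
    refine hfi ((h.add hi).congr (Eventually.of_forall fun x => ?_))
    simp

lemma main_zero {x₀ : En n} {R p : ℝ} (hp : 1 < p)
    {A : En n → Form n N (0 + 1)} {f : En n → Form n N 0}
    (hA : WSol x₀ R p A f)
    {φ : En n → Form n N 0} {Gφ : En n → Fin n → Form n N 0}
    (hφ : MemWdeltaT (ball x₀ R) p φ Gφ) :
    ∫ x in ball x₀ R, finner (A x) (extD (Gφ x)) = ∫ x in ball x₀ R, finner (f x) (φ x) := by
  obtain ⟨hw, hφp, hGp⟩ := (memW1p_iff hp).1 hφ.1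
  refine hA.2 _ _ ((memW1p0_iff hp).2 ⟨hφp, hGp, fun i q τ hτ => ?_⟩)
  have h := tang (fun q => integrable_of_memLp hp (hφp q))
    (fun i q => integrable_of_memLp hp (hGp i q)) hφ.2.2 hτ.1
  have h2 := congrFun h (⟨{i}, by simp⟩, q.2)
  obtain ⟨⟨S, hS⟩, c⟩ := q
  obtain rfl := Finset.card_eq_zero.1 hS
  simp only [extD, Pi.zero_apply] at h2
  rw [Finset.sum_eq_single i (fun b _ hb => by simp [hb]) (by simp)] at h2
  simpa [Finset.filter_singleton] using h2

lemma wsol_of {Ω : Set (En n)} {p : ℝ} {A : En n → Form n N (k + 1)} {f : En n → Form n N k}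
    (hf_meas : ∀ q, AEStronglyMeasurable (fun x => f x q) (volume.restrict Ω))
    (hf_int : ∀ K, K ⊆ Ω → IsCompact K → IntegrableOn (fun x => fnorm (f x)) K volume)
    (hweak : ∀ (x₀ : En n) (R : ℝ), 0 < R → closure (ball x₀ R) ⊆ Ω →
      ∀ ψ Gψ, MemW1p0 n N k (ball x₀ R) p ψ Gψ →
        ∫ x in ball x₀ R, finner (A x) (extD (Gψ x)) =
          ∫ x in ball x₀ R, finner (f x) (ψ x))
    {x₀ : En n} {R : ℝ} (hR : 0 < R) (hB : closure (ball x₀ R) ⊆ Ω) : WSol x₀ R p A f := by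
  refine ⟨fun q => ?_, hweak x₀ R hR hB⟩
  have h := (hf_int _ hB isBounded_ball.isCompact_closure).mono_set subset_closure
  refine Integrable.mono h ((hf_meas q).mono_measure
    (Measure.restrict_mono (subset_closure.trans hB) le_rfl)) (Eventually.of_forall fun x => ?_)
  unfold fnorm
  rw [Real.norm_of_nonneg (Real.sqrt_nonneg _), Real.norm_eq_abs]
  refine Real.abs_le_sqrt ?_
  exact Finset.single_le_sum (f := fun q => f x q ^ 2) (fun q _ => sq_nonneg _)
    (Finset.mem_univ q)

lemma bigger {Ω : Set (En n)} (hΩ : IsOpen Ω) {x₀ : En n} {R : ℝ} (hR : 0 < R)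
    (hB : closure (ball x₀ R) ⊆ Ω) : ∃ R', R < R' ∧ closure (ball x₀ R') ⊆ Ω := by
  obtain ⟨δ, hδ, h⟩ := (isBounded_ball (x := x₀) (r := R)).isCompact_closure.exists_cthickening_subset_open
    hΩ hB
  refine ⟨R + δ, by linarith, ?_⟩
  refine closure_ball_subset_closedBall.trans (Set.Subset.trans ?_ h)
  rw [closure_ball x₀ hR.ne', cthickening_closedBall hδ.le hR.le, add_comm]

/-- **Enlarging the space of test functions.** If `u ∈ W^{1,p}_loc(Ω)` satisfies the
weak formulation `∫_{B_R} ⟨a(x)|du|^{p-2}du ; dψ⟩ = ∫_{B_R} ⟨f ; ψ⟩` for all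
`ψ ∈ W^{1,p}_0(B_R)` and all balls `B_R ⊂⊂ Ω`, then it also satisfies
`∫_{B_R} ⟨a(x)|du|^{p-2}du ; dφ⟩ = ∫_{B_R} ⟨f ; φ⟩` for all
`φ ∈ W^{1,p}_{δ,T}(B_R)`. -/
theorem enlarging_the_space_of_test_functions
    (n N k : ℕ) (Ω : Set (En n)) (hΩ : IsOpen Ω) (p : ℝ) (hp : 1 < p)
    (a : En n → ℝ)
    (f : En n → Form n N k)
    (hf_meas : ∀ q, AEStronglyMeasurable (fun x => f x q) (volume.restrict Ω))
    (hf_int : ∀ K, K ⊆ Ω → IsCompact K → IntegrableOn (fun x => fnorm (f x)) K volume)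
    (u : En n → Form n N k) (G : En n → Fin n → Form n N k)
    (hu : MemW1pLoc Ω p u G)
    (hweak : ∀ (x₀ : En n) (R : ℝ), 0 < R → closure (ball x₀ R) ⊆ Ω →
      ∀ ψ Gψ, MemW1p0 n N k (ball x₀ R) p ψ Gψ →
        ∫ x in ball x₀ R, finner (nl p (a x) (extD (G x))) (extD (Gψ x)) =
          ∫ x in ball x₀ R, finner (f x) (ψ x)) :
    ∀ (x₀ : En n) (R : ℝ), 0 < R → closure (ball x₀ R) ⊆ Ω →
      ∀ φ Gφ, MemWdeltaT (ball x₀ R) p φ Gφ →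
        ∫ x in ball x₀ R, finner (nl p (a x) (extD (G x))) (extD (Gφ x)) =
          ∫ x in ball x₀ R, finner (f x) (φ x) := by
  intro x₀ R hR hB φ Gφ hφ
  have hA := wsol_of hf_meas hf_int hweak hR hB
  cases k with
  | zero => exact main_zero hp hA hφ
  | succ k =>
    obtain ⟨R', hRR, hB'⟩ := bigger hΩ hR hB
    have hA' := wsol_of hf_meas hf_int hweak (hR.trans hRR) hB'
    exact main_succ hR hRR hp hA hA' hφ
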